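/- arXiv:1706.01698 — 4 statements merged into one kernel-verified Lean document; each statement's English description precedes it below -/
import Mathlib

section
/- Let τ ∈ (0, (1+√5)/2), suppose ½Σ̂_f + 𝒮 + σ𝒜𝒜* ≻ 0 and ½Σ̂_g + 𝒯 + σℬℬ* ≻ 0, and let {(y^k, z^k, x^k)}_{k≥0} be a sequence generated by the majorized iPADMM. Suppose the sequence u^k = (y^k, z^k, x^k) converges to a KKT point ū and that the KKT mapping ℛ is metrically subregular at (ū, 0) ∈ gph ℛ with modulus η > 0. Then there exist μ ∈ (0, 1) and an integer k₀ ≥ 1 such that for all k ≥ k₀: dist²_ℳ(u^{k+1}, Ω̄) + ‖z^{k+1} − z^k‖²_{Σ̂_g + 𝒯} ≤ μ[dist²_ℳ(u^k, Ω̄) + ‖z^k − z^{k−1}‖²_{Σ̂_g + 𝒯}]; moreover, there exists μ̂ ∈ [μ, 1) such that this inequality with μ̂ in place of μ holds for all k ≥ 1. -/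
open scoped RealInnerProductSpace

noncomputable section

/-- the quadratic form `‖w‖²_M := ⟨w, M w⟩` of a linear operator. -/
def quadForm {E : Type*} [NormedAddCommGroup E] [InnerProductSpace ℝ E]
    (M : E →ₗ[ℝ] E) (w : E) : ℝ := ⟪w, M w⟫

/-- convexity of a function with values in `ℝ ∪ {±∞}`. -/
def ERConvex {E : Type*} [AddCommGroup E] [Module ℝ E] (p : E → EReal) : Prop :=
  ∀ x y : E, ∀ a b : ℝ, 0 ≤ a → 0 ≤ b → a + b = 1 →
    p (a • x + b • y) ≤ (a : EReal) * p x + (b : EReal) * p y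

/-- properness of a function with values in `ℝ ∪ {±∞}`: nowhere `−∞`, somewhere finite. -/
def ERProper {E : Type*} (p : E → EReal) : Prop :=
  (∃ x, p x ≠ ⊤) ∧ ∀ x, p x ≠ ⊥

/-- `g` belongs to the convex subdifferential `∂p(x)`. -/
def ERSubgrad {E : Type*} [NormedAddCommGroup E] [InnerProductSpace ℝ E]
    (p : E → EReal) (x g : E) : Prop :=
  ∀ w, p x + ((⟪g, w - x⟫ : ℝ) : EReal) ≤ p w

/-- the set `Ω̄` of KKT points of the problem `min p(y) + f(y) + q(z) + g(z)`
subject to `𝒜*y + ℬ*z = c`. -/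
def KKTset {X Y Z : Type*}
    [NormedAddCommGroup X] [InnerProductSpace ℝ X] [FiniteDimensional ℝ X]
    [NormedAddCommGroup Y] [InnerProductSpace ℝ Y] [FiniteDimensional ℝ Y]
    [NormedAddCommGroup Z] [InnerProductSpace ℝ Z] [FiniteDimensional ℝ Z]
    (A : X →ₗ[ℝ] Y) (B : X →ₗ[ℝ] Z) (c : X)
    (gradf : Y → Y) (gradg : Z → Z) (p : Y → EReal) (q : Z → EReal) :
    Set (Y × Z × X) :=
  {u | ERSubgrad p u.1 (-(gradf u.1 + A u.2.2)) ∧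
       ERSubgrad q u.2.1 (-(gradg u.2.1 + B u.2.2)) ∧
       LinearMap.adjoint A u.1 + LinearMap.adjoint B u.2.1 = c}

section QuadraticForms

variable {E : Type*} [NormedAddCommGroup E] [InnerProductSpace ℝ E]

lemma quadForm_add_left (M N : E →ₗ[ℝ] E) (w : E) :
    quadForm (M + N) w = quadForm M w + quadForm N w := by
  simp [quadForm, inner_add_right]

lemma quadForm_smul_left (a : ℝ) (M : E →ₗ[ℝ] E) (w : E) :
    quadForm (a • M) w = a * quadForm M w := by
  simp [quadForm, inner_smul_right]

lemma quadForm_smul_right (a : ℝ) (M : E →ₗ[ℝ] E) (w : E) :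
    quadForm M (a • w) = a ^ 2 * quadForm M w := by
  simp [quadForm, inner_smul_right, inner_smul_left]; ring

lemma quadForm_comp_adjoint {X : Type*} [NormedAddCommGroup X] [InnerProductSpace ℝ X]
    [FiniteDimensional ℝ X] [FiniteDimensional ℝ E] (A : X →ₗ[ℝ] E) (w : E) :
    quadForm (A ∘ₗ LinearMap.adjoint A) w = ‖LinearMap.adjoint A w‖ ^ 2 := by
  rw [quadForm, LinearMap.comp_apply, ← LinearMap.adjoint_inner_left, real_inner_self_eq_norm_sq]

/-- polarization of a symmetric quadratic form along three points. -/
lemma two_mul_inner_apply_sub {M : E →ₗ[ℝ] E} (hM : M.IsSymmetric) (a b d : E) :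
    2 * ⟪M (a - b), a - d⟫
      = quadForm M (a - d) - quadForm M (b - d) + quadForm M (a - b) := by
  have h (v w : E) : ⟪v, M w⟫ = ⟪w, M v⟫ := by rw [← hM, real_inner_comm]
  simp only [quadForm, map_sub, inner_sub_left, inner_sub_right, real_inner_comm _ (M _)]
  rw [h a b, h d a, h d b]; ring

lemma two_mul_inner_apply_le {M : E →ₗ[ℝ] E} (hM : M.IsSymmetric)
    (hpos : ∀ w, 0 ≤ quadForm M w) (a b : E) :
    2 * ⟪M a, b⟫ ≤ quadForm M a + quadForm M b := by
  have h := hpos (a - b)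
  have h1 : ⟪a, M b⟫ = ⟪M a, b⟫ := (hM a b).symm
  have h2 : ⟪b, M a⟫ = ⟪M a, b⟫ := real_inner_comm _ _
  simp only [quadForm, map_sub, inner_sub_left, inner_sub_right] at h ⊢
  linarith

lemma exists_quadForm_le [FiniteDimensional ℝ E] (M : E →ₗ[ℝ] E) :
    ∃ K : ℝ, 0 ≤ K ∧ ∀ w, quadForm M w ≤ K * ‖w‖ ^ 2 := by
  refine ⟨‖M.toContinuousLinearMap‖, norm_nonneg _, fun w => ?_⟩
  calc quadForm M w ≤ ‖w‖ * ‖M w‖ := real_inner_le_norm _ _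
    _ ≤ ‖w‖ * (‖M.toContinuousLinearMap‖ * ‖w‖) := by
        gcongr; exact M.toContinuousLinearMap.le_opNorm w
    _ = _ := by ring

lemma exists_mul_norm_sq_le_quadForm [FiniteDimensional ℝ E] (M : E →ₗ[ℝ] E)
    (hM : ∀ w, w ≠ 0 → 0 < quadForm M w) :
    ∃ κ : ℝ, 0 < κ ∧ ∀ w, κ * ‖w‖ ^ 2 ≤ quadForm M w := by
  rcases subsingleton_or_nontrivial E with hE | hE
  · exact ⟨1, one_pos, fun w => by simp [Subsingleton.elim w 0, quadForm]⟩
  have hc : Continuous (quadForm M) :=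
    continuous_id.inner M.continuous_of_finiteDimensional
  obtain ⟨v, hv, hmin⟩ := (isCompact_sphere (0 : E) 1).exists_isMinOn
    (NormedSpace.sphere_nonempty.mpr zero_le_one) hc.continuousOn
  have hv1 : ‖v‖ = 1 := by simpa using hv
  refine ⟨quadForm M v, hM v (by rintro rfl; simp at hv1), fun w => ?_⟩
  rcases eq_or_ne w 0 with rfl | hw
  · simp [quadForm]
  have hw0 : ‖w‖ ≠ 0 := by simpa using hw
  have h := hmin (show ‖w‖⁻¹ • w ∈ Metric.sphere (0 : E) 1 by simp [norm_smul, hw0])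
  rw [Set.mem_ofPred_eq, quadForm_smul_right] at h
  calc quadForm M v * ‖w‖ ^ 2 ≤ ‖w‖⁻¹ ^ 2 * quadForm M w * ‖w‖ ^ 2 := by gcongr
    _ = quadForm M w := by field_simp

lemma exists_norm_apply_le {F : Type*} [NormedAddCommGroup F] [InnerProductSpace ℝ F]
    [FiniteDimensional ℝ E] (M : E →ₗ[ℝ] F) :
    ∃ K : ℝ, 0 ≤ K ∧ ∀ w, ‖M w‖ ≤ K * ‖w‖ :=
  ⟨‖M.toContinuousLinearMap‖, norm_nonneg _, M.toContinuousLinearMap.le_opNorm⟩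

/-- cocoercivity of the gradient of a convex function majorized by the quadratic form of `M`. -/
lemma two_mul_inner_sub_quadForm_le {f : E → ℝ} {G : E → E} {M : E →ₗ[ℝ] E}
    (hlow : ∀ w w', f w' + ⟪G w', w - w'⟫ ≤ f w)
    (hup : ∀ w w', f w ≤ f w' + ⟪G w', w - w'⟫ + 1 / 2 * quadForm M (w - w')) (a b v : E) :
    2 * ⟪G a - G b, v⟫ - quadForm M v ≤ ⟪G a - G b, a - b⟫ := by
  have h1 := hlow (a - v) b
  have h2 := hup (a - v) a
  have h3 := hlow (b + v) a
  have h4 := hup (b + v) b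
  have hneg : quadForm M (-v) = quadForm M v := by simp [quadForm]
  simp only [sub_sub_cancel_left, add_sub_cancel_left, hneg] at h2 h4
  simp only [inner_sub_left, inner_sub_right, inner_add_right, inner_neg_right] at *
  linarith

lemma neg_quadForm_le_inner_gradient {f : E → ℝ} {G : E → E} {M : E →ₗ[ℝ] E}
    (hlow : ∀ w w', f w' + ⟪G w', w - w'⟫ ≤ f w)
    (hup : ∀ w w', f w ≤ f w' + ⟪G w', w - w'⟫ + 1 / 2 * quadForm M (w - w')) (a b w : E) :
    -(1 / 4) * quadForm M (w - a) ≤ ⟪G a - G b, w - b⟫ := by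
  have h := two_mul_inner_sub_quadForm_le hlow hup a b ((-(1 / 2) : ℝ) • (w - a))
  rw [inner_smul_right, quadForm_smul_right] at h
  have e : w - b = (w - a) + (a - b) := by abel
  rw [e, inner_add_right]
  linarith

/-- the increments of a gradient, corrected by a metric dominating half of the majorant. -/
lemma two_mul_inner_apply_sub_gradient_le {g : E → ℝ} {G : E → E} {M T : E →ₗ[ℝ] E}
    (hlow : ∀ w w', g w' + ⟪G w', w - w'⟫ ≤ g w)
    (hup : ∀ w w', g w ≤ g w' + ⟪G w', w - w'⟫ + 1 / 2 * quadForm M (w - w'))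
    (hM : M.IsSymmetric) (hT : T.IsSymmetric)
    (hMT : ∀ w, -(1 / 2) * quadForm M w ≤ quadForm T w) (a b w : E) :
    2 * ⟪(M + T) (a - b) - (G a - G b), w⟫
      ≤ quadForm (M + T) (a - b) + quadForm (M + T) w := by
  have h := neg_quadForm_le_inner_gradient hlow hup a b (a + w - (a - b))
  rw [show a + w - (a - b) - b = w by abel, show a + w - (a - b) - a = w - (a - b) by abel] at h
  have hN : ((1 / 2 : ℝ) • M + T).IsSymmetric := by
    refine LinearMap.IsSymmetric.add (fun v v' => ?_) hT
    simp [inner_smul_left, inner_smul_right, hM v v']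
  have h' := two_mul_inner_apply_le hN
    (fun v => by rw [quadForm_add_left, quadForm_smul_left]; linarith [hMT v]) (a - b) w
  have hp := two_mul_inner_apply_sub hM w (a - b) 0
  simp only [sub_zero, map_sub M w, inner_sub_left (M w)] at hp
  rw [show ⟪M w, w⟫ = quadForm M w from real_inner_comm _ _] at hp
  simp only [quadForm_add_left, quadForm_smul_left, LinearMap.add_apply, LinearMap.smul_apply,
    inner_add_left, inner_smul_left, inner_sub_left _ (G a - G b)] at *
  simp only [conj_trivial] at h'
  linarith

end QuadraticForms

section Subgradients

variable {E : Type*} [NormedAddCommGroup E] [InnerProductSpace ℝ E] {p : E → EReal}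

lemma ERSubgrad.ne_top (hp : ERProper p) {a s : E} (h : ERSubgrad p a s) : p a ≠ ⊤ := by
  obtain ⟨w, hw⟩ := hp.1
  intro ha
  have := h w
  rw [ha, EReal.top_add_coe, top_le_iff] at this
  exact hw this

lemma ERSubgrad.inner_sub_nonneg (hp : ERProper p) {a b s t : E}
    (ha : ERSubgrad p a s) (hb : ERSubgrad p b t) : 0 ≤ ⟪s - t, a - b⟫ := by
  have h1 := ha b
  have h2 := hb a
  have ha' := ha.ne_top hp
  have hb' := hb.ne_top hp
  lift p a to ℝ using ⟨ha', hp.2 a⟩ with α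
  lift p b to ℝ using ⟨hb', hp.2 b⟩ with β
  norm_cast at h1 h2
  simp only [inner_sub_left, inner_sub_right] at *
  linarith

/-- first-order optimality for the sum of a convex function and a quadratic one. -/
lemma ERSubgrad.of_isMin_add_quadratic (hp : ERProper p) (hconv : ERConvex p) {h : E → ℝ}
    {a s : E} {K : E → ℝ} (ha : p a ≠ ⊤)
    (hquad : ∀ w (t : ℝ), h (a + t • (w - a)) = h a - t * ⟪s, w - a⟫ + t ^ 2 * K w)
    (hmin : ∀ w, p a + (h a : EReal) ≤ p w + (h w : EReal)) : ERSubgrad p a s := by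
  intro w
  by_cases hw : p w = ⊤
  · simp [hw]
  have key : ∀ t : ℝ, 0 < t → t ≤ 1 → (p a).toReal + ⟪s, w - a⟫ ≤ (p w).toReal + t * K w := by
    intro t ht ht1
    have h1 := hmin (a + t • (w - a))
    have h2 := hconv a w (1 - t) t (by linarith) ht.le (by ring)
    rw [show (1 - t) • a + t • w = a + t • (w - a) by module] at h2
    rw [hquad] at h1
    have hbot := hp.2 (a + t • (w - a))
    lift p a to ℝ using ⟨ha, hp.2 a⟩ with α
    lift p w to ℝ using ⟨hw, hp.2 w⟩ with ω
    have htop : p (a + t • (w - a)) ≠ ⊤ := by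
      refine ne_top_of_le_ne_top ?_ h2
      norm_cast
      exact EReal.coe_ne_top _
    lift p (a + t • (w - a)) to ℝ using ⟨htop, hbot⟩ with π
    norm_cast at h1 h2
    simp only [EReal.toReal_coe]
    have : t * (α + ⟪s, w - a⟫) ≤ t * (ω + t * K w) := by nlinarith
    exact le_of_mul_le_mul_left this ht
  have hlim : (p a).toReal + ⟪s, w - a⟫ ≤ (p w).toReal := by
    have htend : Filter.Tendsto (fun t : ℝ => (p w).toReal + t * K w)
        (nhdsWithin 0 (Set.Ioi 0)) (nhds ((p w).toReal + 0 * K w)) :=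
      (Continuous.tendsto (by fun_prop) 0).mono_left nhdsWithin_le_nhds
    rw [zero_mul, add_zero] at htend
    refine ge_of_tendsto htend ?_
    filter_upwards [Ioc_mem_nhdsGT one_pos] with t ht using key t ht.1 ht.2
  lift p a to ℝ using ⟨ha, hp.2 a⟩ with α
  lift p w to ℝ using ⟨hw, hp.2 w⟩ with ω
  exact_mod_cast hlim

/-- first-order optimality of a proximal step. -/
lemma ERSubgrad.of_prox (hp : ERProper p) (hconv : ERConvex p) {v a : E}
    (hmin : ∀ w, p a + ((1 / 2 * ‖a - v‖ ^ 2 : ℝ) : EReal)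
      ≤ p w + ((1 / 2 * ‖w - v‖ ^ 2 : ℝ) : EReal)) : ERSubgrad p a (v - a) := by
  have ha : p a ≠ ⊤ := by
    obtain ⟨w, hw⟩ := hp.1
    intro ha
    have := hmin w
    rw [ha, EReal.top_add_coe, top_le_iff] at this
    exact (EReal.add_lt_top hw (EReal.coe_ne_top _)).ne this
  refine ERSubgrad.of_isMin_add_quadratic hp hconv (h := fun w => 1 / 2 * ‖w - v‖ ^ 2)
    (K := fun w => 1 / 2 * ‖w - a‖ ^ 2) ha (fun w t => ?_) hmin
  have e : a + t • (w - a) - v = (a - v) + t • (w - a) := by abel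
  simp only [e, norm_add_sq_real, inner_smul_right, norm_smul, mul_pow, Real.norm_eq_abs, sq_abs]
  rw [← neg_sub a v, inner_neg_left]
  ring

/-- first-order optimality of a linearized proximal augmented Lagrangian step. -/
lemma ERSubgrad.of_augmented_step {X : Type*} [NormedAddCommGroup X] [InnerProductSpace ℝ X]
    [FiniteDimensional ℝ X] [FiniteDimensional ℝ E]
    (hp : ERProper p) (hconv : ERConvex p) (A : X →ₗ[ℝ] E) {M : E →ₗ[ℝ] E} (hM : M.IsSymmetric)
    {a a₀ l : E} {d : X} {σ : ℝ} (ha : p a ≠ ⊤)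
    (hmin : ∀ w, p a + ((⟪a, l⟫ + σ / 2 * ‖LinearMap.adjoint A a + d‖ ^ 2
        + 1 / 2 * quadForm M (a - a₀) : ℝ) : EReal)
      ≤ p w + ((⟪w, l⟫ + σ / 2 * ‖LinearMap.adjoint A w + d‖ ^ 2
        + 1 / 2 * quadForm M (w - a₀) : ℝ) : EReal)) :
    ERSubgrad p a (-(l + σ • A (LinearMap.adjoint A a + d) + M (a - a₀))) := by
  refine ERSubgrad.of_isMin_add_quadratic hp hconv
    (h := fun w => ⟪w, l⟫ + σ / 2 * ‖LinearMap.adjoint A w + d‖ ^ 2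
        + 1 / 2 * quadForm M (w - a₀))
    (K := fun w => σ / 2 * ‖LinearMap.adjoint A (w - a)‖ ^ 2 + 1 / 2 * quadForm M (w - a))
    ha (fun w t => ?_) hmin
  have e1 : a + t • (w - a) - a₀ = (a - a₀) + t • (w - a) := by abel
  have e2 : LinearMap.adjoint A (a + t • (w - a)) + d
      = (LinearMap.adjoint A a + d) + t • LinearMap.adjoint A (w - a) := by
    rw [map_add, map_smul]; abel
  have e3 : quadForm M ((a - a₀) + t • (w - a))
      = quadForm M (a - a₀) + 2 * t * ⟪M (a - a₀), w - a⟫ + t ^ 2 * quadForm M (w - a) := by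
    rw [quadForm, map_add, map_smul, inner_add_left, inner_add_right, inner_add_right,
      inner_smul_right, inner_smul_left, inner_smul_left, inner_smul_right, ← hM (a - a₀) (w - a),
      real_inner_comm (M (a - a₀)) (w - a)]
    simp only [conj_trivial, quadForm]
    ring
  simp only [e1, e2, e3, norm_add_sq_real, norm_smul, mul_pow, Real.norm_eq_abs, sq_abs,
    inner_add_left, inner_neg_left, inner_smul_left, inner_smul_right, conj_trivial,
    ← LinearMap.adjoint_inner_right A]
  rw [real_inner_comm l (w - a)]
  ring

/-- the proximal residual at `a` is bounded by the defect of any subgradient at `a`. -/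
lemma norm_sub_prox_le (hp : ERProper p) (hconv : ERConvex p) {a s ξ b : E}
    (ha : ERSubgrad p a s)
    (hmin : ∀ w, p b + ((1 / 2 * ‖b - (a - ξ)‖ ^ 2 : ℝ) : EReal)
      ≤ p w + ((1 / 2 * ‖w - (a - ξ)‖ ^ 2 : ℝ) : EReal)) : ‖a - b‖ ≤ ‖s + ξ‖ := by
  have h := ha.inner_sub_nonneg hp (ERSubgrad.of_prox hp hconv hmin)
  have e : s - (a - ξ - b) = (s + ξ) - (a - b) := by abel
  rw [e, inner_sub_left, real_inner_self_eq_norm_sq] at h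
  have h' := real_inner_le_norm (s + ξ) (a - b)
  rcases (norm_nonneg (a - b)).eq_or_lt with h0 | h0
  · rw [← h0]; exact norm_nonneg _
  · exact le_of_mul_le_mul_right (by nlinarith) h0

end Subgradients

section LinearRate

/-- a contraction factor valid at finitely many indices can be chosen uniformly. -/
lemma exists_uniform_factor {Ψ : ℕ → ℝ} (hΨ : ∀ k, 0 ≤ Ψ k) {μ : ℝ} (hμ : μ < 1)
    (h : ∀ k, 1 ≤ k → ∃ ν < 1, Ψ (k + 1) ≤ ν * Ψ k) (n : ℕ) :
    ∃ ν, μ ≤ ν ∧ ν < 1 ∧ ∀ k, 1 ≤ k → k < n → Ψ (k + 1) ≤ ν * Ψ k := by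
  induction n with
  | zero => exact ⟨μ, le_rfl, hμ, fun k _ hk => absurd hk (Nat.not_lt_zero k)⟩
  | succ n ih =>
    obtain ⟨ν, hν, hν1, H⟩ := ih
    rcases Nat.eq_zero_or_pos n with rfl | hn
    · exact ⟨ν, hν, hν1, fun k hk hk' => by omega⟩
    obtain ⟨ν', hν', H'⟩ := h n hn
    refine ⟨max ν ν', hν.trans (le_max_left _ _), max_lt hν1 hν', fun k hk hkn => ?_⟩
    rcases Nat.lt_succ_iff_lt_or_eq.mp hkn with hlt | rfl
    · exact (H k hk hlt).trans (mul_le_mul_of_nonneg_right (le_max_left _ _) (hΨ k))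
    · exact H'.trans (mul_le_mul_of_nonneg_right (le_max_right _ _) (hΨ k))

/-- a descent inequality together with an eventual error bound yields a linear rate. -/
lemma exists_linear_rate {Ψ D : ℕ → ℝ} (hΨ : ∀ k, 0 ≤ Ψ k) (hD : ∀ k, 0 ≤ D k)
    (hdesc : ∀ k, 1 ≤ k → Ψ (k + 1) ≤ Ψ k - D k) {κ : ℝ} (hκ : 0 < κ)
    (hbound : ∀ᶠ k in Filter.atTop, Ψ (k + 1) ≤ κ * D k)
    (hzero : ∀ k, D k = 0 → Ψ (k + 1) = 0) :
    ∃ μ : ℝ, 0 < μ ∧ μ < 1 ∧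
      (∃ k₀ : ℕ, 1 ≤ k₀ ∧ ∀ k : ℕ, k₀ ≤ k → Ψ (k + 1) ≤ μ * Ψ k) ∧
      (∃ μh : ℝ, μ ≤ μh ∧ μh < 1 ∧ ∀ k : ℕ, 1 ≤ k → Ψ (k + 1) ≤ μh * Ψ k) := by
  obtain ⟨n, hn⟩ := Filter.eventually_atTop.mp hbound
  have hμ1 : κ / (1 + κ) < 1 := by rw [div_lt_one (by linarith)]; linarith
  have htail : ∀ k, n + 1 ≤ k → Ψ (k + 1) ≤ κ / (1 + κ) * Ψ k := by
    intro k hk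
    have h1 := hdesc k (by omega)
    have h2 := hn k (by omega)
    rw [div_mul_eq_mul_div, le_div_iff₀ (by linarith)]
    nlinarith
  have hone : ∀ k, 1 ≤ k → ∃ ν < 1, Ψ (k + 1) ≤ ν * Ψ k := by
    intro k hk
    rcases (hD k).eq_or_lt with h0 | h0
    · exact ⟨0, one_pos, by rw [hzero k h0.symm, zero_mul]⟩
    · have h1 := hdesc k hk
      have hpos : 0 < Ψ k := by linarith [hΨ (k + 1)]
      refine ⟨1 - D k / Ψ k, by linarith [div_pos h0 hpos], ?_⟩
      rw [sub_mul, one_mul, div_mul_cancel₀ _ hpos.ne']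
      exact h1
  refine ⟨κ / (1 + κ), by positivity, hμ1, ⟨n + 1, by omega, htail⟩, ?_⟩
  obtain ⟨ν, hν, hν1, H⟩ := exists_uniform_factor hΨ hμ1 hone (n + 1)
  refine ⟨ν, hν, hν1, fun k hk => ?_⟩
  rcases lt_or_ge k (n + 1) with hlt | hge
  · exact H k hk hlt
  · exact (htail k hge).trans (mul_le_mul_of_nonneg_right hν (hΨ k))

end LinearRate

section StepLength

variable {τ : ℝ}

lemma stepLength_slack_pos (h0 : 0 < τ) (h1 : τ < (1 + Real.sqrt 5) / 2) :
    0 < (1 - τ + min τ τ⁻¹) / 2 := by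
  rcases le_total τ 1 with h | h
  · rw [min_eq_left (h.trans ((one_le_inv₀ h0).mpr h))]; linarith
  · rw [min_eq_right ((inv_le_one_of_one_le₀ h).trans h)]
    have h5 : Real.sqrt 5 ^ 2 = 5 := Real.sq_sqrt (by norm_num)
    have hs := Real.sqrt_nonneg 5
    have hq : 0 < 1 + τ - τ ^ 2 := by nlinarith
    have e : 1 - τ + τ⁻¹ = (1 + τ - τ ^ 2) / τ := by field_simp; ring
    rw [e]; positivity

lemma stepLength_weight_nonneg (h1 : τ < (1 + Real.sqrt 5) / 2) :
    0 ≤ (5 - τ - 3 * min τ τ⁻¹) / 4 := by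
  have hs : Real.sqrt 5 < 3 := by
    rw [Real.sqrt_lt' (by norm_num)]; norm_num
  rcases le_total τ 1 with h | h
  · linarith [min_le_left τ τ⁻¹]
  · linarith [min_le_right τ τ⁻¹, inv_le_one_of_one_le₀ h]

lemma stepLength_cross_le {X : Type*} [NormedAddCommGroup X] [InnerProductSpace ℝ X]
    (h0 : 0 < τ) (r b : X) :
    2 * (1 - τ) * ⟪r, b⟫
      ≤ ((5 - τ - 3 * min τ τ⁻¹) / 4 - (1 - τ + min τ τ⁻¹) / 2 / 2) * ‖r‖ ^ 2
        + (1 - 2 * ((1 - τ + min τ τ⁻¹) / 2) * τ) * ‖b‖ ^ 2 := by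
  rcases le_total τ 1 with h | h
  · rw [min_eq_left (h.trans ((one_le_inv₀ h0).mpr h))]
    have hn := sq_nonneg ‖r - b‖
    rw [norm_sub_sq_real] at hn
    nlinarith [mul_nonneg (sub_nonneg.mpr h) hn]
  · rw [min_eq_right ((inv_le_one_of_one_le₀ h).trans h)]
    have hn := sq_nonneg ‖r + τ • b‖
    rw [norm_add_sq_real, norm_smul, mul_pow, Real.norm_eq_abs, sq_abs, inner_smul_right] at hn
    have hm := mul_nonneg (mul_nonneg (sub_nonneg.mpr h) (inv_pos.mpr h0).le) hn
    have e : (τ - 1) * τ⁻¹ * (‖r‖ ^ 2 + 2 * (τ * ⟪r, b⟫) + τ ^ 2 * ‖b‖ ^ 2)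
        = (1 - τ⁻¹) * ‖r‖ ^ 2 + 2 * (τ - 1) * ⟪r, b⟫ + (τ ^ 2 - τ) * ‖b‖ ^ 2 := by
      field_simp
    have e2 : τ⁻¹ * τ = 1 := inv_mul_cancel₀ h0.ne'
    rw [e] at hm
    linear_combination hm + ‖b‖ ^ 2 * e2

end StepLength

/-- the algebraic identity behind the descent of the multiplier part. -/
lemma multiplier_identity {X : Type*} [NormedAddCommGroup X] [InnerProductSpace ℝ X]
    {σ τ : ℝ} (hσ : 0 < σ) (hτ : 0 < τ) (ξ r b β : X) :
    2 * ⟪ξ + σ • (r - b), r - β⟫ + 2 * ⟪ξ + σ • r, β⟫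
      = (τ * σ)⁻¹ * ‖ξ + (τ * σ) • r‖ ^ 2 - (τ * σ)⁻¹ * ‖ξ‖ ^ 2 + (2 - τ) * σ * ‖r‖ ^ 2
        - 2 * σ * ⟪r, b⟫ + σ * (‖β‖ ^ 2 - ‖β - b‖ ^ 2 + ‖b‖ ^ 2) := by
  rw [norm_add_sq_real ξ, norm_sub_sq_real β b, norm_smul, mul_pow, Real.norm_eq_abs, sq_abs]
  simp only [inner_add_left, inner_sub_left, inner_sub_right, inner_smul_left, inner_smul_right,
    conj_trivial, real_inner_self_eq_norm_sq]
  rw [real_inner_comm r b, real_inner_comm β b]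
  field_simp
  ring

section Descent

variable {X Y Z : Type*}
  [NormedAddCommGroup X] [InnerProductSpace ℝ X] [FiniteDimensional ℝ X]
  [NormedAddCommGroup Y] [InnerProductSpace ℝ Y]
  [NormedAddCommGroup Z] [InnerProductSpace ℝ Z] [FiniteDimensional ℝ Z]

/-- the guaranteed decrease of the Lyapunov function in one iteration, in terms of the increments
`dy`, `dz` and the new and old feasibility residuals `r₁`, `r₀`. -/
def decrement (B : X →ₗ[ℝ] Z) (N : Y →ₗ[ℝ] Y) (O : Z →ₗ[ℝ] Z) (σ τ t : ℝ)
    (dy : Y) (dz : Z) (r₁ r₀ : X) : ℝ :=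
  quadForm N dy + quadForm O dz
    + σ * (2 * t * τ * ‖LinearMap.adjoint B dz‖ ^ 2 + 3 / 2 * t * ‖r₁‖ ^ 2 + 1 / 2 * t * ‖r₀‖ ^ 2)

lemma decrement_nonneg (B : X →ₗ[ℝ] Z) {N : Y →ₗ[ℝ] Y} {O : Z →ₗ[ℝ] Z} {σ τ t : ℝ}
    (hN : ∀ w, 0 ≤ quadForm N w) (hO : ∀ w, 0 ≤ quadForm O w)
    (hσ : 0 < σ) (hτ : 0 < τ) (ht : 0 < t) (dy : Y) (dz : Z) (r₁ r₀ : X) :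
    0 ≤ decrement B N O σ τ t dy dz r₁ r₀ := by
  have := hN dy
  have := hO dz
  rw [decrement]
  positivity

variable [FiniteDimensional ℝ Y]

/-- the quadratic form of the metric `ℳ`, for proximal metrics `P`, `Q` and weight `s`. -/
def metricForm (A : X →ₗ[ℝ] Y) (B : X →ₗ[ℝ] Z) (P : Y →ₗ[ℝ] Y) (Q : Z →ₗ[ℝ] Z) (σ τ s : ℝ)
    (dy : Y) (dz : Z) (dx : X) : ℝ :=
  quadForm P dy + quadForm (Q + σ • (B ∘ₗ LinearMap.adjoint B)) dz + (τ * σ)⁻¹ * ‖dx‖ ^ 2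
    + s * σ * ‖LinearMap.adjoint A dy + LinearMap.adjoint B dz‖ ^ 2

lemma metricForm_nonneg (A : X →ₗ[ℝ] Y) (B : X →ₗ[ℝ] Z) {P : Y →ₗ[ℝ] Y} {Q : Z →ₗ[ℝ] Z}
    {σ τ s : ℝ} (hP : ∀ w, 0 ≤ quadForm P w) (hQ : ∀ w, 0 ≤ quadForm Q w)
    (hσ : 0 < σ) (hτ : 0 < τ) (hs : 0 ≤ s) (dy : Y) (dz : Z) (dx : X) :
    0 ≤ metricForm A B P Q σ τ s dy dz dx := by
  rw [metricForm, quadForm_add_left, quadForm_smul_left, quadForm_comp_adjoint]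
  have := hP dy
  have := hQ dz
  positivity

lemma exists_metricForm_le (A : X →ₗ[ℝ] Y) (B : X →ₗ[ℝ] Z) (P : Y →ₗ[ℝ] Y) (Q : Z →ₗ[ℝ] Z)
    {σ τ s : ℝ} (hσ : 0 < σ) (hτ : 0 < τ) (hs : 0 ≤ s) :
    ∃ K : ℝ, 0 < K ∧ ∀ dy dz dx, metricForm A B P Q σ τ s dy dz dx
      ≤ K * (‖dy‖ ^ 2 + ‖dz‖ ^ 2 + ‖dx‖ ^ 2) := by
  obtain ⟨KP, hKP, HP⟩ := exists_quadForm_le P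
  obtain ⟨KQ, hKQ, HQ⟩ := exists_quadForm_le (Q + σ • (B ∘ₗ LinearMap.adjoint B))
  obtain ⟨KA, hKA, HA⟩ := exists_norm_apply_le (LinearMap.adjoint A)
  obtain ⟨KB, hKB, HB⟩ := exists_norm_apply_le (LinearMap.adjoint B)
  refine ⟨KP + KQ + (τ * σ)⁻¹ + s * σ * (2 * KA ^ 2 + 2 * KB ^ 2), by positivity,
    fun dy dz dx => ?_⟩
  have h1 : ‖LinearMap.adjoint A dy + LinearMap.adjoint B dz‖ ^ 2
      ≤ 2 * KA ^ 2 * ‖dy‖ ^ 2 + 2 * KB ^ 2 * ‖dz‖ ^ 2 := by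
    calc _ ≤ (KA * ‖dy‖ + KB * ‖dz‖) ^ 2 := by
          gcongr
          exact (norm_add_le _ _).trans (add_le_add (HA dy) (HB dz))
      _ ≤ _ := by nlinarith [sq_nonneg (KA * ‖dy‖ - KB * ‖dz‖)]
  have h2 := mul_le_mul_of_nonneg_left h1 (mul_nonneg hs hσ.le)
  rw [metricForm]
  have h3 := HP dy
  have h4 := HQ dz
  have hm : 0 < (τ * σ)⁻¹ := by positivity
  have hsσ : 0 ≤ s * σ := by positivity
  have e : (KP + KQ + (τ * σ)⁻¹ + s * σ * (2 * KA ^ 2 + 2 * KB ^ 2))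
        * (‖dy‖ ^ 2 + ‖dz‖ ^ 2 + ‖dx‖ ^ 2)
      = KP * ‖dy‖ ^ 2 + KQ * ‖dz‖ ^ 2 + (τ * σ)⁻¹ * ‖dx‖ ^ 2
        + s * σ * (2 * KA ^ 2 * ‖dy‖ ^ 2 + 2 * KB ^ 2 * ‖dz‖ ^ 2)
        + (KP * (‖dz‖ ^ 2 + ‖dx‖ ^ 2) + KQ * (‖dy‖ ^ 2 + ‖dx‖ ^ 2)
          + (τ * σ)⁻¹ * (‖dy‖ ^ 2 + ‖dz‖ ^ 2)
          + s * σ * (2 * KA ^ 2 * (‖dz‖ ^ 2 + ‖dx‖ ^ 2)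
            + 2 * KB ^ 2 * (‖dy‖ ^ 2 + ‖dx‖ ^ 2))) := by ring
  rw [e]
  have : 0 ≤ KP * (‖dz‖ ^ 2 + ‖dx‖ ^ 2) + KQ * (‖dy‖ ^ 2 + ‖dx‖ ^ 2)
          + (τ * σ)⁻¹ * (‖dy‖ ^ 2 + ‖dz‖ ^ 2)
          + s * σ * (2 * KA ^ 2 * (‖dz‖ ^ 2 + ‖dx‖ ^ 2)
            + 2 * KB ^ 2 * (‖dy‖ ^ 2 + ‖dx‖ ^ 2)) := by positivity
  linarith

/-- the decrement controls the increments and the new feasibility residual. -/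
lemma exists_norm_sq_le_decrement (A : X →ₗ[ℝ] Y) (B : X →ₗ[ℝ] Z)
    {N : Y →ₗ[ℝ] Y} {O : Z →ₗ[ℝ] Z} {σ τ t : ℝ}
    (hN : ∀ w, 0 ≤ quadForm N w) (hO : ∀ w, 0 ≤ quadForm O w)
    (hσ : 0 < σ) (hτ : 0 < τ) (ht : 0 < t)
    (hposY : ∀ w, w ≠ 0 → 0 < quadForm (N + σ • (A ∘ₗ LinearMap.adjoint A)) w)
    (hposZ : ∀ w, w ≠ 0 → 0 < quadForm (O + σ • (B ∘ₗ LinearMap.adjoint B)) w) :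
    ∃ C : ℝ, 0 < C ∧ ∀ dy dz r₁ r₀,
      LinearMap.adjoint A dy + LinearMap.adjoint B dz = r₁ - r₀ →
      ‖dy‖ ^ 2 + ‖dz‖ ^ 2 + ‖r₁‖ ^ 2 ≤ C * decrement B N O σ τ t dy dz r₁ r₀ := by
  obtain ⟨κ₁, hκ₁, H₁⟩ := exists_mul_norm_sq_le_quadForm _ hposY
  obtain ⟨κ₂, hκ₂, H₂⟩ := exists_mul_norm_sq_le_quadForm _ hposZ
  refine ⟨κ₁⁻¹ * (1 + 3 * (2 / 3 / t + 2 / t + 1 / (2 * t * τ)))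
    + κ₂⁻¹ * (1 + 1 / (2 * t * τ)) + 2 / 3 / (t * σ), by positivity,
    fun dy dz r₁ r₀ hr => ?_⟩
  set D := decrement B N O σ τ t dy dz r₁ r₀ with hDdef
  set β := ‖LinearMap.adjoint B dz‖ ^ 2 with hβ
  have h1 := hN dy
  have h2 := hO dz
  have hβ0 : 0 ≤ β := by positivity
  have hr1 : 0 ≤ ‖r₁‖ ^ 2 := by positivity
  have hr0 : 0 ≤ ‖r₀‖ ^ 2 := by positivity
  have hD : D = quadForm N dy + quadForm O dz + σ * (2 * t * τ * β) + σ * (3 / 2 * t * ‖r₁‖ ^ 2)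
      + σ * (1 / 2 * t * ‖r₀‖ ^ 2) := by rw [hDdef, decrement]; ring
  have p1 : 0 ≤ σ * (2 * t * τ * β) := by positivity
  have p2 : 0 ≤ σ * (3 / 2 * t * ‖r₁‖ ^ 2) := by positivity
  have p3 : 0 ≤ σ * (1 / 2 * t * ‖r₀‖ ^ 2) := by positivity
  have b1 : σ * β ≤ 1 / (2 * t * τ) * D := by
    rw [div_mul_eq_mul_div, le_div_iff₀ (by positivity)]; linarith
  have b2 : σ * ‖r₁‖ ^ 2 ≤ 2 / 3 / t * D := by
    rw [div_mul_eq_mul_div, le_div_iff₀ (by positivity)]; linarith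
  have b3 : σ * ‖r₀‖ ^ 2 ≤ 2 / t * D := by
    rw [div_mul_eq_mul_div, le_div_iff₀ (by positivity)]; linarith
  have b4 : ‖r₁‖ ^ 2 ≤ 2 / 3 / (t * σ) * D := by
    rw [div_mul_eq_mul_div, le_div_iff₀ (by positivity)]; linarith
  have hA : ‖LinearMap.adjoint A dy‖ ^ 2 ≤ 3 * (‖r₁‖ ^ 2 + ‖r₀‖ ^ 2 + β) := by
    have e : LinearMap.adjoint A dy = r₁ - r₀ - LinearMap.adjoint B dz := by
      rw [← hr]; abel
    have hle : ‖LinearMap.adjoint A dy‖ ≤ ‖r₁‖ + ‖r₀‖ + ‖LinearMap.adjoint B dz‖ := by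
      rw [e]
      exact (norm_sub_le _ _).trans (by gcongr; exact norm_sub_le _ _)
    have := pow_le_pow_left₀ (norm_nonneg _) hle 2
    nlinarith [sq_nonneg (‖r₁‖ - ‖r₀‖), sq_nonneg (‖r₁‖ - ‖LinearMap.adjoint B dz‖),
      sq_nonneg (‖r₀‖ - ‖LinearMap.adjoint B dz‖)]
  have hA' := mul_le_mul_of_nonneg_left hA hσ.le
  have q1 := H₁ dy
  have q2 := H₂ dz
  rw [quadForm_add_left, quadForm_smul_left, quadForm_comp_adjoint] at q1 q2
  have c1 : ‖dy‖ ^ 2 ≤ κ₁⁻¹ * ((1 + 3 * (2 / 3 / t + 2 / t + 1 / (2 * t * τ))) * D) := by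
    rw [← div_eq_inv_mul, le_div_iff₀ hκ₁]; linarith
  have c2 : ‖dz‖ ^ 2 ≤ κ₂⁻¹ * ((1 + 1 / (2 * t * τ)) * D) := by
    rw [← div_eq_inv_mul, le_div_iff₀ hκ₂]; linarith
  linarith

variable {A : X →ₗ[ℝ] Y} {B : X →ₗ[ℝ] Z} {c : X} {f : Y → ℝ} {g : Z → ℝ}
  {gradf : Y → Y} {gradg : Z → Z} {Sfh S : Y →ₗ[ℝ] Y} {Sgh T : Z →ₗ[ℝ] Z} {σ τ : ℝ}

/-- the one-step descent inequality of the majorized iPADMM, expressed through the monotonicity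
inequalities of the two subproblems. -/
lemma ipadmm_descent
    (hflow : ∀ w w', f w' + ⟪gradf w', w - w'⟫ ≤ f w)
    (hfup : ∀ w w', f w ≤ f w' + ⟪gradf w', w - w'⟫ + 1 / 2 * quadForm Sfh (w - w'))
    (hglow : ∀ w w', g w' + ⟪gradg w', w - w'⟫ ≤ g w)
    (hgup : ∀ w w', g w ≤ g w' + ⟪gradg w', w - w'⟫ + 1 / 2 * quadForm Sgh (w - w'))
    (hSfh : Sfh.IsSymmetric) (hS : S.IsSymmetric) (hSgh : Sgh.IsSymmetric) (hT : T.IsSymmetric)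
    (hTlow : ∀ w, -(1 / 2) * quadForm Sgh w ≤ quadForm T w)
    (hσ : 0 < σ) (hτ : 0 < τ)
    {y₀ y₁ yb : Y} {zm z₀ z₁ zb : Z} {xm x₀ x₁ xb r₀ r₁ : X}
    (hr₀ : r₀ = LinearMap.adjoint A y₀ + LinearMap.adjoint B z₀ - c)
    (hr₁ : r₁ = LinearMap.adjoint A y₁ + LinearMap.adjoint B z₁ - c)
    (hb : LinearMap.adjoint A yb + LinearMap.adjoint B zb = c)
    (hx₀ : x₀ = xm + (τ * σ) • r₀) (hx₁ : x₁ = x₀ + (τ * σ) • r₁)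
    (hy : ⟪gradf y₀ - gradf yb
      + A (x₀ + σ • (r₁ - LinearMap.adjoint B (z₁ - z₀)) - xb)
      + (Sfh + S) (y₁ - y₀), y₁ - yb⟫ ≤ 0)
    (hz : ⟪gradg z₀ - gradg zb + B (x₀ + σ • r₁ - xb) + (Sgh + T) (z₁ - z₀), z₁ - zb⟫ ≤ 0)
    (hzz : ⟪gradg z₀ - gradg zm + B (x₀ + σ • r₁ - (xm + σ • r₀))
      + (Sgh + T) (z₁ - z₀ - (z₀ - zm)), z₁ - z₀⟫ ≤ 0) :
    metricForm A B (Sfh + S) (Sgh + T) σ τ ((5 - τ - 3 * min τ τ⁻¹) / 4)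
        (y₁ - yb) (z₁ - zb) (x₁ - xb) + quadForm (Sgh + T) (z₁ - z₀)
      ≤ metricForm A B (Sfh + S) (Sgh + T) σ τ ((5 - τ - 3 * min τ τ⁻¹) / 4)
          (y₀ - yb) (z₀ - zb) (x₀ - xb) + quadForm (Sgh + T) (z₀ - zm)
        - decrement B ((1 / 2 : ℝ) • Sfh + S) ((1 / 2 : ℝ) • Sgh + T) σ τ
          ((1 - τ + min τ τ⁻¹) / 2) (y₁ - y₀) (z₁ - z₀) r₁ r₀ := by
  have hgf := neg_quadForm_le_inner_gradient hflow hfup y₀ yb y₁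
  have hgg := neg_quadForm_le_inner_gradient hglow hgup z₀ zb z₁
  have hggz := two_mul_inner_apply_sub_gradient_le hglow hgup hSgh hT hTlow z₀ zm (z₁ - z₀)
  have hpy := two_mul_inner_apply_sub (hSfh.add hS) y₁ y₀ yb
  have hpz := two_mul_inner_apply_sub (hSgh.add hT) z₁ z₀ zb
  have e₁ : LinearMap.adjoint A (y₁ - yb) + LinearMap.adjoint B (z₁ - zb) = r₁ := by
    rw [hr₁, ← hb, map_sub, map_sub]; abel
  have e₀ : LinearMap.adjoint A (y₀ - yb) + LinearMap.adjoint B (z₀ - zb) = r₀ := by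
    rw [hr₀, ← hb, map_sub, map_sub]; abel
  have eA : LinearMap.adjoint A (y₁ - yb) = r₁ - LinearMap.adjoint B (z₁ - zb) := by
    rw [← e₁]; abel
  have eB : LinearMap.adjoint B (z₀ - zb)
      = LinearMap.adjoint B (z₁ - zb) - LinearMap.adjoint B (z₁ - z₀) := by
    rw [← map_sub]; congr 1; abel
  have hid := multiplier_identity hσ hτ (x₀ - xb) r₁ (LinearMap.adjoint B (z₁ - z₀))
    (LinearMap.adjoint B (z₁ - zb))
  have hcross := mul_le_mul_of_nonneg_left
    (stepLength_cross_le hτ r₀ (LinearMap.adjoint B (z₁ - z₀))) hσ.le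
  have ex : x₁ - xb = x₀ - xb + (τ * σ) • r₁ := by rw [hx₁]; abel
  have exy : x₀ + σ • (r₁ - LinearMap.adjoint B (z₁ - z₀)) - xb
      = x₀ - xb + σ • (r₁ - LinearMap.adjoint B (z₁ - z₀)) := by abel
  have exz : x₀ + σ • r₁ - xb = x₀ - xb + σ • r₁ := by abel
  have exx : x₀ + σ • r₁ - (xm + σ • r₀) = σ • r₁ - ((1 - τ) * σ) • r₀ := by rw [hx₀]; module
  rw [inner_add_left, inner_add_left, ← LinearMap.adjoint_inner_right, exy, eA] at hy
  rw [inner_add_left, inner_add_left, ← LinearMap.adjoint_inner_right, exz] at hz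
  rw [inner_add_left, inner_add_left, ← LinearMap.adjoint_inner_right, exx, map_sub (Sgh + T),
    inner_sub_left (σ • r₁), inner_smul_left, inner_smul_left,
    inner_sub_left ((Sgh + T) (z₁ - z₀))] at hzz
  rw [show ⟪(Sgh + T) (z₁ - z₀), z₁ - z₀⟫ = quadForm (Sgh + T) (z₁ - z₀)
    from real_inner_comm _ _] at hzz
  rw [inner_sub_left] at hggz
  simp only [conj_trivial] at hzz
  simp only [metricForm, decrement, e₁, e₀, ex]
  rw [quadForm_add_left (Sgh + T), quadForm_add_left (Sgh + T), quadForm_smul_left,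
    quadForm_smul_left, quadForm_comp_adjoint, quadForm_comp_adjoint, eB]
  simp only [quadForm_add_left, quadForm_smul_left] at *
  linarith

end Descent

section ErrorBound

/-- a squared distance is bounded through any distance that dominates it pointwise. -/
lemma sInf_image_le_mul_sq {E : Type*} {Ω : Set E} (hΩ : Ω.Nonempty) {F n : E → ℝ} {K δ : ℝ}
    (hK : 0 < K) (hF : ∀ w, 0 ≤ F w) (hn : ∀ w, 0 ≤ n w) (hFn : ∀ w, F w ≤ K * n w ^ 2)
    (hδ : sInf (n '' Ω) ≤ δ) : sInf (F '' Ω) ≤ K * δ ^ 2 := by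
  have hbdd : BddBelow (F '' Ω) := ⟨0, by rintro _ ⟨w, -, rfl⟩; exact hF w⟩
  have h0 : 0 ≤ sInf (F '' Ω) := Real.sInf_nonneg (by rintro _ ⟨w, -, rfl⟩; exact hF w)
  have h1 : Real.sqrt (sInf (F '' Ω) / K) ≤ δ := by
    refine le_trans (le_csInf (hΩ.image n) ?_) hδ
    rintro _ ⟨w, hw, rfl⟩
    refine Real.sqrt_le_iff.mpr ⟨hn w, ?_⟩
    rw [div_le_iff₀' hK]
    exact (csInf_le hbdd ⟨w, hw, rfl⟩).trans (hFn w)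
  have h2 := pow_le_pow_left₀ (Real.sqrt_nonneg _) h1 2
  rw [Real.sq_sqrt (by positivity), div_le_iff₀' hK] at h2
  exact h2

lemma sInf_image_le_sub {E : Type*} {Ω : Set E} (hΩ : Ω.Nonempty) {F G : E → ℝ} {δ : ℝ}
    (hF : ∀ w, 0 ≤ F w) (h : ∀ w ∈ Ω, F w ≤ G w - δ) :
    sInf (F '' Ω) ≤ sInf (G '' Ω) - δ := by
  have hbdd : BddBelow (F '' Ω) := ⟨0, by rintro _ ⟨w, -, rfl⟩; exact hF w⟩
  refine le_sub_iff_add_le.mpr (le_csInf (hΩ.image G) ?_)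
  rintro _ ⟨w, hw, rfl⟩
  linarith [csInf_le hbdd ⟨w, hw, rfl⟩, h w hw]

variable {X Y Z : Type*}
  [NormedAddCommGroup X] [InnerProductSpace ℝ X] [FiniteDimensional ℝ X]
  [NormedAddCommGroup Y] [InnerProductSpace ℝ Y] [FiniteDimensional ℝ Y]
  [NormedAddCommGroup Z] [InnerProductSpace ℝ Z] [FiniteDimensional ℝ Z]

/-- the optimality defect of a subproblem is controlled by the increments and the residual. -/
lemma exists_defect_sq_le {G : Y → Y} (hG : ∃ L : NNReal, LipschitzWith L G)
    (A : X →ₗ[ℝ] Y) (D : Z →ₗ[ℝ] X) (P : Y →ₗ[ℝ] Y) (a : ℝ) :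
    ∃ C : ℝ, 0 ≤ C ∧ ∀ u v w r,
      ‖G u - G v + A (a • r + D w) - P (u - v)‖ ^ 2
        ≤ C * (‖u - v‖ ^ 2 + ‖w‖ ^ 2 + ‖r‖ ^ 2) := by
  obtain ⟨L, hL⟩ := hG
  obtain ⟨KA, hKA, HA⟩ := exists_norm_apply_le A
  obtain ⟨KD, hKD, HD⟩ := exists_norm_apply_le D
  obtain ⟨KP, hKP, HP⟩ := exists_norm_apply_le P
  refine ⟨3 * ((L + KP) ^ 2 + (KA * |a|) ^ 2 + (KA * KD) ^ 2), by positivity,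
    fun u v w r => ?_⟩
  have h1 : ‖G u - G v‖ ≤ L * ‖u - v‖ := by
    simpa [dist_eq_norm] using hL.dist_le_mul u v
  have h2 : ‖A (a • r + D w)‖ ≤ KA * (|a| * ‖r‖ + KD * ‖w‖) := by
    refine (HA _).trans (mul_le_mul_of_nonneg_left ((norm_add_le _ _).trans ?_) hKA)
    rw [norm_smul, Real.norm_eq_abs]
    exact add_le_add le_rfl (HD w)
  have h3 : ‖G u - G v + A (a • r + D w) - P (u - v)‖
      ≤ (L + KP) * ‖u - v‖ + (KA * |a|) * ‖r‖ + (KA * KD) * ‖w‖ := by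
    have := norm_sub_le (G u - G v + A (a • r + D w)) (P (u - v))
    have := norm_add_le (G u - G v) (A (a • r + D w))
    linarith [HP (u - v)]
  have h4 := pow_le_pow_left₀ (norm_nonneg _) h3 2
  set α := (L : ℝ) + KP
  set β := KA * |a|
  set γ := KA * KD
  have h5 : (α * ‖u - v‖ + β * ‖r‖ + γ * ‖w‖) ^ 2
      ≤ 3 * (α ^ 2 * ‖u - v‖ ^ 2 + β ^ 2 * ‖r‖ ^ 2 + γ ^ 2 * ‖w‖ ^ 2) := by
    nlinarith [sq_nonneg (α * ‖u - v‖ - β * ‖r‖), sq_nonneg (α * ‖u - v‖ - γ * ‖w‖),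
      sq_nonneg (β * ‖r‖ - γ * ‖w‖)]
  have h6 : 0 ≤ α ^ 2 * (‖r‖ ^ 2 + ‖w‖ ^ 2) + β ^ 2 * (‖u - v‖ ^ 2 + ‖w‖ ^ 2)
      + γ ^ 2 * (‖u - v‖ ^ 2 + ‖r‖ ^ 2) := by positivity
  linarith

end ErrorBound

set_option maxHeartbeats 1000000 in
open Filter Topology in
/-- **Theorem 3.1 (b).**  Under the assumptions of Theorem 3.1, if the iPADMM sequence
converges to a KKT point `ū` at which the KKT mapping `ℛ` is metrically subregular with
modulus `η > 0`, then there are `μ ∈ (0,1)` and `k₀ ≥ 1` such that for all `k ≥ k₀`: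
`dist²_ℳ(u^{k+1}, Ω̄) + ‖z^{k+1} − z^k‖²_{Σ̂_g+𝒯}
  ≤ μ[dist²_ℳ(u^k, Ω̄) + ‖z^k − z^{k−1}‖²_{Σ̂_g+𝒯}]`,
and some `μ̂ ∈ [μ, 1)` for which this inequality holds for all `k ≥ 1`. -/
theorem stmt8 {X Y Z : Type*}
    [NormedAddCommGroup X] [InnerProductSpace ℝ X] [FiniteDimensional ℝ X]
    [NormedAddCommGroup Y] [InnerProductSpace ℝ Y] [FiniteDimensional ℝ Y]
    [NormedAddCommGroup Z] [InnerProductSpace ℝ Z] [FiniteDimensional ℝ Z]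
    (A : X →ₗ[ℝ] Y) (B : X →ₗ[ℝ] Z) (c : X)
    (f : Y → ℝ) (g : Z → ℝ) (gradf : Y → Y) (gradg : Z → Z)
    (hfconv : ConvexOn ℝ Set.univ f) (hgconv : ConvexOn ℝ Set.univ g)
    (hfdiff : ∀ w, HasGradientAt f (gradf w) w)
    (hgdiff : ∀ w, HasGradientAt g (gradg w) w)
    (hfLip : ∃ L : NNReal, LipschitzWith L gradf)
    (hgLip : ∃ L : NNReal, LipschitzWith L gradg)
    (p : Y → EReal) (q : Z → EReal)
    (hpconv : ERConvex p) (hplsc : LowerSemicontinuous p) (hpproper : ERProper p)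
    (hqconv : ERConvex q) (hqlsc : LowerSemicontinuous q) (hqproper : ERProper q)
    (Sf Sfh : Y →ₗ[ℝ] Y) (Sg Sgh : Z →ₗ[ℝ] Z)
    (hSfsym : Sf.IsSymmetric) (hSfh_sym : Sfh.IsSymmetric)
    (hSgsym : Sg.IsSymmetric) (hSghsym : Sgh.IsSymmetric)
    (hSfpos : ∀ w, 0 ≤ quadForm Sf w) (hSfhpos : ∀ w, 0 ≤ quadForm Sfh w)
    (hSgpos : ∀ w, 0 ≤ quadForm Sg w) (hSghpos : ∀ w, 0 ≤ quadForm Sgh w)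
    (hSfle : ∀ w, quadForm Sf w ≤ quadForm Sfh w)
    (hSgle : ∀ w, quadForm Sg w ≤ quadForm Sgh w)
    (hfmaj : ∀ w w' : Y,
      f w' + ⟪gradf w', w - w'⟫ + 1 / 2 * quadForm Sf (w - w') ≤ f w ∧
      f w ≤ f w' + ⟪gradf w', w - w'⟫ + 1 / 2 * quadForm Sfh (w - w'))
    (hgmaj : ∀ w w' : Z,
      g w' + ⟪gradg w', w - w'⟫ + 1 / 2 * quadForm Sg (w - w') ≤ g w ∧
      g w ≤ g w' + ⟪gradg w', w - w'⟫ + 1 / 2 * quadForm Sgh (w - w'))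
    (σ τ : ℝ) (hσ : 0 < σ) (hτ : 0 < τ ∧ τ < (1 + Real.sqrt 5) / 2)
    (S : Y →ₗ[ℝ] Y) (T : Z →ₗ[ℝ] Z)
    (hSsym : S.IsSymmetric) (hTsym : T.IsSymmetric)
    (hS : ∀ w, -(1 / 2) * quadForm Sfh w ≤ quadForm S w)
    (hT : ∀ w, -(1 / 2) * quadForm Sgh w ≤ quadForm T w)
    (y : ℕ → Y) (z : ℕ → Z) (x : ℕ → X)
    (hdomp : ∀ k, p (y k) ≠ ⊤) (hdomq : ∀ k, q (z k) ≠ ⊤)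
    (hsubY : ∀ k, ∀ w : Y,
      p (y (k + 1)) + ((⟪y (k + 1), gradf (y k) + A (x k)⟫
          + σ / 2 * ‖LinearMap.adjoint A (y (k + 1)) + LinearMap.adjoint B (z k) - c‖ ^ 2
          + 1 / 2 * quadForm (Sfh + S) (y (k + 1) - y k) : ℝ) : EReal)
      ≤ p w + ((⟪w, gradf (y k) + A (x k)⟫
          + σ / 2 * ‖LinearMap.adjoint A w + LinearMap.adjoint B (z k) - c‖ ^ 2
          + 1 / 2 * quadForm (Sfh + S) (w - y k) : ℝ) : EReal))
    (hsubZ : ∀ k, ∀ w : Z,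
      q (z (k + 1)) + ((⟪z (k + 1), gradg (z k) + B (x k)⟫
          + σ / 2 * ‖LinearMap.adjoint A (y (k + 1)) + LinearMap.adjoint B (z (k + 1)) - c‖ ^ 2
          + 1 / 2 * quadForm (Sgh + T) (z (k + 1) - z k) : ℝ) : EReal)
      ≤ q w + ((⟪w, gradg (z k) + B (x k)⟫
          + σ / 2 * ‖LinearMap.adjoint A (y (k + 1)) + LinearMap.adjoint B w - c‖ ^ 2
          + 1 / 2 * quadForm (Sgh + T) (w - z k) : ℝ) : EReal))
    (hxup : ∀ k, x (k + 1)
      = x k + (τ * σ) • (LinearMap.adjoint A (y (k + 1)) + LinearMap.adjoint B (z (k + 1)) - c))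
    (hKKTne : (KKTset A B c gradf gradg p q).Nonempty)
    (hposY : ∀ w : Y, w ≠ 0 →
      0 < quadForm ((1 / 2 : ℝ) • Sfh + S + σ • (A ∘ₗ LinearMap.adjoint A)) w)
    (hposZ : ∀ w : Z, w ≠ 0 →
      0 < quadForm ((1 / 2 : ℝ) • Sgh + T + σ • (B ∘ₗ LinearMap.adjoint B)) w) 
    (proxP : Y → Y) (proxQ : Z → Z)
    (hproxP : ∀ v w : Y,
      p (proxP v) + ((1 / 2 * ‖proxP v - v‖ ^ 2 : ℝ) : EReal)
        ≤ p w + ((1 / 2 * ‖w - v‖ ^ 2 : ℝ) : EReal))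
    (hproxQ : ∀ v w : Z,
      q (proxQ v) + ((1 / 2 * ‖proxQ v - v‖ ^ 2 : ℝ) : EReal)
        ≤ q w + ((1 / 2 * ‖w - v‖ ^ 2 : ℝ) : EReal))
    (ybar : Y) (zbar : Z) (xbar : X)
    (hKKT : (ybar, zbar, xbar) ∈ KKTset A B c gradf gradg p q)
    (hconv : Filter.Tendsto (fun k => (y k, z k, x k)) Filter.atTop (nhds (ybar, zbar, xbar)))
    (η : ℝ) (hη : 0 < η)
    (hsubreg : ∃ ε : ℝ, 0 < ε ∧ ∀ v : Y × Z × X,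
      Real.sqrt (‖v.1 - ybar‖ ^ 2 + ‖v.2.1 - zbar‖ ^ 2 + ‖v.2.2 - xbar‖ ^ 2) ≤ ε →
      sInf ((fun w : Y × Z × X =>
          Real.sqrt (‖v.1 - w.1‖ ^ 2 + ‖v.2.1 - w.2.1‖ ^ 2 + ‖v.2.2 - w.2.2‖ ^ 2))
        '' KKTset A B c gradf gradg p q)
      ≤ η * Real.sqrt
        (‖v.1 - proxP (v.1 - (gradf v.1 + A v.2.2))‖ ^ 2
          + ‖v.2.1 - proxQ (v.2.1 - (gradg v.2.1 + B v.2.2))‖ ^ 2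
          + ‖c - LinearMap.adjoint A v.1 - LinearMap.adjoint B v.2.1‖ ^ 2)) :
    let sτ : ℝ := (5 - τ - 3 * min τ τ⁻¹) / 4
    let quadM : Y → Z → X → ℝ := fun dy dz dx =>
      quadForm (Sfh + S) dy
        + quadForm (Sgh + T + σ • (B ∘ₗ LinearMap.adjoint B)) dz
        + (τ * σ)⁻¹ * ‖dx‖ ^ 2
        + sτ * σ * ‖LinearMap.adjoint A dy + LinearMap.adjoint B dz‖ ^ 2
    let distSqM : ℕ → ℝ := fun j =>
      sInf ((fun w : Y × Z × X => quadM (y j - w.1) (z j - w.2.1) (x j - w.2.2))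
        '' KKTset A B c gradf gradg p q)
    ∃ μ : ℝ, 0 < μ ∧ μ < 1 ∧
      (∃ k₀ : ℕ, 1 ≤ k₀ ∧ ∀ k : ℕ, k₀ ≤ k →
        distSqM (k + 1) + quadForm (Sgh + T) (z (k + 1) - z k)
          ≤ μ * (distSqM k + quadForm (Sgh + T) (z k - z (k - 1)))) ∧
      (∃ μh : ℝ, μ ≤ μh ∧ μh < 1 ∧ ∀ k : ℕ, 1 ≤ k →
        distSqM (k + 1) + quadForm (Sgh + T) (z (k + 1) - z k)
          ≤ μh * (distSqM k + quadForm (Sgh + T) (z k - z (k - 1)))) := by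
  intro sτ quadM distSqM
  set Ω := KKTset A B c gradf gradg p q with hΩ
  set tτ : ℝ := (1 - τ + min τ τ⁻¹) / 2 with htτ
  have ht : 0 < tτ := stepLength_slack_pos hτ.1 hτ.2
  have hs : 0 ≤ sτ := stepLength_weight_nonneg hτ.2
  have hflow : ∀ w w', f w' + ⟪gradf w', w - w'⟫ ≤ f w := fun w w' => by
    linarith [(hfmaj w w').1, hSfpos (w - w')]
  have hglow : ∀ w w', g w' + ⟪gradg w', w - w'⟫ ≤ g w := fun w w' => by
    linarith [(hgmaj w w').1, hSgpos (w - w')]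
  have hN : ∀ w, 0 ≤ quadForm ((1 / 2 : ℝ) • Sfh + S) w := fun w => by
    rw [quadForm_add_left, quadForm_smul_left]; linarith [hS w]
  have hO : ∀ w, 0 ≤ quadForm ((1 / 2 : ℝ) • Sgh + T) w := fun w => by
    rw [quadForm_add_left, quadForm_smul_left]; linarith [hT w]
  have hP : ∀ w, 0 ≤ quadForm (Sfh + S) w := fun w => by
    rw [quadForm_add_left]; linarith [hS w, hSfhpos w]
  have hQ : ∀ w, 0 ≤ quadForm (Sgh + T) w := fun w => by
    rw [quadForm_add_left]; linarith [hT w, hSghpos w]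
  have hM : ∀ dy dz dx, 0 ≤ quadM dy dz dx := metricForm_nonneg A B hP hQ hσ hτ.1 hs
  set r : ℕ → X := fun k => LinearMap.adjoint A (y k) + LinearMap.adjoint B (z k) - c with hr
  have hx : ∀ k, x (k + 1) = x k + (τ * σ) • r (k + 1) := hxup
  have hYopt : ∀ k, ERSubgrad p (y (k + 1)) (-(gradf (y k)
      + A (x k + σ • (r (k + 1) - LinearMap.adjoint B (z (k + 1) - z k)))
      + (Sfh + S) (y (k + 1) - y k))) := fun k => by
    have h := ERSubgrad.of_augmented_step hpproper hpconv A (hSfh_sym.add hSsym)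
      (a := y (k + 1)) (a₀ := y k) (l := gradf (y k) + A (x k))
      (d := LinearMap.adjoint B (z k) - c) (σ := σ) (hdomp (k + 1))
      (by simpa only [add_sub_assoc] using hsubY k)
    convert h using 3
    rw [map_add, map_smul, add_assoc]
    congr 5
    simp only [hr, map_sub]
    abel
  have hZopt : ∀ k, ERSubgrad q (z (k + 1)) (-(gradg (z k) + B (x k + σ • r (k + 1))
      + (Sgh + T) (z (k + 1) - z k))) := fun k => by
    have e : ∀ w, LinearMap.adjoint B w + (LinearMap.adjoint A (y (k + 1)) - c)
        = LinearMap.adjoint A (y (k + 1)) + LinearMap.adjoint B w - c := fun w => by abel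
    have h := ERSubgrad.of_augmented_step hqproper hqconv B (hSghsym.add hTsym)
      (a := z (k + 1)) (a₀ := z k) (l := gradg (z k) + B (x k))
      (d := LinearMap.adjoint A (y (k + 1)) - c) (σ := σ) (hdomq (k + 1))
      (by simpa only [e] using hsubZ k)
    convert h using 3
    rw [map_add, map_smul, add_assoc, e]
  let D : ℕ → ℝ := fun k => decrement B ((1 / 2 : ℝ) • Sfh + S) ((1 / 2 : ℝ) • Sgh + T) σ τ tτ
    (y (k + 1) - y k) (z (k + 1) - z k) (r (k + 1)) (r k)
  have hD : ∀ k, 0 ≤ D k := fun k => decrement_nonneg B hN hO hσ hτ.1 ht _ _ _ _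
  have hdesc : ∀ k, 1 ≤ k →
      distSqM (k + 1) + quadForm (Sgh + T) (z (k + 1) - z (k + 1 - 1))
        ≤ distSqM k + quadForm (Sgh + T) (z k - z (k - 1)) - D k := by
    intro k hk
    obtain ⟨j, rfl⟩ : ∃ j, k = j + 1 := ⟨k - 1, by omega⟩
    simp only [Nat.add_sub_cancel]
    have h := sInf_image_le_sub hKKTne
      (F := fun w => quadM (y (j + 1 + 1) - w.1) (z (j + 1 + 1) - w.2.1) (x (j + 1 + 1) - w.2.2))
      (G := fun w => quadM (y (j + 1) - w.1) (z (j + 1) - w.2.1) (x (j + 1) - w.2.2))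
      (δ := D (j + 1) + quadForm (Sgh + T) (z (j + 1 + 1) - z (j + 1))
        - quadForm (Sgh + T) (z (j + 1) - z j)) (fun w => hM _ _ _) ?_
    · simp only [distSqM]
      linarith
    rintro ⟨yb, zb, xb⟩ ⟨hyb, hzb, hcb⟩
    have hy := (hYopt (j + 1)).inner_sub_nonneg hpproper hyb
    have hz := (hZopt (j + 1)).inner_sub_nonneg hqproper hzb
    have hzz := (hZopt (j + 1)).inner_sub_nonneg hqproper (hZopt j)
    have hstep := ipadmm_descent (A := A) (B := B) (c := c) (yb := yb) (zb := zb) (xb := xb)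
      (zm := z j) (xm := x j)
      hflow (fun w w' => (hfmaj w w').2) hglow (fun w w' => (hgmaj w w').2)
      hSfh_sym hSsym hSghsym hTsym hT hσ hτ.1 (r₀ := r (j + 1)) (r₁ := r (j + 1 + 1))
      rfl rfl hcb (hx j) (hx (j + 1))
      (by rw [← neg_nonneg, ← inner_neg_left]; convert hy using 2; simp only [map_sub]; abel)
      (by rw [← neg_nonneg, ← inner_neg_left]; convert hz using 2; simp only [map_sub]; abel)
      (by rw [← neg_nonneg, ← inner_neg_left]; convert hzz using 2; simp only [map_sub]; abel)
    have hstep' : quadM (y (j + 1 + 1) - yb) (z (j + 1 + 1) - zb) (x (j + 1 + 1) - xb)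
        + quadForm (Sgh + T) (z (j + 1 + 1) - z (j + 1))
        ≤ quadM (y (j + 1) - yb) (z (j + 1) - zb) (x (j + 1) - xb)
          + quadForm (Sgh + T) (z (j + 1) - z j) - D (j + 1) := hstep
    linarith
  obtain ⟨C, hC, HC⟩ := exists_norm_sq_le_decrement A B hN hO hσ hτ.1 ht hposY hposZ
  have hinc : ∀ k, ‖y (k + 1) - y k‖ ^ 2 + ‖z (k + 1) - z k‖ ^ 2 + ‖r (k + 1)‖ ^ 2
      ≤ C * D k := fun k => HC _ _ _ _ (by simp only [hr, map_sub]; abel)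
  obtain ⟨K, hK, HK⟩ := exists_metricForm_le A B (Sfh + S) (Sgh + T) hσ hτ.1 hs
  obtain ⟨KQ, hKQ, HQ⟩ := exists_quadForm_le (Sgh + T)
  obtain ⟨CY, hCY, HCY⟩ := exists_defect_sq_le hfLip A (σ • LinearMap.adjoint B) (Sfh + S)
    ((τ - 1) * σ)
  obtain ⟨CZ, hCZ, HCZ⟩ := exists_defect_sq_le hgLip B (0 : Z →ₗ[ℝ] X) (Sgh + T) ((τ - 1) * σ)
  have hdist0 : ∀ k, 0 ≤ distSqM k := fun k =>
    Real.sInf_nonneg (by rintro _ ⟨w, -, rfl⟩; exact hM _ _ _)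
  have hzero : ∀ k, D k = 0 →
      distSqM (k + 1) + quadForm (Sgh + T) (z (k + 1) - z (k + 1 - 1)) = 0 := by
    intro k hk
    have h := hinc k
    rw [hk, mul_zero] at h
    have hy0 : y (k + 1) - y k = 0 := by
      rw [← norm_eq_zero, ← sq_eq_zero_iff]; linarith [sq_nonneg ‖z (k + 1) - z k‖,
        sq_nonneg ‖r (k + 1)‖, sq_nonneg ‖y (k + 1) - y k‖]
    have hz0 : z (k + 1) - z k = 0 := by
      rw [← norm_eq_zero, ← sq_eq_zero_iff]; linarith [sq_nonneg ‖z (k + 1) - z k‖,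
        sq_nonneg ‖r (k + 1)‖, sq_nonneg ‖y (k + 1) - y k‖]
    have hr0 : r (k + 1) = 0 := by
      rw [← norm_eq_zero, ← sq_eq_zero_iff]; linarith [sq_nonneg ‖z (k + 1) - z k‖,
        sq_nonneg ‖r (k + 1)‖, sq_nonneg ‖y (k + 1) - y k‖]
    have hx0 : x (k + 1) = x k := by rw [hx, hr0, smul_zero, add_zero]
    have hmem : (y (k + 1), z (k + 1), x (k + 1)) ∈ Ω := by
      have h1 := hYopt k
      have h2 := hZopt k
      simp only [hr0, map_zero, sub_self, smul_zero, add_zero, ← hx0,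
        ← sub_eq_zero.mp hy0, ← sub_eq_zero.mp hz0] at h1 h2
      exact ⟨h1, h2, sub_eq_zero.mp hr0⟩
    have hle : distSqM (k + 1) ≤ 0 := by
      refine csInf_le ⟨0, by rintro _ ⟨w, -, rfl⟩; exact hM _ _ _⟩ ⟨_, hmem, ?_⟩
      simp [quadM, quadForm]
    simp only [Nat.add_sub_cancel, hz0]
    rw [le_antisymm hle (hdist0 _)]
    simp [quadForm]
  have hbound : ∀ᶠ k in atTop,
      distSqM (k + 1) + quadForm (Sgh + T) (z (k + 1) - z (k + 1 - 1))
        ≤ (K * η ^ 2 * (CY + CZ + 1) * C + KQ * C + 1) * D k := by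
    obtain ⟨ε, hε, H⟩ := hsubreg
    have htend : Tendsto (fun k => Real.sqrt (‖y (k + 1) - ybar‖ ^ 2 + ‖z (k + 1) - zbar‖ ^ 2
        + ‖x (k + 1) - xbar‖ ^ 2)) atTop (𝓝 0) := by
      have hcont : Continuous fun v : Y × Z × X =>
          Real.sqrt (‖v.1 - ybar‖ ^ 2 + ‖v.2.1 - zbar‖ ^ 2 + ‖v.2.2 - xbar‖ ^ 2) := by fun_prop
      have h := (hcont.tendsto _).comp (hconv.comp (tendsto_add_atTop_nat 1))
      simpa [Function.comp_def] using h
    filter_upwards [htend.eventually_le_const hε] with k hk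
    have hd := H (y (k + 1), z (k + 1), x (k + 1)) hk
    have hy : ‖y (k + 1) - proxP (y (k + 1) - (gradf (y (k + 1)) + A (x (k + 1))))‖ ^ 2
        ≤ CY * (C * D k) := by
      have h1 := norm_sub_prox_le hpproper hpconv
        (ξ := gradf (y (k + 1)) + A (x (k + 1))) (hYopt k) (hproxP _)
      refine (pow_le_pow_left₀ (norm_nonneg _) h1 2).trans ?_
      refine le_trans ?_ ((HCY (y (k + 1)) (y k) (z (k + 1) - z k) (r (k + 1))).trans
        (mul_le_mul_of_nonneg_left (hinc k) hCY))
      apply le_of_eq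
      congr 2
      rw [hx]
      simp only [map_add, map_sub, map_smul, LinearMap.smul_apply]
      module
    have hz : ‖z (k + 1) - proxQ (z (k + 1) - (gradg (z (k + 1)) + B (x (k + 1))))‖ ^ 2
        ≤ CZ * (C * D k) := by
      have h1 := norm_sub_prox_le hqproper hqconv
        (ξ := gradg (z (k + 1)) + B (x (k + 1))) (hZopt k) (hproxQ _)
      refine (pow_le_pow_left₀ (norm_nonneg _) h1 2).trans ?_
      refine le_trans ?_ ((HCZ (z (k + 1)) (z k) 0 (r (k + 1))).trans
        (mul_le_mul_of_nonneg_left (le_trans ?_ (hinc k)) hCZ))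
      · apply le_of_eq
        congr 2
        rw [hx]
        simp only [map_add, map_sub, map_smul, map_zero, add_zero]
        module
      · rw [norm_zero]
        linarith only [sq_nonneg ‖y (k + 1) - y k‖]
    have hres : ‖c - LinearMap.adjoint A (y (k + 1)) - LinearMap.adjoint B (z (k + 1))‖ ^ 2
        ≤ C * D k := by
      rw [show c - LinearMap.adjoint A (y (k + 1)) - LinearMap.adjoint B (z (k + 1))
        = -r (k + 1) by simp only [hr]; abel, norm_neg]
      linarith only [hinc k, sq_nonneg ‖z (k + 1) - z k‖, sq_nonneg ‖y (k + 1) - y k‖]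
    have hdist := sInf_image_le_mul_sq hKKTne hK
      (F := fun w => quadM (y (k + 1) - w.1) (z (k + 1) - w.2.1) (x (k + 1) - w.2.2))
      (fun w => hM _ _ _) (fun w => Real.sqrt_nonneg _)
      (fun w => by rw [Real.sq_sqrt (by positivity)]; exact HK _ _ _) hd
    rw [mul_pow, Real.sq_sqrt (by positivity)] at hdist
    have hdist' : distSqM (k + 1)
        ≤ K * (η ^ 2 * (CY * (C * D k) + CZ * (C * D k) + C * D k)) :=
      hdist.trans (by gcongr)
    have hzq : quadForm (Sgh + T) (z (k + 1) - z (k + 1 - 1)) ≤ KQ * (C * D k) := by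
      simp only [Nat.add_sub_cancel]
      refine (HQ _).trans (mul_le_mul_of_nonneg_left ?_ hKQ)
      linarith only [hinc k, sq_nonneg ‖r (k + 1)‖, sq_nonneg ‖y (k + 1) - y k‖]
    linarith only [hD k, hdist', hzq]
  exact exists_linear_rate
    (Ψ := fun k => distSqM k + quadForm (Sgh + T) (z k - z (k - 1)))
    (fun k => add_nonneg (hdist0 k) (hQ _)) hD hdesc (by positivity) hbound hzero

end
end

section
/- Let V = V₁ × ⋯ × V_s be a product of finite-dimensional real inner product spaces and let W be a self-adjoint linear operator on V with block components W_ij : V_j → V_i. Let W_d := Diag(W_11, …, W_ss) be the block-diagonal part and W_u the strictly upper block-triangular part, so that W = W_u + W_d + W_u*. If every diagonal block W_ii is positive definite, then W + W_u W_d⁻¹ W_u* = (W_d + W_u) W_d⁻¹ (W_d + W_u)* is positive definite. -/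
open scoped RealInnerProductSpace

/-- Splitting off the diagonal term of a weakly upper-triangular sum. -/
theorem sum_filter_le_eq_add_sum_filter_lt {s : ℕ} {M : Type*} [AddCommMonoid M] (i : Fin s)
    (f : Fin s → M) :
    ∑ j ∈ Finset.univ.filter (fun j => i ≤ j), f j
      = f i + ∑ j ∈ Finset.univ.filter (fun j => i < j), f j := by
  have h : Finset.univ.filter (fun j => i ≤ j)
      = insert i (Finset.univ.filter (fun j => i < j)) := by
    ext j
    simp [le_iff_eq_or_lt, eq_comm]
  rw [h, Finset.sum_insert (by simp)]

/-- Splitting off the diagonal term of a weakly lower-triangular sum. -/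
theorem sum_filter_ge_eq_add_sum_filter_gt {s : ℕ} {M : Type*} [AddCommMonoid M] (j : Fin s)
    (f : Fin s → M) :
    ∑ i ∈ Finset.univ.filter (fun i => i ≤ j), f i
      = f j + ∑ i ∈ Finset.univ.filter (fun i => i < j), f i := by
  have h : Finset.univ.filter (fun i => i ≤ j)
      = insert j (Finset.univ.filter (fun i => i < j)) := by
    ext i
    simp [le_iff_eq_or_lt]
  rw [h, Finset.sum_insert (by simp)]

/-- A block lower-triangular operator with injective diagonal blocks is injective. -/
theorem eq_zero_of_lowerTriangular_eq_zero {s : ℕ} {V : Fin s → Type*}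
    [∀ i, AddCommGroup (V i)] [∀ i, Module ℝ (V i)] (Wb : ∀ i j, V j →ₗ[ℝ] V i)
    (hinj : ∀ i, Function.Injective (Wb i i)) (x : ∀ i, V i)
    (hx : ∀ j, Wb j j (x j)
      + ∑ l ∈ Finset.univ.filter (fun l => l < j), Wb j l (x l) = 0) : x = 0 := by
  funext j
  induction j using WellFoundedLT.induction with
  | ind j ih =>
    have hsum : ∑ l ∈ Finset.univ.filter (fun l => l < j), Wb j l (x l) = 0 :=
      Finset.sum_eq_zero fun l hl => by
        simp [ih l (Finset.mem_filter.mp hl).2]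
    have h := hx j
    rw [hsum, add_zero] at h
    exact hinj j (by rw [h, Pi.zero_apply, map_zero])

/-- The weakly lower-triangular part of a symmetric block operator is the adjoint of the
weakly upper-triangular part. -/
theorem sum_inner_upperTriangular {s : ℕ} {V : Fin s → Type*}
    [∀ i, NormedAddCommGroup (V i)] [∀ i, InnerProductSpace ℝ (V i)]
    (Wb : ∀ i j, V j →ₗ[ℝ] V i)
    (hsym : ∀ i j, ∀ (u : V i) (v : V j), ⟪Wb j i u, v⟫ = ⟪u, Wb i j v⟫)
    (x z : ∀ i, V i) :
    ∑ i, ⟪x i, ∑ j ∈ Finset.univ.filter (fun j => i ≤ j), Wb i j (z j)⟫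
      = ∑ j, ⟪Wb j j (x j)
          + ∑ l ∈ Finset.univ.filter (fun l => l < j), Wb j l (x l), z j⟫ := by
  simp_rw [← sum_filter_ge_eq_add_sum_filter_gt _ fun l => Wb _ l (x l), inner_sum, sum_inner,
    hsym]
  exact Finset.sum_comm' (by simp)

/-- **Block symmetric Gauss–Seidel decomposition.**  Let `V = V₁ × ⋯ × V_s` and let `W` be a
self-adjoint operator on `V` given by block components `Wb i j : V j →ₗ V i` (self-adjointness
being `W_ji = W_ij*`), with block-diagonal part `W_d` and strictly upper block-triangular part
`W_u` (so `W = W_u + W_d + W_u*`).  If every diagonal block `W_ii` is positive definite (with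
inverse `Winv i`), then `W + W_u W_d⁻¹ W_u* = (W_d + W_u) W_d⁻¹ (W_d + W_u)*` and this operator
is positive definite.  Everything is expressed blockwise: the inner product on the product
space is `⟨x, y⟩ = Σ_i ⟨x i, y i⟩`, `(W x) i = Σ_j, Wb i j (x j)`,
`(W_u* x) i = Σ_{j < i} Wb i j (x j)`, etc. -/
theorem stmt9 {s : ℕ} {V : Fin s → Type*}
    [∀ i, NormedAddCommGroup (V i)] [∀ i, InnerProductSpace ℝ (V i)]
    [∀ i, FiniteDimensional ℝ (V i)]
    (Wb : ∀ i j, V j →ₗ[ℝ] V i)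
    (hsym : ∀ i j, ∀ (u : V i) (v : V j), ⟪Wb j i u, v⟫ = ⟪u, Wb i j v⟫)
    (hdiag : ∀ i, ∀ v : V i, v ≠ 0 → 0 < ⟪v, Wb i i v⟫)
    (Winv : ∀ i, V i →ₗ[ℝ] V i)
    (hWinv : ∀ i (v : V i), Winv i (Wb i i v) = v ∧ Wb i i (Winv i v) = v) :
    (∀ x : ∀ i, V i, ∀ i,
      (∑ j, Wb i j (x j))
        + (∑ j ∈ Finset.univ.filter (fun j => i < j),
            Wb i j (Winv j (∑ l ∈ Finset.univ.filter (fun l => l < j), Wb j l (x l))))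
      = ∑ j ∈ Finset.univ.filter (fun j => i ≤ j),
          Wb i j (Winv j
            (Wb j j (x j) + ∑ l ∈ Finset.univ.filter (fun l => l < j), Wb j l (x l)))) ∧
    (∀ x : ∀ i, V i, x ≠ 0 →
      0 < ∑ i, ⟪x i,
        (∑ j, Wb i j (x j))
          + (∑ j ∈ Finset.univ.filter (fun j => i < j),
              Wb i j (Winv j (∑ l ∈ Finset.univ.filter (fun l => l < j), Wb j l (x l))))⟫) := by
  have hfactor : ∀ x : ∀ i, V i, ∀ i,
      (∑ j, Wb i j (x j))
        + (∑ j ∈ Finset.univ.filter (fun j => i < j),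
            Wb i j (Winv j (∑ l ∈ Finset.univ.filter (fun l => l < j), Wb j l (x l))))
      = ∑ j ∈ Finset.univ.filter (fun j => i ≤ j),
          Wb i j (Winv j
            (Wb j j (x j) + ∑ l ∈ Finset.univ.filter (fun l => l < j), Wb j l (x l))) := by
    intro x i
    simp_rw [map_add (Winv _), (hWinv _ _).1, map_add (Wb _ _), Finset.sum_add_distrib]
    rw [sum_filter_le_eq_add_sum_filter_lt i fun j => Wb i j (Winv j _), (hWinv _ _).2,
      ← add_assoc, ← Finset.sum_filter_add_sum_filter_not Finset.univ (fun j => i ≤ j)]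
    simp_rw [not_le]
  refine ⟨hfactor, fun x hx => ?_⟩
  simp_rw [hfactor]
  rw [sum_inner_upperTriangular Wb hsym x]
  set y : ∀ j, V j := fun j =>
    Wb j j (x j) + ∑ l ∈ Finset.univ.filter (fun l => l < j), Wb j l (x l)
  have hinner : ∀ j, ⟪y j, Winv j (y j)⟫ = ⟪Winv j (y j), Wb j j (Winv j (y j))⟫ := fun j => by
    rw [(hWinv j (y j)).2, real_inner_comm]
  have hpos : ∀ j, y j ≠ 0 → 0 < ⟪y j, Winv j (y j)⟫ := fun j hj => by
    rw [hinner]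
    refine hdiag j _ fun h => hj ?_
    rw [← (hWinv j (y j)).2, h, map_zero]
  obtain ⟨j, hj⟩ : ∃ j, y j ≠ 0 := by
    by_contra! h
    exact hx (eq_zero_of_lowerTriangular_eq_zero Wb
      (fun i => Function.LeftInverse.injective fun v => (hWinv i v).1) x h)
  refine Finset.sum_pos' (fun i _ => ?_) ⟨j, Finset.mem_univ j, hpos j hj⟩
  by_cases hi : y i = 0
  · change 0 ≤ ⟪y i, Winv i (y i)⟫
    rw [hi, inner_zero_left]
  · exact (hpos i hi).le
end

section
/- In the multi-block setting with 𝒮 := Diag(𝒮₁, …, 𝒮_s) + sGS(M̃) and 𝒯 := Diag(𝒯₁, …, 𝒯_t) + sGS(Ñ), let {u^k = (y^k, z^k, x^k)}_{k≥0} be the sequence generated by the 2-block majorized iPADMM with these proximal terms (equivalently, by the majorized sGS-iPADMM). Then: (a) u^k converges to a KKT point of the multi-block problem; (b) if moreover the limit ū is such that the KKT mapping ℛ is metrically subregular at (ū, 0) ∈ gph ℛ, then u^k converges linearly to ū, i.e., there exist C > 0 and ρ ∈ (0, 1) with ‖u^k − ū‖ ≤ Cρ^k for all k. -/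
open scoped RealInnerProductSpace

noncomputable section

variable {X : Type*} [NormedAddCommGroup X] [InnerProductSpace ℝ X] [FiniteDimensional ℝ X]

/-- for a block operator `𝒜` given by components `𝒜_i : 𝒳 → V_i`, the adjoint applied to a
block vector: `𝒜* w = Σ_i 𝒜_i* w_i`. -/
def opStar {ι : Type*} [Fintype ι] {V : ι → Type*}
    [∀ i, NormedAddCommGroup (V i)] [∀ i, InnerProductSpace ℝ (V i)]
    [∀ i, FiniteDimensional ℝ (V i)]
    (A : ∀ i, X →ₗ[ℝ] V i) (w : ∀ i, V i) : X :=
  ∑ i, LinearMap.adjoint (A i) (w i)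

/-- the inner product `Σ_i ⟨w_i, v_i⟩` of the product of inner product spaces. -/
def innerPi {ι : Type*} [Fintype ι] {V : ι → Type*}
    [∀ i, NormedAddCommGroup (V i)] [∀ i, InnerProductSpace ℝ (V i)]
    (w v : ∀ i, V i) : ℝ :=
  ∑ i, ⟪w i, v i⟫

/-- the quadratic form of a block-diagonal operator `Diag(D_1, …, D_s)`. -/
def quadDiag {ι : Type*} [Fintype ι] {V : ι → Type*}
    [∀ i, NormedAddCommGroup (V i)] [∀ i, InnerProductSpace ℝ (V i)]
    (D : ∀ i, V i →ₗ[ℝ] V i) (w : ∀ i, V i) : ℝ :=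
  ∑ i, ⟪w i, D i (w i)⟫

/-- the quadratic form of `sGS(M̃) = M̃_u M̃_d⁻¹ M̃_u*`, where the strictly off-diagonal blocks
of `M̃` are `M̃_ij = σ𝒜_i𝒜_j*` and `Minv i` is the inverse of the `i`-th diagonal block:
`⟨w, M̃_u M̃_d⁻¹ M̃_u* w⟩ = Σ_i ⟨(M̃_u* w)_i, M̃_ii⁻¹ (M̃_u* w)_i⟩` with
`(M̃_u* w)_i = Σ_{j<i} σ𝒜_i 𝒜_j* w_j`. -/
def sgsQuad {ι : Type*} [Fintype ι] [LinearOrder ι] {V : ι → Type*}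
    [∀ i, NormedAddCommGroup (V i)] [∀ i, InnerProductSpace ℝ (V i)]
    [∀ i, FiniteDimensional ℝ (V i)]
    (σ : ℝ) (A : ∀ i, X →ₗ[ℝ] V i) (Minv : ∀ i, V i →ₗ[ℝ] V i) (w : ∀ i, V i) : ℝ :=
  ∑ i, ⟪σ • A i (∑ j ∈ Finset.univ.filter (fun j => j < i), LinearMap.adjoint (A j) (w j)),
    Minv i (σ • A i (∑ j ∈ Finset.univ.filter (fun j => j < i),
      LinearMap.adjoint (A j) (w j)))⟫

variable {s t : ℕ} {Yc : Fin (s + 1) → Type*} {Zc : Fin (t + 1) → Type*}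
variable [∀ i, NormedAddCommGroup (Yc i)] [∀ i, InnerProductSpace ℝ (Yc i)]
  [∀ i, FiniteDimensional ℝ (Yc i)]
variable [∀ j, NormedAddCommGroup (Zc j)] [∀ j, InnerProductSpace ℝ (Zc j)]
  [∀ j, FiniteDimensional ℝ (Zc j)]

/-- the set of KKT points of the multi-block convex composite problem
`min p(y₁) + Σᵢ f_i(y_i) + q(z₁) + Σⱼ g_j(z_j)` s.t. `𝒜*y + ℬ*z = c`. -/
def KKTmb (A : ∀ i, X →ₗ[ℝ] Yc i) (Bo : ∀ j, X →ₗ[ℝ] Zc j) (c : X)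
    (gradfi : ∀ i, Yc i → Yc i) (gradgj : ∀ j, Zc j → Zc j)
    (p : Yc 0 → EReal) (q : Zc 0 → EReal) :
    Set ((∀ i, Yc i) × (∀ j, Zc j) × X) :=
  {u | (∀ w : ∀ i, Yc i,
          p (u.1 0) + ((∑ i, ⟪-(gradfi i (u.1 i) + A i u.2.2), w i - u.1 i⟫ : ℝ) : EReal)
            ≤ p (w 0)) ∧
       (∀ w : ∀ j, Zc j,
          q (u.2.1 0) + ((∑ j, ⟪-(gradgj j (u.2.1 j) + Bo j u.2.2), w j - u.2.1 j⟫ : ℝ) : EReal)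
            ≤ q (w 0)) ∧
       opStar A u.1 + opStar Bo u.2.1 = c}
/-- Data of a two-block proximal ADMM for the inclusion system
`0 ∈ MP y + F y + A x`, `0 ∈ MQ z + G z + B x`, `At y + Bt z = c`. -/
structure ProxADMM (X Y Z : Type*)
    [NormedAddCommGroup X] [InnerProductSpace ℝ X]
    [NormedAddCommGroup Y] [InnerProductSpace ℝ Y]
    [NormedAddCommGroup Z] [InnerProductSpace ℝ Z] where
  A : X →L[ℝ] Y
  At : Y →L[ℝ] X
  B : X →L[ℝ] Z
  Bt : Z →L[ℝ] X
  c : X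
  σ : ℝ
  τ : ℝ
  F : Y → Y
  G : Z → Z
  Sf : Y →L[ℝ] Y
  Sg : Z →L[ℝ] Z
  P : Y →L[ℝ] Y
  Q : Z →L[ℝ] Z
  MP : Y → Y → Prop
  MQ : Z → Z → Prop
  y : ℕ → Y
  z : ℕ → Z
  x : ℕ → X

namespace ProxADMM

variable {X Y Z : Type*}
  [NormedAddCommGroup X] [InnerProductSpace ℝ X]
  [NormedAddCommGroup Y] [InnerProductSpace ℝ Y]
  [NormedAddCommGroup Z] [InnerProductSpace ℝ Z]

/-- The primal residual at iteration `k`. -/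
def r (D : ProxADMM X Y Z) (k : ℕ) : X := D.At (D.y k) + D.Bt (D.z k) - D.c

/-- The standing assumptions on the data and the iteration. -/
structure Valid (D : ProxADMM X Y Z) : Prop where
  adjA : ∀ x y, ⟪D.A x, y⟫ = ⟪x, D.At y⟫
  adjB : ∀ x z, ⟪D.B x, z⟫ = ⟪x, D.Bt z⟫
  hσ : 0 < D.σ
  hτ : 0 < D.τ
  hτ' : 0 < 1 + D.τ - D.τ ^ 2
  cocoF : ∀ a b w, ⟪D.F a - D.F b, w⟫ ≤ 1 / 4 * ⟪a - b + w, D.Sf (a - b + w)⟫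
  cocoG : ∀ a b w, ⟪D.G a - D.G b, w⟫ ≤ 1 / 4 * ⟪a - b + w, D.Sg (a - b + w)⟫
  posSf : ∀ w, 0 ≤ ⟪w, D.Sf w⟫
  posSg : ∀ w, 0 ≤ ⟪w, D.Sg w⟫
  symP : ∀ v w, ⟪D.P v, w⟫ = ⟪v, D.P w⟫
  symQ : ∀ v w, ⟪D.Q v, w⟫ = ⟪v, D.Q w⟫
  posP : ∀ w, 0 ≤ ⟪w, D.P w⟫ - 1 / 2 * ⟪w, D.Sf w⟫
  posQ : ∀ w, 0 ≤ ⟪w, D.Q w⟫ - 1 / 2 * ⟪w, D.Sg w⟫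
  defP : ∀ w, ⟪w, D.P w⟫ - 1 / 2 * ⟪w, D.Sf w⟫ = 0 → D.At w = 0 → w = 0
  defQ : ∀ w, ⟪w, D.Q w⟫ - 1 / 2 * ⟪w, D.Sg w⟫ = 0 → D.Bt w = 0 → w = 0
  monoP : ∀ a v b w, D.MP a v → D.MP b w → 0 ≤ ⟪v - w, a - b⟫
  monoQ : ∀ a v b w, D.MQ a v → D.MQ b w → 0 ≤ ⟪v - w, a - b⟫
  closedP : ∀ (a v : ℕ → Y) (a' v' : Y), Filter.Tendsto a Filter.atTop (nhds a') →
    Filter.Tendsto v Filter.atTop (nhds v') → (∀ n, D.MP (a n) (v n)) → D.MP a' v'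
  closedQ : ∀ (a v : ℕ → Z) (a' v' : Z), Filter.Tendsto a Filter.atTop (nhds a') →
    Filter.Tendsto v Filter.atTop (nhds v') → (∀ n, D.MQ (a n) (v n)) → D.MQ a' v'
  stepY : ∀ k, D.MP (D.y (k + 1)) (-(D.F (D.y k) + D.A (D.x k)
    + D.σ • D.A (D.At (D.y (k + 1)) + D.Bt (D.z k) - D.c) + D.P (D.y (k + 1) - D.y k)))
  stepZ : ∀ k, D.MQ (D.z (k + 1)) (-(D.G (D.z k) + D.B (D.x k)
    + D.σ • D.B (D.r (k + 1)) + D.Q (D.z (k + 1) - D.z k)))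
  stepX : ∀ k, D.x (k + 1) = D.x k + (D.τ * D.σ) • D.r (k + 1)

/-- Solutions of the inclusion system. -/
def IsKKT (D : ProxADMM X Y Z) (u : Y × Z × X) : Prop :=
  D.MP u.1 (-(D.F u.1 + D.A u.2.2)) ∧ D.MQ u.2.1 (-(D.G u.2.1 + D.B u.2.2)) ∧
    D.At u.1 + D.Bt u.2.1 = D.c

/-- The squared distance to `u` in the metric of the method. -/
def phi (D : ProxADMM X Y Z) (u : Y × Z × X) (k : ℕ) : ℝ :=
  1 / (D.τ * D.σ) * ‖D.x k - u.2.2‖ ^ 2 + ⟪D.y k - u.1, D.P (D.y k - u.1)⟫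
    + ⟪D.z k - u.2.1, D.Q (D.z k - u.2.1)⟫ + D.σ * ‖D.Bt (D.z k - u.2.1)‖ ^ 2

/-- The Lyapunov function of the method. -/
def psi (D : ProxADMM X Y Z) (α : ℝ) (u : Y × Z × X) (k : ℕ) : ℝ :=
  D.phi u (k + 1) + ⟪D.z (k + 1) - D.z k, D.Q (D.z (k + 1) - D.z k)⟫
    + α * D.σ * ‖D.r (k + 1)‖ ^ 2

/-- The squared size of the step from iterate `k + 1` to iterate `k + 2`. -/
def gap (D : ProxADMM X Y Z) (k : ℕ) : ℝ :=
  ‖D.y (k + 2) - D.y (k + 1)‖ ^ 2 + ‖D.z (k + 2) - D.z (k + 1)‖ ^ 2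
    + ‖D.r (k + 2)‖ ^ 2 + ‖D.r (k + 1)‖ ^ 2

lemma inner_symm_three_point {E : Type*} [NormedAddCommGroup E] [InnerProductSpace ℝ E]
    (P : E →L[ℝ] E) (hP : ∀ v w, ⟪P v, w⟫ = ⟪v, P w⟫) (a b : E) :
    2 * ⟪P (a - b), a⟫ = ⟪a, P a⟫ + ⟪a - b, P (a - b)⟫ - ⟪b, P b⟫ := by
  have h1 : ⟪a, P b⟫ = ⟪b, P a⟫ := by rw [← hP, real_inner_comm]
  have h2 : ⟪P a, a⟫ = ⟪a, P a⟫ := hP a a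
  have h3 : ⟪P b, a⟫ = ⟪b, P a⟫ := hP b a
  simp only [map_sub, inner_sub_left, inner_sub_right, h1, h2, h3]
  ring

lemma norm_dual_update {E : Type*} [NormedAddCommGroup E] [InnerProductSpace ℝ E]
    (s : ℝ) (hs : 0 < s) (ξ r : E) :
    1 / s * ‖ξ + s • r‖ ^ 2 = 1 / s * ‖ξ‖ ^ 2 + 2 * ⟪ξ, r⟫ + s * ‖r‖ ^ 2 := by
  rw [norm_add_sq_real, inner_smul_right, norm_smul, Real.norm_of_nonneg hs.le]
  field_simp

variable {D : ProxADMM X Y Z}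

lemma phi_succ_le (h : D.Valid) {u : Y × Z × X} (hu : D.IsKKT u) (k : ℕ) :
    D.phi u (k + 1) ≤ D.phi u k + 2 * D.σ * ⟪D.r (k + 1), D.Bt (D.z (k + 1) - D.z k)⟫
      - (2 - D.τ) * D.σ * ‖D.r (k + 1)‖ ^ 2 - D.σ * ‖D.Bt (D.z (k + 1) - D.z k)‖ ^ 2
      - (⟪D.y (k + 1) - D.y k, D.P (D.y (k + 1) - D.y k)⟫
        - 1 / 2 * ⟪D.y (k + 1) - D.y k, D.Sf (D.y (k + 1) - D.y k)⟫)
      - (⟪D.z (k + 1) - D.z k, D.Q (D.z (k + 1) - D.z k)⟫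
        - 1 / 2 * ⟪D.z (k + 1) - D.z k, D.Sg (D.z (k + 1) - D.z k)⟫) := by
  obtain ⟨hu1, hu2, hu3⟩ := hu
  have my := h.monoP _ _ _ _ (h.stepY k) hu1
  have mz := h.monoQ _ _ _ _ (h.stepZ k) hu2
  have cf := h.cocoF (D.y k) u.1 (-(D.y (k + 1) - u.1))
  have cg := h.cocoG (D.z k) u.2.1 (-(D.z (k + 1) - u.2.1))
  have e1 : D.y k - u.1 + -(D.y (k + 1) - u.1) = -(D.y (k + 1) - D.y k) := by abel
  have e2 : D.z k - u.2.1 + -(D.z (k + 1) - u.2.1) = -(D.z (k + 1) - D.z k) := by abel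
  rw [e1, map_neg, inner_neg_neg, inner_neg_right] at cf
  rw [e2, map_neg, inner_neg_neg, inner_neg_right] at cg
  have tp := inner_symm_three_point D.P h.symP (D.y (k + 1) - u.1) (D.y k - u.1)
  have tq := inner_symm_three_point D.Q h.symQ (D.z (k + 1) - u.2.1) (D.z k - u.2.1)
  rw [sub_sub_sub_cancel_right] at tp tq
  have hr1 : D.r (k + 1) = D.At (D.y (k + 1) - u.1) + D.Bt (D.z (k + 1) - u.2.1) := by
    rw [r, ← hu3, map_sub, map_sub]; abel
  have hr0 : D.At (D.y (k + 1)) + D.Bt (D.z k) - D.c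
      = D.At (D.y (k + 1) - u.1) + D.Bt (D.z k - u.2.1) := by
    rw [← hu3, map_sub, map_sub]; abel
  have hb : D.Bt (D.z (k + 1) - D.z k)
      = D.Bt (D.z (k + 1) - u.2.1) - D.Bt (D.z k - u.2.1) := by
    rw [← map_sub, sub_sub_sub_cancel_right]
  have hx : D.x (k + 1) - u.2.2 = (D.x k - u.2.2) + (D.τ * D.σ) • D.r (k + 1) := by
    rw [h.stepX]; abel
  have nx := norm_dual_update (D.τ * D.σ) (mul_pos h.hτ h.hσ) (D.x k - u.2.2) (D.r (k + 1))
  have my' : 0 ≤ -⟪D.F (D.y k) - D.F u.1, D.y (k + 1) - u.1⟫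
      - ⟪D.x k - u.2.2, D.At (D.y (k + 1) - u.1)⟫
      - D.σ * ⟪D.At (D.y (k + 1) - u.1) + D.Bt (D.z k - u.2.1), D.At (D.y (k + 1) - u.1)⟫
      - ⟪D.P (D.y (k + 1) - D.y k), D.y (k + 1) - u.1⟫ := by
    rw [hr0] at my
    refine my.trans_eq ?_
    rw [← h.adjA, ← h.adjA, map_sub D.A (D.x k)]
    simp only [inner_sub_left, inner_neg_left, inner_add_left, inner_smul_left]
    simp only [RCLike.conj_to_real]
    ring
  have mz' : 0 ≤ -⟪D.G (D.z k) - D.G u.2.1, D.z (k + 1) - u.2.1⟫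
      - ⟪D.x k - u.2.2, D.Bt (D.z (k + 1) - u.2.1)⟫
      - D.σ * ⟪D.r (k + 1), D.Bt (D.z (k + 1) - u.2.1)⟫
      - ⟪D.Q (D.z (k + 1) - D.z k), D.z (k + 1) - u.2.1⟫ := by
    refine mz.trans_eq ?_
    rw [← h.adjB, ← h.adjB, map_sub D.B (D.x k)]
    simp only [inner_sub_left, inner_neg_left, inner_add_left, inner_smul_left]
    simp only [RCLike.conj_to_real]
    ring
  rw [phi, phi, hx, nx, hb]
  rw [hr1] at mz' ⊢
  generalize D.At (D.y (k + 1) - u.1) = a at *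
  generalize D.Bt (D.z (k + 1) - u.2.1) = b' at *
  generalize D.Bt (D.z k - u.2.1) = b at *
  generalize D.x k - u.2.2 = ξ at *
  simp only [← real_inner_self_eq_norm_sq] at *
  have c1 := real_inner_comm a b
  have c2 := real_inner_comm a b'
  have c3 := real_inner_comm b b'
  simp only [inner_add_left, inner_add_right, inner_sub_left, inner_sub_right, c1, c2, c3] at my' mz' tp tq cf cg ⊢
  linarith

lemma inner_residual_le (h : D.Valid) (k : ℕ) :
    2 * D.σ * ⟪D.r (k + 2), D.Bt (D.z (k + 2) - D.z (k + 1))⟫ ≤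
      2 * (1 - D.τ) * D.σ * ⟪D.r (k + 1), D.Bt (D.z (k + 2) - D.z (k + 1))⟫
      + ⟪D.z (k + 1) - D.z k, D.Q (D.z (k + 1) - D.z k)⟫
      - ⟪D.z (k + 2) - D.z (k + 1), D.Q (D.z (k + 2) - D.z (k + 1))⟫ := by
  have m := h.monoQ _ _ _ _ (h.stepZ (k + 1)) (h.stepZ k)
  have cg := h.cocoG (D.z (k + 1)) (D.z k) (-(D.z (k + 2) - D.z (k + 1)))
  have hp := h.posQ ((D.z (k + 1) - D.z k) + -(D.z (k + 2) - D.z (k + 1)))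
  have hx := h.stepX k
  simp only [show k + 1 + 1 = k + 2 from rfl] at m
  rw [hx] at m
  generalize D.z (k + 2) - D.z (k + 1) = b at *
  generalize D.z (k + 1) - D.z k = a at *
  generalize D.G (D.z (k + 1)) = g1 at *
  generalize D.G (D.z k) = g0 at *
  have e : ⟪a, D.Q b⟫ = ⟪b, D.Q a⟫ := by rw [← h.symQ, real_inner_comm]
  rw [← h.adjB, ← h.adjB]
  simp only [map_add, map_neg, map_smul, inner_sub_left, inner_neg_left, inner_add_left,
    inner_add_right, inner_neg_right, inner_smul_left, RCLike.conj_to_real, h.symQ] at *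
  linarith

lemma exists_coercive {E W : Type*} [NormedAddCommGroup E] [InnerProductSpace ℝ E]
    [FiniteDimensional ℝ E] [NormedAddCommGroup W] [InnerProductSpace ℝ W]
    (P S : E →L[ℝ] E) (T : E →L[ℝ] W)
    (hpos : ∀ w, 0 ≤ ⟪w, P w⟫ - 1 / 2 * ⟪w, S w⟫)
    (hdef : ∀ w, ⟪w, P w⟫ - 1 / 2 * ⟪w, S w⟫ = 0 → T w = 0 → w = 0) :
    ∃ m : ℝ, 0 < m ∧ ∀ w, m * ‖w‖ ^ 2 ≤ ⟪w, P w⟫ - 1 / 2 * ⟪w, S w⟫ + ‖T w‖ ^ 2 := by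
  set φ : E → ℝ := fun w => ⟪w, P w⟫ - 1 / 2 * ⟪w, S w⟫ + ‖T w‖ ^ 2 with hφ
  have hcont : Continuous φ := by fun_prop
  have : ProperSpace E := FiniteDimensional.proper ℝ E
  rcases (Metric.sphere (0 : E) 1).eq_empty_or_nonempty with hemp | hne
  · refine ⟨1, one_pos, fun w => ?_⟩
    have hw : w = 0 := by
      by_contra hw
      have : ‖w‖⁻¹ • w ∈ Metric.sphere (0 : E) 1 := by
        simp [norm_smul, inv_mul_cancel₀ (norm_ne_zero_iff.2 hw)]
      simp [hemp] at this
    simp [hw]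
  · obtain ⟨w₀, hw₀, hmin⟩ := (isCompact_sphere (0 : E) 1).exists_isMinOn hne hcont.continuousOn
    have hpos₀ : 0 < φ w₀ := by
      have h1 := hpos w₀
      have h2 := sq_nonneg ‖T w₀‖
      by_contra hle
      simp only [hφ, not_lt] at hle
      have h3 : ‖T w₀‖ ^ 2 = 0 := by linarith
      have h4 := hdef w₀ (by linarith) (by simpa using h3)
      simp [h4] at hw₀
    refine ⟨φ w₀, hpos₀, fun w => ?_⟩
    rcases eq_or_ne w 0 with rfl | hw
    · simp
    have hn : ‖w‖ ≠ 0 := norm_ne_zero_iff.2 hw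
    have hmem : ‖w‖⁻¹ • w ∈ Metric.sphere (0 : E) 1 := by
      simp [norm_smul, inv_mul_cancel₀ hn]
    have hle : φ w₀ ≤ φ (‖w‖⁻¹ • w) := hmin hmem
    have hsc : φ (‖w‖⁻¹ • w) * ‖w‖ ^ 2 = φ w := by
      simp only [hφ, map_smul, inner_smul_left, inner_smul_right, norm_smul, norm_inv, norm_norm,
        RCLike.conj_to_real]
      field_simp
    calc φ w₀ * ‖w‖ ^ 2 ≤ φ (‖w‖⁻¹ • w) * ‖w‖ ^ 2 := by gcongr
      _ = φ w := hsc

lemma norm_add_sq_le {E : Type*} [SeminormedAddCommGroup E] (a b : E) :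
    ‖a + b‖ ^ 2 ≤ 2 * ‖a‖ ^ 2 + 2 * ‖b‖ ^ 2 := by
  have h := norm_add_le a b
  have h0 := norm_nonneg (a + b)
  nlinarith [sq_nonneg (‖a‖ - ‖b‖)]

lemma norm_sub_sq_le {E : Type*} [SeminormedAddCommGroup E] (a b : E) :
    ‖a - b‖ ^ 2 ≤ 2 * ‖a‖ ^ 2 + 2 * ‖b‖ ^ 2 := by
  simpa [sub_eq_add_neg] using norm_add_sq_le a (-b)

lemma clm_norm_sq_le {E W : Type*} [NormedAddCommGroup E] [InnerProductSpace ℝ E]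
    [NormedAddCommGroup W] [InnerProductSpace ℝ W] (T : E →L[ℝ] W) (w : E) :
    ‖T w‖ ^ 2 ≤ ‖T‖ ^ 2 * ‖w‖ ^ 2 := by
  rw [← mul_pow]
  gcongr
  exact T.le_opNorm w

lemma clm_inner_le {E : Type*} [NormedAddCommGroup E] [InnerProductSpace ℝ E]
    (T : E →L[ℝ] E) (w : E) : ⟪w, T w⟫ ≤ ‖T‖ * ‖w‖ ^ 2 := by
  calc ⟪w, T w⟫ ≤ ‖w‖ * ‖T w‖ := real_inner_le_norm _ _
    _ ≤ ‖w‖ * (‖T‖ * ‖w‖) := by gcongr; exact T.le_opNorm w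
    _ = _ := by ring

lemma psi_descent_aux (h : D.Valid) : ∃ α : ℝ, 0 < α ∧ ∃ κ : ℝ, 0 < κ ∧
    ∀ u, D.IsKKT u → ∀ k, D.psi α u (k + 1)
      + κ * (‖D.r (k + 2)‖ ^ 2 + ‖D.r (k + 1)‖ ^ 2
        + ‖D.Bt (D.z (k + 2) - D.z (k + 1))‖ ^ 2
        + (⟪D.y (k + 2) - D.y (k + 1), D.P (D.y (k + 2) - D.y (k + 1))⟫
          - 1 / 2 * ⟪D.y (k + 2) - D.y (k + 1), D.Sf (D.y (k + 2) - D.y (k + 1))⟫)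
        + (⟪D.z (k + 2) - D.z (k + 1), D.Q (D.z (k + 2) - D.z (k + 1))⟫
          - 1 / 2 * ⟪D.z (k + 2) - D.z (k + 1), D.Sg (D.z (k + 2) - D.z (k + 1))⟫))
      ≤ D.psi α u k := by
  set δ : ℝ := 1 + D.τ - D.τ ^ 2 with hδ
  have hδ0 : 0 < δ := h.hτ'
  have hσ := h.hσ
  set β : ℝ := (1 - D.τ) ^ 2 + δ / 3 with hβ
  have hβ0 : 0 < β := by positivity
  set γ : ℝ := 1 - (1 - D.τ) ^ 2 / β with hγ
  have hγ0 : 0 < γ := by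
    rw [hγ, sub_pos, div_lt_one hβ0]; linarith
  set κ : ℝ := min 1 (min (D.σ * (δ / 3)) (D.σ * γ)) with hκ
  have hκ0 : 0 < κ := by positivity
  have k1 : κ ≤ 1 := min_le_left _ _
  have k2 : κ ≤ D.σ * (δ / 3) := (min_le_right _ _).trans (min_le_left _ _)
  have k3 : κ ≤ D.σ * γ := (min_le_right _ _).trans (min_le_right _ _)
  refine ⟨β + δ / 3, by positivity, κ, hκ0, fun u hu k => ?_⟩
  have s1 := phi_succ_le h hu (k + 1)
  have s2 := inner_residual_le h k
  simp only [show k + 1 + 1 = k + 2 from rfl] at s1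
  simp only [psi, show k + 1 + 1 = k + 2 from rfl]
  have hy := h.posP (D.y (k + 2) - D.y (k + 1))
  have hz := h.posQ (D.z (k + 2) - D.z (k + 1))
  have young : 2 * (1 - D.τ) * ⟪D.r (k + 1), D.Bt (D.z (k + 2) - D.z (k + 1))⟫
      ≤ β * ‖D.r (k + 1)‖ ^ 2
        + (1 - D.τ) ^ 2 / β * ‖D.Bt (D.z (k + 2) - D.z (k + 1))‖ ^ 2 := by
    have h0 := sq_nonneg ‖β • D.r (k + 1) - (1 - D.τ) • D.Bt (D.z (k + 2) - D.z (k + 1))‖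
    rw [norm_sub_sq_real, norm_smul, norm_smul, mul_pow, mul_pow, Real.norm_eq_abs,
      Real.norm_eq_abs, sq_abs, sq_abs, inner_smul_left, inner_smul_right] at h0
    simp only [RCLike.conj_to_real] at h0
    have h1 : 0 ≤ β⁻¹ * (β * (β * ‖D.r (k + 1)‖ ^ 2
        + (1 - D.τ) ^ 2 / β * ‖D.Bt (D.z (k + 2) - D.z (k + 1))‖ ^ 2
        - 2 * (1 - D.τ) * ⟪D.r (k + 1), D.Bt (D.z (k + 2) - D.z (k + 1))⟫)) := by
      refine mul_nonneg (inv_nonneg.2 hβ0.le) (h0.trans_eq ?_)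
      field_simp
      ring
    rw [inv_mul_cancel_left₀ hβ0.ne'] at h1
    linarith
  have young' := mul_le_mul_of_nonneg_left young hσ.le
  have a1 := mul_le_mul_of_nonneg_right k2 (sq_nonneg ‖D.r (k + 2)‖)
  have a2 := mul_le_mul_of_nonneg_right k2 (sq_nonneg ‖D.r (k + 1)‖)
  have a3 := mul_le_mul_of_nonneg_right k3 (sq_nonneg ‖D.Bt (D.z (k + 2) - D.z (k + 1))‖)
  have a4 := mul_le_mul_of_nonneg_right k1 hy
  have a5 := mul_le_mul_of_nonneg_right k1 hz
  have e : (2 - D.τ) - β - δ / 3 = δ / 3 := by rw [hβ, hδ]; ring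
  have e' : (2 - D.τ) * D.σ * ‖D.r (k + 2)‖ ^ 2 = (β + δ / 3) * D.σ * ‖D.r (k + 2)‖ ^ 2
      + D.σ * (δ / 3) * ‖D.r (k + 2)‖ ^ 2 := by
    rw [← e]; ring
  rw [hγ] at a3
  nlinarith

lemma psi_upper (h : D.Valid) {α : ℝ} (hα : 0 < α) : ∃ M : ℝ, 0 < M ∧
    ∀ u k, D.psi α u k ≤ M * (‖D.y (k + 1) - u.1‖ ^ 2 + ‖D.z (k + 1) - u.2.1‖ ^ 2
      + ‖D.x (k + 1) - u.2.2‖ ^ 2 + ‖D.z (k + 1) - D.z k‖ ^ 2 + ‖D.r (k + 1)‖ ^ 2) := by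
  have hσ := h.hσ
  have hτ := h.hτ
  set a := 1 / (D.τ * D.σ) with ha
  have ha0 : 0 < a := by positivity
  set b := D.σ * ‖D.Bt‖ ^ 2 with hb
  have hb0 : 0 ≤ b := by positivity
  have hP := norm_nonneg D.P
  have hQ := norm_nonneg D.Q
  have hc : 0 < α * D.σ := by positivity
  refine ⟨a + b + ‖D.P‖ + ‖D.Q‖ + α * D.σ, by positivity, fun u k => ?_⟩
  have i1 := clm_inner_le D.P (D.y (k + 1) - u.1)
  have i2 := clm_inner_le D.Q (D.z (k + 1) - u.2.1)
  have i3 := clm_inner_le D.Q (D.z (k + 1) - D.z k)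
  have i4 := mul_le_mul_of_nonneg_left (clm_norm_sq_le D.Bt (D.z (k + 1) - u.2.1)) hσ.le
  rw [← mul_assoc, ← hb] at i4
  rw [psi, phi, ← ha]
  generalize D.y (k + 1) - u.1 = v1 at *
  generalize D.z (k + 1) - u.2.1 = v2 at *
  generalize D.z (k + 1) - D.z k = v3 at *
  generalize D.x (k + 1) - u.2.2 = v4 at *
  generalize D.r (k + 1) = v5 at *
  have s1 := sq_nonneg ‖v1‖
  have s2 := sq_nonneg ‖v2‖
  have s3 := sq_nonneg ‖v3‖
  have s4 := sq_nonneg ‖v4‖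
  have s5 := sq_nonneg ‖v5‖
  have j1 : 0 ≤ (a + b + ‖D.Q‖ + α * D.σ) * ‖v1‖ ^ 2 := by positivity
  have j2 : 0 ≤ (a + ‖D.P‖ + α * D.σ) * ‖v2‖ ^ 2 := by positivity
  have j3 : 0 ≤ (a + b + ‖D.P‖ + α * D.σ) * ‖v3‖ ^ 2 := by positivity
  have j4 : 0 ≤ (b + ‖D.P‖ + ‖D.Q‖ + α * D.σ) * ‖v4‖ ^ 2 := by positivity
  have j5 : 0 ≤ (a + b + ‖D.P‖ + ‖D.Q‖) * ‖v5‖ ^ 2 := by positivity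
  linarith

lemma norm_sub_le_of_cocoercive {E : Type*} [NormedAddCommGroup E] [InnerProductSpace ℝ E]
    (F : E → E) (S : E →L[ℝ] E)
    (hF : ∀ a b w, ⟪F a - F b, w⟫ ≤ 1 / 4 * ⟪a - b + w, S (a - b + w)⟫) (a b : E) :
    ‖F a - F b‖ ≤ (‖S‖ + 1) * ‖a - b‖ := by
  set C := ‖S‖ + 1 with hC
  have hC0 : 0 < C := by positivity
  have h1 := hF a b (C⁻¹ • (F a - F b))
  have h2 := clm_inner_le S (a - b + C⁻¹ • (F a - F b))
  have h3 := norm_add_sq_le (a - b) (C⁻¹ • (F a - F b))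
  rw [inner_smul_right, real_inner_self_eq_norm_sq] at h1
  rw [norm_smul (C⁻¹), Real.norm_of_nonneg (inv_nonneg.2 hC0.le), mul_pow] at h3
  have h4 : ‖S‖ * ‖a - b + C⁻¹ • (F a - F b)‖ ^ 2 ≤ C * ‖a - b + C⁻¹ • (F a - F b)‖ ^ 2 := by
    gcongr; linarith
  have h5 := mul_le_mul_of_nonneg_left h3 hC0.le
  have h6 : C⁻¹ * ‖F a - F b‖ ^ 2 ≤
      1 / 4 * (C * (2 * ‖a - b‖ ^ 2 + 2 * (C⁻¹ ^ 2 * ‖F a - F b‖ ^ 2))) := by linarith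
  have h7 : C * (C⁻¹ * ‖F a - F b‖ ^ 2) ≤
      C * (1 / 4 * (C * (2 * ‖a - b‖ ^ 2 + 2 * (C⁻¹ ^ 2 * ‖F a - F b‖ ^ 2)))) := by gcongr
  have h8 : C * (C⁻¹ * ‖F a - F b‖ ^ 2) = ‖F a - F b‖ ^ 2 := by field_simp
  have h9 : C * (1 / 4 * (C * (2 * ‖a - b‖ ^ 2 + 2 * (C⁻¹ ^ 2 * ‖F a - F b‖ ^ 2))))
      = 1 / 2 * (C * ‖a - b‖) ^ 2 + 1 / 2 * ‖F a - F b‖ ^ 2 := by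
    field_simp
    ring
  exact abs_le_of_sq_le_sq' (by linarith) (by positivity) |>.2

lemma continuous_of_cocoercive {E : Type*} [NormedAddCommGroup E] [InnerProductSpace ℝ E]
    (F : E → E) (S : E →L[ℝ] E)
    (hF : ∀ a b w, ⟪F a - F b, w⟫ ≤ 1 / 4 * ⟪a - b + w, S (a - b + w)⟫) : Continuous F := by
  have : LipschitzWith (‖S‖ + 1).toNNReal F := by
    refine LipschitzWith.of_dist_le_mul fun a b => ?_
    rw [dist_eq_norm, dist_eq_norm, Real.coe_toNNReal _ (by positivity)]
    exact norm_sub_le_of_cocoercive F S hF a b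
  exact this.continuous

lemma norm_sub_resolvent_le {E : Type*} [NormedAddCommGroup E] [InnerProductSpace ℝ E]
    (M : E → E → Prop) (hM : ∀ a v b w, M a v → M b w → 0 ≤ ⟪v - w, a - b⟫)
    (J : E → E) (hJ : ∀ v, M (J v) (v - J v)) {y g : E} (hy : M y (-g)) (g' : E) :
    ‖y - J (y - g')‖ ≤ ‖g' - g‖ := by
  have h1 := hM _ _ _ _ hy (hJ (y - g'))
  have e : -g - (y - g' - J (y - g')) = (g' - g) - (y - J (y - g')) := by abel
  rw [e, inner_sub_left, real_inner_self_eq_norm_sq] at h1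
  have h2 := real_inner_le_norm (g' - g) (y - J (y - g'))
  by_contra hlt
  push Not at hlt
  have h3 := norm_nonneg (g' - g)
  nlinarith [norm_nonneg (y - J (y - g'))]

lemma residual_le (h : D.Valid) (JP : Y → Y) (JQ : Z → Z)
    (hJP : ∀ v, D.MP (JP v) (v - JP v)) (hJQ : ∀ v, D.MQ (JQ v) (v - JQ v)) :
    ∃ M : ℝ, 0 < M ∧ ∀ k,
      ‖D.y (k + 2) - JP (D.y (k + 2) - (D.F (D.y (k + 2)) + D.A (D.x (k + 2))))‖ ^ 2
      + ‖D.z (k + 2) - JQ (D.z (k + 2) - (D.G (D.z (k + 2)) + D.B (D.x (k + 2))))‖ ^ 2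
      + ‖D.r (k + 2)‖ ^ 2 ≤ M * D.gap k := by
  have hσ := h.hσ
  have hτ := h.hτ
  set K₁ := ‖D.Sf‖ + 1 + ‖D.P‖ + D.τ * D.σ * ‖D.A‖ + D.σ * ‖D.A‖ + D.σ * ‖D.A‖ * ‖D.Bt‖
    with hK₁
  set K₂ := ‖D.Sg‖ + 1 + ‖D.Q‖ + D.τ * D.σ * ‖D.B‖ + D.σ * ‖D.B‖ with hK₂
  have hK₁0 : 0 ≤ K₁ := by positivity
  have hK₂0 : 0 ≤ K₂ := by positivity
  refine ⟨3 * K₁ ^ 2 + 3 * K₂ ^ 2 + 1, by positivity, fun k => ?_⟩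
  have hy := norm_sub_resolvent_le D.MP h.monoP JP hJP (h.stepY (k + 1))
    (D.F (D.y (k + 2)) + D.A (D.x (k + 2)))
  have hz := norm_sub_resolvent_le D.MQ h.monoQ JQ hJQ (h.stepZ (k + 1))
    (D.G (D.z (k + 2)) + D.B (D.x (k + 2)))
  simp only [show k + 1 + 1 = k + 2 from rfl] at hy hz
  have hx := h.stepX (k + 1)
  simp only [show k + 1 + 1 = k + 2 from rfl] at hx
  have fy := norm_sub_le_of_cocoercive D.F D.Sf h.cocoF (D.y (k + 2)) (D.y (k + 1))
  have fz := norm_sub_le_of_cocoercive D.G D.Sg h.cocoG (D.z (k + 2)) (D.z (k + 1))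
  have ey : D.F (D.y (k + 2)) + D.A (D.x (k + 2)) - (D.F (D.y (k + 1)) + D.A (D.x (k + 1))
      + D.σ • D.A (D.At (D.y (k + 2)) + D.Bt (D.z (k + 1)) - D.c)
      + D.P (D.y (k + 2) - D.y (k + 1)))
      = (D.F (D.y (k + 2)) - D.F (D.y (k + 1))) + (D.τ * D.σ) • D.A (D.r (k + 2))
        - D.σ • D.A (D.r (k + 2)) + D.σ • D.A (D.Bt (D.z (k + 2) - D.z (k + 1)))
        - D.P (D.y (k + 2) - D.y (k + 1)) := by
    have : D.At (D.y (k + 2)) + D.Bt (D.z (k + 1)) - D.c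
        = D.r (k + 2) - D.Bt (D.z (k + 2) - D.z (k + 1)) := by
      simp only [r, map_sub]; abel
    rw [this, hx, map_add, map_smul, map_sub D.A, smul_sub]
    abel
  have ez : D.G (D.z (k + 2)) + D.B (D.x (k + 2)) - (D.G (D.z (k + 1)) + D.B (D.x (k + 1))
      + D.σ • D.B (D.r (k + 2)) + D.Q (D.z (k + 2) - D.z (k + 1)))
      = (D.G (D.z (k + 2)) - D.G (D.z (k + 1))) + (D.τ * D.σ) • D.B (D.r (k + 2))
        - D.σ • D.B (D.r (k + 2)) - D.Q (D.z (k + 2) - D.z (k + 1)) := by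
    rw [hx, map_add, map_smul]
    abel
  rw [ey] at hy
  rw [ez] at hz
  have hτσ : 0 ≤ D.τ * D.σ := by positivity
  rw [gap]
  generalize D.y (k + 2) - JP (D.y (k + 2) - (D.F (D.y (k + 2)) + D.A (D.x (k + 2)))) = R₁ at *
  generalize D.z (k + 2) - JQ (D.z (k + 2) - (D.G (D.z (k + 2)) + D.B (D.x (k + 2)))) = R₂ at *
  generalize D.F (D.y (k + 2)) - D.F (D.y (k + 1)) = dF at *
  generalize D.G (D.z (k + 2)) - D.G (D.z (k + 1)) = dG at *
  generalize D.y (k + 2) - D.y (k + 1) = dy at *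
  generalize D.z (k + 2) - D.z (k + 1) = dz at *
  generalize D.r (k + 2) = r2 at *
  have nA : ‖D.σ • D.A r2‖ ≤ D.σ * ‖D.A‖ * ‖r2‖ := by
    rw [norm_smul, Real.norm_of_nonneg hσ.le, mul_assoc]
    gcongr; exact D.A.le_opNorm r2
  have nA' : ‖(D.τ * D.σ) • D.A r2‖ ≤ D.τ * D.σ * ‖D.A‖ * ‖r2‖ := by
    rw [norm_smul, Real.norm_of_nonneg hτσ, mul_assoc _ ‖D.A‖]
    gcongr; exact D.A.le_opNorm r2
  have nB : ‖D.σ • D.B r2‖ ≤ D.σ * ‖D.B‖ * ‖r2‖ := by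
    rw [norm_smul, Real.norm_of_nonneg hσ.le, mul_assoc]
    gcongr; exact D.B.le_opNorm r2
  have nB' : ‖(D.τ * D.σ) • D.B r2‖ ≤ D.τ * D.σ * ‖D.B‖ * ‖r2‖ := by
    rw [norm_smul, Real.norm_of_nonneg hτσ, mul_assoc _ ‖D.B‖]
    gcongr; exact D.B.le_opNorm r2
  have nAB : ‖D.σ • D.A (D.Bt dz)‖ ≤ D.σ * ‖D.A‖ * ‖D.Bt‖ * ‖dz‖ := by
    rw [norm_smul, Real.norm_of_nonneg hσ.le, mul_assoc, mul_assoc]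
    gcongr
    refine (D.A.le_opNorm _).trans ?_
    gcongr; exact D.Bt.le_opNorm dz
  have nP := D.P.le_opNorm dy
  have nQ := D.Q.le_opNorm dz
  have by1 : ‖R₁‖ ≤ K₁ * (‖dy‖ + ‖dz‖ + ‖r2‖) := by
    have t1 := norm_sub_le (dF + (D.τ * D.σ) • D.A r2 - D.σ • D.A r2 + D.σ • D.A (D.Bt dz))
      (D.P dy)
    have t2 := norm_add_le (dF + (D.τ * D.σ) • D.A r2 - D.σ • D.A r2) (D.σ • D.A (D.Bt dz))
    have t3 := norm_sub_le (dF + (D.τ * D.σ) • D.A r2) (D.σ • D.A r2)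
    have t4 := norm_add_le dF ((D.τ * D.σ) • D.A r2)
    have p1 : 0 ≤ (D.τ * D.σ * ‖D.A‖ + D.σ * ‖D.A‖ + D.σ * ‖D.A‖ * ‖D.Bt‖) * ‖dy‖ := by positivity
    have p2 : 0 ≤ (‖D.Sf‖ + 1 + ‖D.P‖ + D.τ * D.σ * ‖D.A‖ + D.σ * ‖D.A‖) * ‖dz‖ := by positivity
    have p3 : 0 ≤ (‖D.Sf‖ + 1 + ‖D.P‖ + D.σ * ‖D.A‖ * ‖D.Bt‖) * ‖r2‖ := by positivity
    rw [hK₁]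
    linarith
  have bz1 : ‖R₂‖ ≤ K₂ * (‖dy‖ + ‖dz‖ + ‖r2‖) := by
    have t1 := norm_sub_le (dG + (D.τ * D.σ) • D.B r2 - D.σ • D.B r2) (D.Q dz)
    have t3 := norm_sub_le (dG + (D.τ * D.σ) • D.B r2) (D.σ • D.B r2)
    have t4 := norm_add_le dG ((D.τ * D.σ) • D.B r2)
    have p1 : 0 ≤ K₂ * ‖dy‖ := by positivity
    have p2 : 0 ≤ (D.τ * D.σ * ‖D.B‖ + D.σ * ‖D.B‖) * ‖dz‖ := by positivity
    have p3 : 0 ≤ (‖D.Sg‖ + 1 + ‖D.Q‖) * ‖r2‖ := by positivity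
    rw [hK₂] at p1 ⊢
    linarith
  have sq3 : (‖dy‖ + ‖dz‖ + ‖r2‖) ^ 2 ≤ 3 * (‖dy‖ ^ 2 + ‖dz‖ ^ 2 + ‖r2‖ ^ 2) := by
    nlinarith [sq_nonneg (‖dy‖ - ‖dz‖), sq_nonneg (‖dz‖ - ‖r2‖), sq_nonneg (‖dy‖ - ‖r2‖)]
  have f1 : ‖R₁‖ ^ 2 ≤ K₁ ^ 2 * (3 * (‖dy‖ ^ 2 + ‖dz‖ ^ 2 + ‖r2‖ ^ 2)) := by
    calc ‖R₁‖ ^ 2 ≤ (K₁ * (‖dy‖ + ‖dz‖ + ‖r2‖)) ^ 2 := by gcongr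
      _ = K₁ ^ 2 * (‖dy‖ + ‖dz‖ + ‖r2‖) ^ 2 := by ring
      _ ≤ _ := by gcongr
  have f2 : ‖R₂‖ ^ 2 ≤ K₂ ^ 2 * (3 * (‖dy‖ ^ 2 + ‖dz‖ ^ 2 + ‖r2‖ ^ 2)) := by
    calc ‖R₂‖ ^ 2 ≤ (K₂ * (‖dy‖ + ‖dz‖ + ‖r2‖)) ^ 2 := by gcongr
      _ = K₂ ^ 2 * (‖dy‖ + ‖dz‖ + ‖r2‖) ^ 2 := by ring
      _ ≤ _ := by gcongr
  have g1 : 0 ≤ (3 * K₁ ^ 2 + 3 * K₂ ^ 2 + 1) * ‖D.r (k + 1)‖ ^ 2 := by positivity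
  have g2 : 0 ≤ ‖dy‖ ^ 2 + ‖dz‖ ^ 2 := by positivity
  linarith

lemma gap_nonneg (D : ProxADMM X Y Z) (k : ℕ) : 0 ≤ D.gap k := by
  rw [gap]; positivity

lemma norm_sub_y_sq_le_gap (D : ProxADMM X Y Z) (k : ℕ) :
    ‖D.y (k + 2) - D.y (k + 1)‖ ^ 2 ≤ D.gap k := by
  rw [gap, add_assoc, add_assoc]
  exact le_add_of_nonneg_right (by positivity)

lemma norm_sub_z_sq_le_gap (D : ProxADMM X Y Z) (k : ℕ) :
    ‖D.z (k + 2) - D.z (k + 1)‖ ^ 2 ≤ D.gap k := by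
  have h : 0 ≤ ‖D.y (k + 2) - D.y (k + 1)‖ ^ 2 + ‖D.r (k + 2)‖ ^ 2 + ‖D.r (k + 1)‖ ^ 2 := by
    positivity
  rw [gap]
  linarith

lemma norm_r_sq_le_gap (D : ProxADMM X Y Z) (k : ℕ) : ‖D.r (k + 1)‖ ^ 2 ≤ D.gap k := by
  rw [gap]
  exact le_add_of_nonneg_left (by positivity)

lemma norm_r_succ_sq_le_gap (D : ProxADMM X Y Z) (k : ℕ) : ‖D.r (k + 2)‖ ^ 2 ≤ D.gap k := by
  have h : 0 ≤ ‖D.y (k + 2) - D.y (k + 1)‖ ^ 2 + ‖D.z (k + 2) - D.z (k + 1)‖ ^ 2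
      + ‖D.r (k + 1)‖ ^ 2 := by
    positivity
  rw [gap]
  linarith

lemma tendsto_zero_of_norm_sq_le {E : Type*} [SeminormedAddCommGroup E] {f : ℕ → E} {g : ℕ → ℝ}
    (hg : Filter.Tendsto g Filter.atTop (nhds 0)) (hf : ∀ k, ‖f k‖ ^ 2 ≤ g k) :
    Filter.Tendsto f Filter.atTop (nhds 0) := by
  rw [tendsto_zero_iff_norm_tendsto_zero]
  refine squeeze_zero (fun k => norm_nonneg _) (fun k => Real.le_sqrt_of_sq_le (hf k)) ?_
  simpa using hg.sqrt

variable [FiniteDimensional ℝ Y] [FiniteDimensional ℝ Z]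

lemma psi_descent (h : D.Valid) : ∃ α : ℝ, 0 < α ∧ ∃ κ : ℝ, 0 < κ ∧
    ∀ u, D.IsKKT u → ∀ k, D.psi α u (k + 1) + κ * D.gap k ≤ D.psi α u k := by
  obtain ⟨α, hα, κ, hκ, H⟩ := psi_descent_aux h
  obtain ⟨m₁, hm₁, H₁⟩ := exists_coercive D.P D.Sf D.At h.posP h.defP
  obtain ⟨m₂, hm₂, H₂⟩ := exists_coercive D.Q D.Sg D.Bt h.posQ h.defQ
  set m := min (1 / 8) (min (m₁ / 8) (m₂ / 8)) with hm
  have hm0 : 0 < m := by positivity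
  have l1 : m ≤ 1 / 8 := min_le_left _ _
  have l2 : m ≤ m₁ / 8 := (min_le_right _ _).trans (min_le_left _ _)
  have l3 : m ≤ m₂ / 8 := (min_le_right _ _).trans (min_le_right _ _)
  refine ⟨α, hα, κ * m, by positivity, fun u hu k => le_trans ?_ (H u hu k)⟩
  rw [mul_assoc]
  gcongr
  have hy := H₁ (D.y (k + 2) - D.y (k + 1))
  have hz := H₂ (D.z (k + 2) - D.z (k + 1))
  have py := h.posP (D.y (k + 2) - D.y (k + 1))
  have pz := h.posQ (D.z (k + 2) - D.z (k + 1))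
  have e : D.At (D.y (k + 2) - D.y (k + 1))
      = (D.r (k + 2) - D.r (k + 1)) - D.Bt (D.z (k + 2) - D.z (k + 1)) := by
    simp only [r, map_sub]; abel
  have n1 := norm_sub_sq_le (D.r (k + 2) - D.r (k + 1)) (D.Bt (D.z (k + 2) - D.z (k + 1)))
  have n2 := norm_sub_sq_le (D.r (k + 2)) (D.r (k + 1))
  rw [← e] at n1
  have b1 := mul_le_mul_of_nonneg_right l1 (sq_nonneg ‖D.r (k + 2)‖)
  have b2 := mul_le_mul_of_nonneg_right l1 (sq_nonneg ‖D.r (k + 1)‖)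
  have b3 := mul_le_mul_of_nonneg_right l2 (sq_nonneg ‖D.y (k + 2) - D.y (k + 1)‖)
  have b4 := mul_le_mul_of_nonneg_right l3 (sq_nonneg ‖D.z (k + 2) - D.z (k + 1)‖)
  have q1 := sq_nonneg ‖D.Bt (D.z (k + 2) - D.z (k + 1))‖
  have q2 := sq_nonneg ‖D.r (k + 2)‖
  have q3 := sq_nonneg ‖D.r (k + 1)‖
  rw [gap]
  linarith

lemma psi_lower (h : D.Valid) {α : ℝ} (hα : 0 < α) : ∃ m : ℝ, 0 < m ∧
    ∀ u, D.IsKKT u → ∀ k, m * (‖D.y (k + 1) - u.1‖ ^ 2 + ‖D.z (k + 1) - u.2.1‖ ^ 2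
      + ‖D.x (k + 1) - u.2.2‖ ^ 2) ≤ D.psi α u k := by
  obtain ⟨m₁, hm₁, H₁⟩ := exists_coercive D.P D.Sf D.At h.posP h.defP
  obtain ⟨m₂, hm₂, H₂⟩ := exists_coercive D.Q D.Sg D.Bt h.posQ h.defQ
  have hσ := h.hσ
  have hτ := h.hτ
  set m₀ := min (1 / 8) (min (D.σ / 8) (α * D.σ / 8)) with hm₀
  have hm00 : 0 < m₀ := by positivity
  have l1 : m₀ ≤ 1 / 8 := min_le_left _ _
  have l2 : m₀ ≤ D.σ / 8 := (min_le_right _ _).trans (min_le_left _ _)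
  have l3 : m₀ ≤ α * D.σ / 8 := (min_le_right _ _).trans (min_le_right _ _)
  set m := min (1 / (D.τ * D.σ)) (min (m₀ * m₁) (m₀ * m₂)) with hm
  have hm0 : 0 < m := by positivity
  have t1 : m ≤ 1 / (D.τ * D.σ) := min_le_left _ _
  have t2 : m ≤ m₀ * m₁ := (min_le_right _ _).trans (min_le_left _ _)
  have t3 : m ≤ m₀ * m₂ := (min_le_right _ _).trans (min_le_right _ _)
  refine ⟨m, hm0, fun u hu k => ?_⟩
  have e : D.At (D.y (k + 1) - u.1) = D.r (k + 1) - D.Bt (D.z (k + 1) - u.2.1) := by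
    simp only [r, map_sub, ← hu.2.2]; abel
  have n1 := norm_sub_sq_le (D.r (k + 1)) (D.Bt (D.z (k + 1) - u.2.1))
  rw [← e] at n1
  have hy := mul_le_mul_of_nonneg_left (H₁ (D.y (k + 1) - u.1)) hm00.le
  have hz := mul_le_mul_of_nonneg_left (H₂ (D.z (k + 1) - u.2.1)) hm00.le
  have py := h.posP (D.y (k + 1) - u.1)
  have pz := h.posQ (D.z (k + 1) - u.2.1)
  have qy := h.posSf (D.y (k + 1) - u.1)
  have qz := h.posSg (D.z (k + 1) - u.2.1)
  have pd := h.posQ (D.z (k + 1) - D.z k)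
  have qd := h.posSg (D.z (k + 1) - D.z k)
  have b1 := mul_le_mul_of_nonneg_right l1 py
  have b2 := mul_le_mul_of_nonneg_right l1 pz
  have b3 := mul_le_mul_of_nonneg_right l2 (sq_nonneg ‖D.Bt (D.z (k + 1) - u.2.1)‖)
  have b4 := mul_le_mul_of_nonneg_right l3 (sq_nonneg ‖D.r (k + 1)‖)
  have n1' := mul_le_mul_of_nonneg_left n1 hm00.le
  have c1 := mul_le_mul_of_nonneg_right t1 (sq_nonneg ‖D.x (k + 1) - u.2.2‖)
  have c2 := mul_le_mul_of_nonneg_right t2 (sq_nonneg ‖D.y (k + 1) - u.1‖)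
  have c3 := mul_le_mul_of_nonneg_right t3 (sq_nonneg ‖D.z (k + 1) - u.2.1‖)
  have d1 : 0 ≤ α * D.σ * ‖D.r (k + 1)‖ ^ 2 := by positivity
  have d2 : 0 ≤ D.σ * ‖D.Bt (D.z (k + 1) - u.2.1)‖ ^ 2 := by positivity
  rw [psi, phi]
  linarith

lemma exists_geometric_bound {a : ℕ → ℝ} (ha : ∀ k, 0 ≤ a k) {C ρ : ℝ} (hC : 0 ≤ C) (hρ : 0 < ρ)
    (K : ℕ) (h : ∀ n, a (n + K) ≤ C * ρ ^ n) : ∃ C' : ℝ, 0 < C' ∧ ∀ k, a k ≤ C' * ρ ^ k := by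
  have hs : ∀ k, 0 ≤ a k / ρ ^ k := fun k => div_nonneg (ha k) (by positivity)
  have hS : 0 ≤ ∑ k ∈ Finset.range K, a k / ρ ^ k := Finset.sum_nonneg fun k _ => hs k
  have hCK : 0 ≤ C / ρ ^ K := by positivity
  refine ⟨C / ρ ^ K + ∑ k ∈ Finset.range K, a k / ρ ^ k + 1, by positivity, fun k => ?_⟩
  have hρk : 0 < ρ ^ k := by positivity
  rw [← div_le_iff₀ hρk]
  rcases lt_or_ge k K with hk | hk
  · have := Finset.single_le_sum (f := fun k => a k / ρ ^ k) (fun k _ => hs k)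
      (Finset.mem_range.2 hk)
    linarith
  · obtain ⟨n, rfl⟩ := Nat.exists_eq_add_of_le' hk
    have : a (n + K) / ρ ^ (n + K) ≤ C / ρ ^ K := by
      rw [div_le_iff₀ hρk, pow_add]
      refine (h n).trans_eq ?_
      field_simp
    linarith

/-- Local linear convergence under an error bound for the natural residual map. -/
lemma linear_convergence (h : D.Valid) (JP : Y → Y) (JQ : Z → Z)
    (hJP : ∀ v, D.MP (JP v) (v - JP v)) (hJQ : ∀ v, D.MQ (JQ v) (v - JQ v))
    {u : Y × Z × X} (hu : D.IsKKT u)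
    (hconv : Filter.Tendsto (fun k => (D.y k, D.z k, D.x k)) Filter.atTop (nhds u))
    {η ε : ℝ} (hη : 0 < η) (hε : 0 < ε)
    (hreg : ∀ v : Y × Z × X,
      ‖v.1 - u.1‖ ^ 2 + ‖v.2.1 - u.2.1‖ ^ 2 + ‖v.2.2 - u.2.2‖ ^ 2 ≤ ε → ∀ δ > 0,
      ∃ w, D.IsKKT w ∧ ‖v.1 - w.1‖ ^ 2 + ‖v.2.1 - w.2.1‖ ^ 2 + ‖v.2.2 - w.2.2‖ ^ 2
        ≤ η * (‖v.1 - JP (v.1 - (D.F v.1 + D.A v.2.2))‖ ^ 2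
          + ‖v.2.1 - JQ (v.2.1 - (D.G v.2.1 + D.B v.2.2))‖ ^ 2
          + ‖D.At v.1 + D.Bt v.2.1 - D.c‖ ^ 2) + δ) :
    ∃ C : ℝ, 0 < C ∧ ∃ ρ : ℝ, 0 < ρ ∧ ρ < 1 ∧ ∀ k,
      ‖D.y k - u.1‖ + ‖D.z k - u.2.1‖ + ‖D.x k - u.2.2‖ ≤ C * ρ ^ k := by
  obtain ⟨α, hα, κ, hκ, hdes⟩ := psi_descent h
  obtain ⟨m, hm, hlow⟩ := psi_lower h hα
  obtain ⟨M, hM, hupp⟩ := psi_upper h hα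
  obtain ⟨N, hN, hres⟩ := residual_le h JP JQ hJP hJQ
  have hnn : ∀ w, D.IsKKT w → ∀ k, 0 ≤ D.psi α w k := fun w hw k =>
    le_trans (by positivity) (hlow w hw k)
  have : Nonempty {w // D.IsKKT w} := ⟨⟨u, hu⟩⟩
  set V : ℕ → ℝ := fun k => ⨅ w : {w // D.IsKKT w}, D.psi α w k with hV
  have hbdd : ∀ k, BddBelow (Set.range fun w : {w // D.IsKKT w} => D.psi α w k) := fun k =>
    ⟨0, by rintro _ ⟨w, rfl⟩; exact hnn w w.2 k⟩
  have hV0 : ∀ k, 0 ≤ V k := fun k => le_ciInf fun w => hnn w w.2 k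
  have hVle : ∀ w, D.IsKKT w → ∀ k, V k ≤ D.psi α w k := fun w hw k =>
    ciInf_le (hbdd k) ⟨w, hw⟩
  have hVdes : ∀ k, V (k + 1) + κ * D.gap k ≤ V k := fun k =>
    le_ciInf fun w => (add_le_add_left (hVle w w.2 (k + 1)) _).trans (hdes w w.2 k)
  have hev : ∀ᶠ k in Filter.atTop, ‖D.y k - u.1‖ ^ 2 + ‖D.z k - u.2.1‖ ^ 2
      + ‖D.x k - u.2.2‖ ^ 2 ≤ ε := by
    have hc : Continuous fun v : Y × Z × X =>
        ‖v.1 - u.1‖ ^ 2 + ‖v.2.1 - u.2.1‖ ^ 2 + ‖v.2.2 - u.2.2‖ ^ 2 := by fun_prop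
    have ht := (hc.tendsto u).comp hconv
    simp only [sub_self, norm_zero] at ht
    exact (ht.eventually_lt_const (by simpa using hε)).mono fun k hk => hk.le
  obtain ⟨K, hK⟩ := Filter.eventually_atTop.1 hev
  set L := M * (η * N + 2) with hL
  have hL0 : 0 < L := by positivity
  have hVgap : ∀ k ≥ K, V (k + 1) ≤ L * D.gap k := by
    intro k hk
    refine le_of_forall_pos_le_add fun δ hδ => ?_
    obtain ⟨w, hw, hwd⟩ := hreg (D.y (k + 2), D.z (k + 2), D.x (k + 2)) (hK _ (by lia)) (δ / M)
      (by positivity)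
    have h1 := hVle w hw (k + 1)
    have h2 := hupp w (k + 1)
    have h3 := hres k
    simp only [show k + 1 + 1 = k + 2 from rfl] at h2
    have h4 := D.norm_sub_z_sq_le_gap k
    have h5 := D.norm_r_succ_sq_le_gap k
    have h6 := mul_le_mul_of_nonneg_left h3 hη.le
    have h7 : ‖D.y (k + 2) - w.1‖ ^ 2 + ‖D.z (k + 2) - w.2.1‖ ^ 2 + ‖D.x (k + 2) - w.2.2‖ ^ 2
        + ‖D.z (k + 2) - D.z (k + 1)‖ ^ 2 + ‖D.r (k + 2)‖ ^ 2
        ≤ η * (N * D.gap k) + δ / M + D.gap k + D.gap k := by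
      simp only [r] at h6 h5 ⊢
      linarith
    have h8 := mul_le_mul_of_nonneg_left h7 hM.le
    have h9 : M * (δ / M) = δ := by field_simp
    calc V (k + 1) ≤ _ := h1
      _ ≤ _ := h2
      _ ≤ _ := h8
      _ = L * D.gap k + M * (δ / M) := by rw [hL]; ring
      _ = _ := by rw [h9]
  set θ : ℝ := (1 + κ / L)⁻¹ with hθ
  have hκL : 0 < κ / L := by positivity
  have hθ0 : 0 < θ := by positivity
  have hθ1 : θ < 1 := inv_lt_one_of_one_lt₀ (by linarith)
  have hVθ : ∀ k ≥ K, V (k + 1) ≤ θ * V k := by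
    intro k hk
    have h1 : κ / L * V (k + 1) ≤ κ * D.gap k := by
      calc κ / L * V (k + 1) ≤ κ / L * (L * D.gap k) := by gcongr; exact hVgap k hk
        _ = _ := by field_simp
    rw [hθ, inv_mul_eq_div, le_div_iff₀ (by positivity)]
    linarith [hVdes k]
  have hVgeo : ∀ n, V (n + K) ≤ V K * θ ^ n := by
    intro n
    induction n with
    | zero => simp
    | succ n ih =>
      have := hVθ (n + K) (by lia)
      calc V (n + 1 + K) = V (n + K + 1) := by congr 1; lia
        _ ≤ θ * V (n + K) := this
        _ ≤ θ * (V K * θ ^ n) := by gcongr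
        _ = _ := by ring
  set ρ := Real.sqrt θ with hρ
  have hρ0 : 0 < ρ := Real.sqrt_pos.2 hθ0
  have hρ1 : ρ < 1 := by rw [hρ, Real.sqrt_lt' one_pos]; simpa using hθ1
  have hρsq : ρ ^ 2 = θ := Real.sq_sqrt hθ0.le
  set C₁ := Real.sqrt (V K / κ) with hC₁
  have hC₁0 : 0 ≤ C₁ := Real.sqrt_nonneg _
  have hC₁sq : C₁ ^ 2 = V K / κ := Real.sq_sqrt (div_nonneg (hV0 K) hκ.le)
  have hgap : ∀ n, D.gap (n + K) ≤ (C₁ * ρ ^ n) ^ 2 := by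
    intro n
    have h1 : D.gap (n + K) ≤ V (n + K) / κ := by
      rw [le_div_iff₀ hκ]
      linarith [hVdes (n + K), hV0 (n + K + 1)]
    calc D.gap (n + K) ≤ V (n + K) / κ := h1
      _ ≤ (V K * θ ^ n) / κ := by gcongr; exact hVgeo n
      _ = (C₁ * ρ ^ n) ^ 2 := by
        rw [mul_pow, ← pow_mul, mul_comm n 2, pow_mul, hρsq, hC₁sq]; ring
  have hσ := h.hσ
  have hτ := h.hτ
  set C₂ := (1 + D.τ * D.σ) * C₁ with hC₂
  have hC₁₂ : C₁ ≤ C₂ := by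
    rw [hC₂]
    exact le_mul_of_one_le_left hC₁0 (by nlinarith [mul_pos hτ hσ])
  have hstep : ∀ n, dist (D.y (n + (K + 1)), D.z (n + (K + 1)), D.x (n + (K + 1)))
      (D.y (n + 1 + (K + 1)), D.z (n + 1 + (K + 1)), D.x (n + 1 + (K + 1))) ≤ C₂ * ρ ^ n := by
    intro n
    have i1 : n + (K + 1) = n + K + 1 := by lia
    have i2 : n + 1 + (K + 1) = n + K + 2 := by lia
    rw [i1, i2, dist_comm, dist_eq_norm]
    have hpos : 0 ≤ C₁ * ρ ^ n := by positivity
    have hle : C₁ * ρ ^ n ≤ C₂ * ρ ^ n := by gcongr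
    simp only [Prod.norm_def, Prod.mk_sub_mk, sup_le_iff]
    refine ⟨?_, ?_, ?_⟩
    · exact (abs_le_of_sq_le_sq' ((D.norm_sub_y_sq_le_gap _).trans (hgap n)) hpos).2.trans hle
    · exact (abs_le_of_sq_le_sq' ((D.norm_sub_z_sq_le_gap _).trans (hgap n)) hpos).2.trans hle
    · have hx := h.stepX (n + K + 1)
      simp only [show n + K + 1 + 1 = n + K + 2 from rfl] at hx
      have hr := (abs_le_of_sq_le_sq' ((D.norm_r_succ_sq_le_gap _).trans (hgap n)) hpos).2
      rw [hx, add_sub_cancel_left, norm_smul, Real.norm_of_nonneg (by positivity)]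
      calc D.τ * D.σ * ‖D.r (n + K + 2)‖ ≤ D.τ * D.σ * (C₁ * ρ ^ n) := by gcongr
        _ ≤ (1 + D.τ * D.σ) * (C₁ * ρ ^ n) := by gcongr; linarith
        _ = C₂ * ρ ^ n := by rw [hC₂]; ring
  have hdist := dist_le_of_le_geometric_of_tendsto ρ C₂ hρ1 hstep
    ((Filter.tendsto_add_atTop_iff_nat (K + 1)).2 hconv)
  obtain ⟨C, hC, hfin⟩ := exists_geometric_bound
    (a := fun k => ‖D.y k - u.1‖ + ‖D.z k - u.2.1‖ + ‖D.x k - u.2.2‖) (fun k => by positivity)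
    (C := 3 * (C₂ / (1 - ρ))) (ρ := ρ)
    (mul_nonneg (by norm_num) (div_nonneg (hC₁0.trans hC₁₂) (by linarith))) hρ0 (K + 1)
    (fun n => by
      have hd := hdist n
      rw [dist_eq_norm] at hd
      simp only [Prod.norm_def, Prod.fst_sub, Prod.snd_sub, sup_le_iff] at hd
      have e : 3 * (C₂ / (1 - ρ)) * ρ ^ n = 3 * (C₂ * ρ ^ n / (1 - ρ)) := by ring
      rw [e]
      linarith [hd.1, hd.2.1, hd.2.2])
  exact ⟨C, hC, ρ, hρ0, hρ1, hfin⟩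

variable [FiniteDimensional ℝ X]

lemma exists_tendsto_isKKT (h : D.Valid) (hne : ∃ u, D.IsKKT u) :
    ∃ u, D.IsKKT u ∧
      Filter.Tendsto (fun k => (D.y k, D.z k, D.x k)) Filter.atTop (nhds u) := by
  have : ProperSpace X := FiniteDimensional.proper ℝ X
  have : ProperSpace Y := FiniteDimensional.proper ℝ Y
  have : ProperSpace Z := FiniteDimensional.proper ℝ Z
  obtain ⟨α, hα, κ, hκ, hdes⟩ := psi_descent h
  obtain ⟨m, hm, hlow⟩ := psi_lower h hα
  obtain ⟨M, hM, hupp⟩ := psi_upper h hα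
  have hnn : ∀ u, D.IsKKT u → ∀ k, 0 ≤ D.psi α u k := fun u hu k =>
    le_trans (by positivity) (hlow u hu k)
  have hanti : ∀ u, D.IsKKT u → Antitone (D.psi α u) := fun u hu =>
    antitone_nat_of_succ_le fun k => by
      nlinarith [hdes u hu k, D.gap_nonneg k]
  have hlim : ∀ u, D.IsKKT u → ∃ l, Filter.Tendsto (D.psi α u) Filter.atTop (nhds l) :=
    fun u hu => ⟨_, tendsto_atTop_ciInf (hanti u hu) ⟨0, by rintro _ ⟨k, rfl⟩; exact hnn u hu k⟩⟩
  obtain ⟨u₀, hu₀⟩ := hne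
  have hgap : Filter.Tendsto D.gap Filter.atTop (nhds 0) := by
    obtain ⟨l, hl⟩ := hlim u₀ hu₀
    have hd : Filter.Tendsto (fun k => (D.psi α u₀ k - D.psi α u₀ (k + 1)) / κ) Filter.atTop
        (nhds 0) := by
      simpa using (hl.sub ((Filter.tendsto_add_atTop_iff_nat 1).2 hl)).div_const κ
    refine squeeze_zero (D.gap_nonneg) (fun k => ?_) hd
    rw [le_div_iff₀ hκ]
    linarith [hdes u₀ hu₀ k]
  have hdy : Filter.Tendsto (fun k => D.y (k + 2) - D.y (k + 1)) Filter.atTop (nhds 0) :=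
    tendsto_zero_of_norm_sq_le hgap D.norm_sub_y_sq_le_gap
  have hdz : Filter.Tendsto (fun k => D.z (k + 2) - D.z (k + 1)) Filter.atTop (nhds 0) :=
    tendsto_zero_of_norm_sq_le hgap D.norm_sub_z_sq_le_gap
  have hr1 : Filter.Tendsto (fun k => D.r (k + 1)) Filter.atTop (nhds 0) :=
    tendsto_zero_of_norm_sq_le hgap D.norm_r_sq_le_gap
  have hr2 : Filter.Tendsto (fun k => D.r (k + 2)) Filter.atTop (nhds 0) :=
    (Filter.tendsto_add_atTop_iff_nat 1).2 hr1
  have hdz' : Filter.Tendsto (fun k => D.z (k + 1) - D.z k) Filter.atTop (nhds 0) :=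
    (Filter.tendsto_add_atTop_iff_nat 1).1 hdz
  have hbd : ∀ k, (D.y (k + 1), D.z (k + 1), D.x (k + 1)) ∈
      Metric.closedBall u₀ (D.psi α u₀ 0 / m + 1) := by
    intro k
    have hb : ‖D.y (k + 1) - u₀.1‖ ^ 2 + ‖D.z (k + 1) - u₀.2.1‖ ^ 2
        + ‖D.x (k + 1) - u₀.2.2‖ ^ 2 ≤ D.psi α u₀ 0 / m := by
      rw [le_div_iff₀ hm]
      linarith [hlow u₀ hu₀ k, hanti u₀ hu₀ (Nat.zero_le k)]
    have hsq : ∀ a b : ℝ, a ^ 2 ≤ b → a ≤ b + 1 := fun a b hab => by nlinarith [sq_nonneg (a - 1)]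
    rw [Metric.mem_closedBall, dist_eq_norm]
    simp only [Prod.norm_def, Prod.fst_sub, Prod.snd_sub, sup_le_iff]
    refine ⟨hsq _ _ ?_, hsq _ _ ?_, hsq _ _ ?_⟩ <;>
      nlinarith [sq_nonneg ‖D.y (k + 1) - u₀.1‖, sq_nonneg ‖D.z (k + 1) - u₀.2.1‖,
        sq_nonneg ‖D.x (k + 1) - u₀.2.2‖]
  obtain ⟨u, -, φ, hφ, hconv⟩ := tendsto_subseq_of_bounded Metric.isBounded_closedBall hbd
  have hφt := hφ.tendsto_atTop
  have cy : Filter.Tendsto (fun j => D.y (φ j + 1)) Filter.atTop (nhds u.1) :=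
    (continuous_fst.tendsto u).comp hconv
  have cz : Filter.Tendsto (fun j => D.z (φ j + 1)) Filter.atTop (nhds u.2.1) :=
    ((continuous_fst.comp continuous_snd).tendsto u).comp hconv
  have cx : Filter.Tendsto (fun j => D.x (φ j + 1)) Filter.atTop (nhds u.2.2) :=
    ((continuous_snd.comp continuous_snd).tendsto u).comp hconv
  have hdyφ := hdy.comp hφt
  have hdzφ := hdz.comp hφt
  have hrφ := hr2.comp hφt
  have cF := continuous_of_cocoercive D.F D.Sf h.cocoF
  have cG := continuous_of_cocoercive D.G D.Sg h.cocoG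
  have hu : D.IsKKT u := by
    refine ⟨?_, ?_, ?_⟩
    · refine h.closedP (fun j => D.y (φ j + 2)) (fun j => -(D.F (D.y (φ j + 1))
        + D.A (D.x (φ j + 1)) + D.σ • D.A (D.r (φ j + 2) - D.Bt (D.z (φ j + 2) - D.z (φ j + 1)))
        + D.P (D.y (φ j + 2) - D.y (φ j + 1)))) _ _ ?_ ?_ ?_
      · simpa using hdyφ.add cy
      · have l1 := ((cF.tendsto _).comp cy).add ((D.A.continuous.tendsto _).comp cx)
        have l2 := (((D.A.continuous.tendsto _).comp
          (hrφ.sub ((D.Bt.continuous.tendsto _).comp hdzφ))).const_smul D.σ)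
        have l3 := (D.P.continuous.tendsto _).comp hdyφ
        simpa using ((l1.add l2).add l3).neg
      · intro j
        have e : D.r (φ j + 2) - D.Bt (D.z (φ j + 2) - D.z (φ j + 1))
            = D.At (D.y (φ j + 2)) + D.Bt (D.z (φ j + 1)) - D.c := by
          simp only [r, map_sub]; abel
        simp only [e]
        exact h.stepY (φ j + 1)
    · refine h.closedQ (fun j => D.z (φ j + 2)) (fun j => -(D.G (D.z (φ j + 1))
        + D.B (D.x (φ j + 1)) + D.σ • D.B (D.r (φ j + 2))
        + D.Q (D.z (φ j + 2) - D.z (φ j + 1)))) _ _ ?_ ?_ ?_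
      · simpa using hdzφ.add cz
      · have l1 := ((cG.tendsto _).comp cz).add ((D.B.continuous.tendsto _).comp cx)
        have l2 := ((D.B.continuous.tendsto _).comp hrφ).const_smul D.σ
        have l3 := (D.Q.continuous.tendsto _).comp hdzφ
        simpa using ((l1.add l2).add l3).neg
      · exact fun j => h.stepZ (φ j + 1)
    · have l := (((D.At.continuous.tendsto _).comp cy).add
        ((D.Bt.continuous.tendsto _).comp cz)).sub_const D.c
      exact sub_eq_zero.1 (tendsto_nhds_unique l (hr1.comp hφt))
  have hzero : Filter.Tendsto (fun j => D.psi α u (φ j)) Filter.atTop (nhds 0) := by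
    refine squeeze_zero (fun j => hnn u hu _) (fun j => hupp u (φ j)) ?_
    have l1 := ((cy.sub_const u.1).norm.pow 2)
    have l2 := ((cz.sub_const u.2.1).norm.pow 2)
    have l3 := ((cx.sub_const u.2.2).norm.pow 2)
    have l4 := ((hdz'.comp hφt).norm.pow 2)
    have l5 := ((hr1.comp hφt).norm.pow 2)
    simpa using ((((l1.add l2).add l3).add l4).add l5).const_mul M
  have hpsi : Filter.Tendsto (D.psi α u) Filter.atTop (nhds 0) := by
    obtain ⟨l, hl⟩ := hlim u hu
    rwa [tendsto_nhds_unique (hl.comp hφt) hzero] at hl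
  refine ⟨u, hu, ?_⟩
  have hdist : Filter.Tendsto (fun k => D.psi α u k / m) Filter.atTop (nhds 0) := by
    simpa using hpsi.div_const m
  have hb : ∀ k, ‖D.y (k + 1) - u.1‖ ^ 2 + ‖D.z (k + 1) - u.2.1‖ ^ 2
      + ‖D.x (k + 1) - u.2.2‖ ^ 2 ≤ D.psi α u k / m := fun k => by
    rw [le_div_iff₀ hm]
    linarith [hlow u hu k]
  have ny := fun k => sq_nonneg ‖D.y (k + 1) - u.1‖
  have nz := fun k => sq_nonneg ‖D.z (k + 1) - u.2.1‖
  have nx := fun k => sq_nonneg ‖D.x (k + 1) - u.2.2‖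
  rw [← Filter.tendsto_add_atTop_iff_nat 1]
  refine Filter.Tendsto.prodMk_nhds (tendsto_sub_nhds_zero_iff.1
    (tendsto_zero_of_norm_sq_le hdist fun k => ?_)) (Filter.Tendsto.prodMk_nhds
    (tendsto_sub_nhds_zero_iff.1 (tendsto_zero_of_norm_sq_le hdist fun k => ?_))
    (tendsto_sub_nhds_zero_iff.1 (tendsto_zero_of_norm_sq_le hdist fun k => ?_)))
  all_goals linarith [ny k, nz k, nx k, hb k]

end ProxADMM

section Subgradient

variable {E : Type*} [NormedAddCommGroup E] [InnerProductSpace ℝ E]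

/-- `v` is a subgradient of the extended-real-valued function `P` at `y`. -/
def IsSubgradient (P : E → EReal) (y v : E) : Prop :=
  ∀ w, P y + ((⟪v, w - y⟫ : ℝ) : EReal) ≤ P w

lemma ERProper.exists_coe_of_add_le {P : E → EReal} (hP : ERProper P) {y : E}
    {φ ψ : E → ℝ} (h : ∀ w, P y + (φ w : EReal) ≤ P w + (ψ w : EReal)) :
    ∃ a : ℝ, P y = a := by
  obtain ⟨w₀, hw₀⟩ := hP.1
  refine ⟨(P y).toReal, (EReal.coe_toReal (fun htop => ?_) (hP.2 y)).symm⟩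
  have h0 := h w₀
  rw [htop, EReal.top_add_coe, top_le_iff] at h0
  exact EReal.add_ne_top hw₀ (EReal.coe_ne_top _) h0

lemma IsSubgradient.exists_coe {P : E → EReal} (hP : ERProper P) {y v : E}
    (h : IsSubgradient P y v) : ∃ a : ℝ, P y = a :=
  hP.exists_coe_of_add_le (φ := fun w => ⟪v, w - y⟫) (ψ := fun _ => 0) fun w => by
    simpa using h w

lemma IsSubgradient.monotone {P : E → EReal} (hP : ERProper P) {a v b w : E}
    (h₁ : IsSubgradient P a v) (h₂ : IsSubgradient P b w) : 0 ≤ ⟪v - w, a - b⟫ := by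
  obtain ⟨α, hα⟩ := h₁.exists_coe hP
  obtain ⟨β, hβ⟩ := h₂.exists_coe hP
  have h1 := h₁ b
  have h2 := h₂ a
  rw [hα, hβ] at h1 h2
  norm_cast at h1 h2
  have e : ⟪v, b - a⟫ = -⟪v, a - b⟫ := by rw [← inner_neg_right, neg_sub]
  rw [inner_sub_left]
  linarith

lemma IsSubgradient.of_tendsto {P : E → EReal} (hP : ERProper P)
    (hlsc : LowerSemicontinuous P) {a v : ℕ → E} {a' v' : E}
    (ha : Filter.Tendsto a Filter.atTop (nhds a')) (hv : Filter.Tendsto v Filter.atTop (nhds v'))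
    (h : ∀ n, IsSubgradient P (a n) (v n)) : IsSubgradient P a' v' := by
  intro w
  rcases eq_or_ne (P w) ⊤ with htop | htop
  · rw [htop]; exact le_top
  obtain ⟨b, hb⟩ : ∃ b : ℝ, P w = b := ⟨_, (EReal.coe_toReal htop (hP.2 w)).symm⟩
  have hc : Filter.Tendsto (fun n => b - ⟪v n, w - a n⟫) Filter.atTop
      (nhds (b - ⟪v', w - a'⟫)) :=
    tendsto_const_nhds.sub (hv.inner (tendsto_const_nhds.sub ha))
  have hle : P a' ≤ ((b - ⟪v', w - a'⟫ : ℝ) : EReal) := by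
    refine EReal.le_of_forall_lt_iff_le.1 fun z hz => ?_
    by_contra hcon
    push Not at hcon
    have hzP : ∀ᶠ n in Filter.atTop, (z : EReal) < P (a n) := ha.eventually (hlsc a' z hcon)
    have hz' : b - ⟪v', w - a'⟫ < z := by exact_mod_cast hz
    obtain ⟨n, hn1, hn2⟩ := (hzP.and (hc.eventually_lt_const hz')).exists
    obtain ⟨α, hα⟩ := (h n).exists_coe hP
    have h1 := h n w
    rw [hα, hb] at h1
    rw [hα] at hn1
    norm_cast at h1 hn1
    linarith
  obtain ⟨α, hα⟩ : ∃ α : ℝ, P a' = α :=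
    ⟨_, (EReal.coe_toReal (ne_top_of_le_ne_top (EReal.coe_ne_top _) hle) (hP.2 a')).symm⟩
  rw [hα] at hle ⊢
  rw [hb]
  norm_cast at hle ⊢
  linarith

lemma IsSubgradient.of_isMin {P : E → EReal} (hP : ERProper P) (hconv : ERConvex P)
    {φ : E → ℝ} {y g : E} (hmin : ∀ w, P y + (φ y : EReal) ≤ P w + (φ w : EReal))
    (hexp : ∀ d : E, ∃ K : ℝ, ∀ s : ℝ, φ (y + s • d) = φ y + s * ⟪g, d⟫ + s ^ 2 * K) :
    IsSubgradient P y (-g) := by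
  intro w
  rcases eq_or_ne (P w) ⊤ with htop | htop
  · rw [htop]; exact le_top
  obtain ⟨b, hb⟩ : ∃ b : ℝ, P w = b := ⟨_, (EReal.coe_toReal htop (hP.2 w)).symm⟩
  obtain ⟨a, ha⟩ := hP.exists_coe_of_add_le (φ := fun _ => φ y) hmin
  obtain ⟨K, hK⟩ := hexp (w - y)
  rw [ha, hb]
  norm_cast
  rw [inner_neg_left]
  have key : ∀ s : ℝ, 0 < s → s ≤ 1 → 0 ≤ (b - a) + ⟪g, w - y⟫ + s * K := by
    intro s hs hs1
    have h1 := hconv y w (1 - s) s (by linarith) hs.le (by ring)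
    have e : (1 - s) • y + s • w = y + s • (w - y) := by module
    rw [e, ha, hb] at h1
    have h2 := hmin (y + s • (w - y))
    rw [hK s] at h2
    obtain ⟨c, hc⟩ : ∃ c : ℝ, P (y + s • (w - y)) = c :=
      ⟨_, (EReal.coe_toReal (ne_top_of_le_ne_top (by norm_cast; exact EReal.coe_ne_top _) h1)
        (hP.2 _)).symm⟩
    rw [hc] at h1 h2
    rw [ha] at h2
    norm_cast at h1 h2
    have h3 : 0 ≤ s * ((b - a) + ⟪g, w - y⟫ + s * K) := by nlinarith
    exact nonneg_of_mul_nonneg_right h3 hs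
  have hlim : Filter.Tendsto (fun s : ℝ => (b - a) + ⟪g, w - y⟫ + s * K)
      (nhdsWithin 0 (Set.Ioi 0)) (nhds ((b - a) + ⟪g, w - y⟫ + 0 * K)) :=
    (Continuous.tendsto (by fun_prop) 0).mono_left nhdsWithin_le_nhds
  have h0 := ge_of_tendsto hlim (by
    filter_upwards [Ioo_mem_nhdsGT (zero_lt_one' ℝ)] with s hs using key s hs.1 hs.2.le)
  linarith

lemma ConvexOn.add_inner_le [CompleteSpace E] {f : E → ℝ} (hf : ConvexOn ℝ Set.univ f) {g a : E}
    (hg : HasGradientAt f g a) (b : E) : f a + ⟪g, b - a⟫ ≤ f b := by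
  have hline : ConvexOn ℝ Set.univ (f ∘ AffineMap.lineMap (k := ℝ) a b) := by
    simpa using hf.comp_affineMap (AffineMap.lineMap (k := ℝ) a b)
  have hder : HasDerivAt (f ∘ AffineMap.lineMap (k := ℝ) a b) ⟪g, b - a⟫ 0 := by
    have h1 : HasFDerivAt f (InnerProductSpace.toDual ℝ E g)
        (AffineMap.lineMap (k := ℝ) a b (0 : ℝ)) := by
      simpa using hg.hasFDerivAt
    simpa using h1.comp_hasDerivAt (0 : ℝ) AffineMap.hasDerivAt_lineMap
  have h := hline.le_slope_of_hasDerivAt (Set.mem_univ 0) (Set.mem_univ 1) one_pos hder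
  simp [slope] at h
  linarith

/-- Cocoercivity of the gradient of a convex function with a quadratic majorant. -/
lemma ConvexOn.inner_gradient_sub_le [CompleteSpace E] {f : E → ℝ}
    (hf : ConvexOn ℝ Set.univ f) {g : E → E} (hg : ∀ w, HasGradientAt f (g w) w) (S : E →ₗ[ℝ] E)
    (hmaj : ∀ w w', f w ≤ f w' + ⟪g w', w - w'⟫ + 1 / 2 * ⟪w - w', S (w - w')⟫) (a b w : E) :
    ⟪g a - g b, w⟫ ≤ 1 / 4 * ⟪a - b + w, S (a - b + w)⟫ := by
  obtain ⟨v, hv⟩ : ∃ v, a - b + w = (2 : ℝ) • v := ⟨(1 / 2 : ℝ) • (a - b + w), by module⟩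
  have hw : w = b - a + (2 : ℝ) • v := by rw [← hv]; abel
  have h1 := hf.add_inner_le (hg a) (b + v)
  have h2 := hf.add_inner_le (hg b) (a - v)
  have h3 := hmaj (b + v) b
  have h4 := hmaj (a - v) a
  have e3 : b + v - b = v := by abel
  have e4 : a - v - a = -v := by abel
  rw [e3] at h3
  rw [e4, map_neg, inner_neg_neg] at h4
  rw [hv, hw]
  simp only [map_smul, inner_sub_left, inner_add_right, inner_sub_right,
    inner_smul_left, inner_smul_right, inner_neg_right, RCLike.conj_to_real] at *
  linarith

end Subgradient

section Block

variable {ι : Type*} [Fintype ι] {i₀ : ι} {V : ι → Type*}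
  [∀ i, NormedAddCommGroup (V i)] [∀ i, InnerProductSpace ℝ (V i)]
  [∀ i, FiniteDimensional ℝ (V i)]

/-- The block operator with components `A i`, into the Euclidean product. -/
def blockOp (A : ∀ i, X →ₗ[ℝ] V i) : X →ₗ[ℝ] PiLp 2 V where
  toFun x := WithLp.toLp 2 fun i => A i x
  map_add' x x' := by ext i; simp
  map_smul' a x := by ext i; simp

/-- The adjoint of `blockOp`. -/
def blockOpStar (A : ∀ i, X →ₗ[ℝ] V i) : PiLp 2 V →ₗ[ℝ] X where
  toFun w := opStar A w.ofLp
  map_add' w w' := by simp [opStar, Finset.sum_add_distrib]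
  map_smul' a w := by simp [opStar, Finset.smul_sum]

/-- The block-diagonal operator on the Euclidean product. -/
def blockDiag (D : ∀ i, V i →ₗ[ℝ] V i) : PiLp 2 V →ₗ[ℝ] PiLp 2 V where
  toFun w := WithLp.toLp 2 fun i => D i (w i)
  map_add' w w' := by ext i; simp
  map_smul' a w := by ext i; simp

/-- The strictly lower block-triangular part of `σ A A*`. -/
def blockLower [LinearOrder ι] (σ : ℝ) (A : ∀ i, X →ₗ[ℝ] V i) : PiLp 2 V →ₗ[ℝ] PiLp 2 V where
  toFun w := WithLp.toLp 2 fun i =>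
    σ • A i (∑ j ∈ Finset.univ.filter (fun j => j < i), LinearMap.adjoint (A j) (w j))
  map_add' w w' := by ext i; simp [Finset.sum_add_distrib]
  map_smul' a w := by
    ext i
    simp only [PiLp.smul_apply, map_smul, ← Finset.smul_sum, RingHom.id_apply]
    rw [smul_comm]

/-- The operator `Diag(Σ_i + S_i) + sGS`. -/
def sgsProx [LinearOrder ι] (σ : ℝ) (A : ∀ i, X →ₗ[ℝ] V i) (Sf S Minv : ∀ i, V i →ₗ[ℝ] V i) :
    PiLp 2 V →ₗ[ℝ] PiLp 2 V :=
  blockDiag Sf + blockDiag S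
    + LinearMap.adjoint (blockLower σ A) ∘ₗ blockDiag Minv ∘ₗ blockLower σ A

lemma inner_blockDiag (D : ∀ i, V i →ₗ[ℝ] V i) (v w : PiLp 2 V) :
    ⟪v, blockDiag D w⟫ = ∑ i, ⟪v i, D i (w i)⟫ := by
  simp [blockDiag, PiLp.inner_apply]

lemma inner_blockOp (A : ∀ i, X →ₗ[ℝ] V i) (x : X) (w : PiLp 2 V) :
    ⟪blockOp A x, w⟫ = ⟪x, blockOpStar A w⟫ := by
  simp [blockOp, blockOpStar, opStar, PiLp.inner_apply, inner_sum, LinearMap.adjoint_inner_right]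

lemma inner_sgsProx [LinearOrder ι] (σ : ℝ) (A : ∀ i, X →ₗ[ℝ] V i)
    (Sf S Minv : ∀ i, V i →ₗ[ℝ] V i) (w : PiLp 2 V) :
    ⟪w, sgsProx σ A Sf S Minv w⟫
      = quadDiag Sf w.ofLp + quadDiag S w.ofLp + sgsQuad σ A Minv w.ofLp := by
  simp only [sgsProx, LinearMap.add_apply, LinearMap.comp_apply, inner_add_right,
    LinearMap.adjoint_inner_right, inner_blockDiag]
  rfl

lemma sgsProx_isSymmetric [LinearOrder ι] (σ : ℝ) (A : ∀ i, X →ₗ[ℝ] V i)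
    {Sf S Minv : ∀ i, V i →ₗ[ℝ] V i} (hSf : ∀ i, (Sf i).IsSymmetric)
    (hS : ∀ i, (S i).IsSymmetric) (hM : ∀ i, (Minv i).IsSymmetric) :
    (sgsProx σ A Sf S Minv).IsSymmetric := by
  have hd : ∀ D : ∀ i, V i →ₗ[ℝ] V i, (∀ i, (D i).IsSymmetric) →
      ∀ v w, ⟪blockDiag D v, w⟫ = ⟪v, blockDiag D w⟫ := by
    intro D hD v w
    rw [real_inner_comm, inner_blockDiag, inner_blockDiag]
    exact Finset.sum_congr rfl fun i _ => by rw [real_inner_comm, hD i]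
  intro v w
  simp only [sgsProx, LinearMap.add_apply, LinearMap.comp_apply, inner_add_right, inner_add_left,
    LinearMap.adjoint_inner_right, LinearMap.adjoint_inner_left, hd Sf hSf, hd S hS, hd Minv hM]

/-- Pairwise expansion of the squared norm of a finite sum along a linear order. -/
lemma norm_sum_sq_eq [LinearOrder ι] {E : Type*} [NormedAddCommGroup E] [InnerProductSpace ℝ E]
    (a : ι → E) : ‖∑ i, a i‖ ^ 2
      = ∑ i, ‖a i‖ ^ 2 + 2 * ∑ i, ⟪a i, ∑ j ∈ Finset.univ.filter (fun j => j < i), a j⟫ := by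
  have hsplit : ∀ i, ∑ j, ⟪a i, a j⟫ = ‖a i‖ ^ 2
      + ∑ j, (if j < i then ⟪a i, a j⟫ else 0) + ∑ j, (if i < j then ⟪a i, a j⟫ else 0) := by
    intro i
    have h1 : ‖a i‖ ^ 2 = ∑ j, (if j = i then ⟪a i, a j⟫ else 0) := by
      simp
    rw [h1, ← Finset.sum_add_distrib, ← Finset.sum_add_distrib]
    refine Finset.sum_congr rfl fun j _ => ?_
    rcases lt_trichotomy j i with h | h | h
    · simp [h, h.ne, h.not_gt]
    · simp [h]
    · simp [h, h.ne', h.not_gt]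
  have hswap : ∑ i, ∑ j, (if i < j then ⟪a i, a j⟫ else 0)
      = ∑ i, ∑ j, (if j < i then ⟪a i, a j⟫ else 0) := by
    rw [Finset.sum_comm]
    simp only [real_inner_comm]
  rw [← real_inner_self_eq_norm_sq, sum_inner]
  simp only [inner_sum]
  simp only [Finset.sum_filter, hsplit, Finset.sum_add_distrib, hswap]
  ring

/-- The quadratic form of the proximal operator minus half the majorant. -/
lemma inner_sgsProx_sub [LinearOrder ι] (σ : ℝ) (A : ∀ i, X →ₗ[ℝ] V i)
    (Sf S Minv : ∀ i, V i →ₗ[ℝ] V i) (w : PiLp 2 V) :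
    ⟪w, sgsProx σ A Sf S Minv w⟫ - 1 / 2 * ⟪w, blockDiag Sf w⟫
      = ∑ i, (1 / 2 * ⟪w i, Sf i (w i)⟫ + ⟪w i, S i (w i)⟫) + sgsQuad σ A Minv w.ofLp := by
  rw [inner_sgsProx, inner_blockDiag, quadDiag, quadDiag, Finset.sum_add_distrib,
    ← Finset.mul_sum]
  ring

/-- The diagonal block `½ Σ_i + S_i + σ A_i A_i*`. -/
def sgsBlock (σ : ℝ) (A : ∀ i, X →ₗ[ℝ] V i) (Sf S : ∀ i, V i →ₗ[ℝ] V i) (i : ι) :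
    V i →ₗ[ℝ] V i :=
  (1 / 2 : ℝ) • Sf i + S i + σ • (A i ∘ₗ LinearMap.adjoint (A i))

lemma sgsBlock_isSymmetric (σ : ℝ) (A : ∀ i, X →ₗ[ℝ] V i) {Sf S : ∀ i, V i →ₗ[ℝ] V i}
    (hSf : ∀ i, (Sf i).IsSymmetric) (hS : ∀ i, (S i).IsSymmetric) (i : ι) :
    (sgsBlock σ A Sf S i).IsSymmetric := by
  intro v w
  simp only [sgsBlock, LinearMap.add_apply, LinearMap.smul_apply, LinearMap.comp_apply,
    inner_add_left, inner_add_right, inner_smul_left, inner_smul_right, RCLike.conj_to_real,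
    hSf i v w, hS i v w, ← LinearMap.adjoint_inner_left (A i),
    ← LinearMap.adjoint_inner_right (A i)]

lemma inner_sgsBlock (σ : ℝ) (A : ∀ i, X →ₗ[ℝ] V i) (Sf S : ∀ i, V i →ₗ[ℝ] V i) (i : ι)
    (w : V i) : ⟪w, sgsBlock σ A Sf S i w⟫ = 1 / 2 * ⟪w, Sf i w⟫ + ⟪w, S i w⟫
      + σ * ‖LinearMap.adjoint (A i) w‖ ^ 2 := by
  simp only [sgsBlock, LinearMap.add_apply, LinearMap.smul_apply, LinearMap.comp_apply,
    inner_add_right, inner_smul_right, ← LinearMap.adjoint_inner_left (A i),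
    real_inner_self_eq_norm_sq]

lemma IsSymmetric.of_inverse {E : Type*} [NormedAddCommGroup E] [InnerProductSpace ℝ E]
    {M N : E →ₗ[ℝ] E} (hM : M.IsSymmetric) (hN : ∀ w, M (N w) = w) : N.IsSymmetric := by
  intro v w
  calc ⟪N v, w⟫ = ⟪N v, M (N w)⟫ := by rw [hN]
    _ = ⟪M (N v), N w⟫ := (hM _ _).symm
    _ = ⟪v, N w⟫ := by rw [hN]

lemma inner_inverse_pos {E : Type*} [NormedAddCommGroup E] [InnerProductSpace ℝ E]
    {M N : E →ₗ[ℝ] E} (hpos : ∀ w, w ≠ 0 → 0 < ⟪w, M w⟫) (hN : ∀ w, M (N w) = w) {v : E}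
    (hv : v ≠ 0) : 0 < ⟪v, N v⟫ := by
  have h0 : N v ≠ 0 := fun h => hv (by rw [← hN v, h, map_zero])
  have := hpos _ h0
  rwa [hN, real_inner_comm] at this

lemma inner_inverse_nonneg {E : Type*} [NormedAddCommGroup E] [InnerProductSpace ℝ E]
    {M N : E →ₗ[ℝ] E} (hpos : ∀ w, w ≠ 0 → 0 < ⟪w, M w⟫) (hN : ∀ w, M (N w) = w) (v : E) :
    0 ≤ ⟪v, N v⟫ := by
  rcases eq_or_ne v 0 with rfl | hv
  · simp
  · exact (inner_inverse_pos hpos hN hv).le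

section Positivity

variable [LinearOrder ι] {σ : ℝ} {A : ∀ i, X →ₗ[ℝ] V i} {Sf S Minv : ∀ i, V i →ₗ[ℝ] V i}

lemma sgsProx_sub_nonneg (hS : ∀ i (w : V i), -(1 / 2) * ⟪w, Sf i w⟫ ≤ ⟪w, S i w⟫)
    (hpos : ∀ i (w : V i), w ≠ 0 → 0 < ⟪w, sgsBlock σ A Sf S i w⟫)
    (hinv : ∀ i (w : V i), sgsBlock σ A Sf S i (Minv i w) = w) (w : PiLp 2 V) :
    0 ≤ ⟪w, sgsProx σ A Sf S Minv w⟫ - 1 / 2 * ⟪w, blockDiag Sf w⟫ := by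
  rw [inner_sgsProx_sub]
  refine add_nonneg (Finset.sum_nonneg fun i _ => ?_) (Finset.sum_nonneg fun i _ => ?_)
  · linarith [hS i (w i)]
  · exact inner_inverse_nonneg (hpos i) (hinv i) _

/-- The sGS decomposition makes `½ Σ + S + sGS + σ A A*` positive definite. -/
lemma eq_zero_of_sgsProx_sub_eq_zero (hσ : 0 < σ)
    (hS : ∀ i (w : V i), -(1 / 2) * ⟪w, Sf i w⟫ ≤ ⟪w, S i w⟫)
    (hpos : ∀ i (w : V i), w ≠ 0 → 0 < ⟪w, sgsBlock σ A Sf S i w⟫)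
    (hinv : ∀ i (w : V i), sgsBlock σ A Sf S i (Minv i w) = w) (w : PiLp 2 V)
    (h0 : ⟪w, sgsProx σ A Sf S Minv w⟫ - 1 / 2 * ⟪w, blockDiag Sf w⟫ = 0)
    (hA : blockOpStar A w = 0) : w = 0 := by
  rw [inner_sgsProx_sub] at h0
  have n1 : ∀ i ∈ Finset.univ, 0 ≤ 1 / 2 * ⟪w i, Sf i (w i)⟫ + ⟪w i, S i (w i)⟫ :=
    fun i _ => by linarith [hS i (w i)]
  have n2 : ∀ i ∈ Finset.univ, 0 ≤ ⟪blockLower σ A w i, Minv i (blockLower σ A w i)⟫ :=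
    fun i _ => inner_inverse_nonneg (hpos i) (hinv i) _
  have s1 := Finset.sum_nonneg n1
  have s2 : 0 ≤ sgsQuad σ A Minv w.ofLp := Finset.sum_nonneg n2
  have z1 := (Finset.sum_eq_zero_iff_of_nonneg n1).1 (by linarith)
  have z2 := (Finset.sum_eq_zero_iff_of_nonneg n2).1
    (show sgsQuad σ A Minv w.ofLp = 0 by linarith)
  have hlow : ∀ i, A i (∑ j ∈ Finset.univ.filter (fun j => j < i),
      LinearMap.adjoint (A j) (w j)) = 0 := by
    intro i
    have hz : blockLower σ A w i = 0 := by
      by_contra hne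
      exact (inner_inverse_pos (hpos i) (hinv i) hne).ne' (z2 i (Finset.mem_univ i))
    exact (smul_eq_zero.1 hz).resolve_left hσ.ne'
  have hnorm := norm_sum_sq_eq fun i => LinearMap.adjoint (A i) (w i)
  have hcross : ∀ i, ⟪LinearMap.adjoint (A i) (w i),
      ∑ j ∈ Finset.univ.filter (fun j => j < i), LinearMap.adjoint (A j) (w j)⟫ = 0 := by
    intro i
    rw [LinearMap.adjoint_inner_left, hlow i, inner_zero_right]
  have hsum : ∑ i, LinearMap.adjoint (A i) (w i) = 0 := hA
  simp only [hcross, hsum, Finset.sum_const_zero, mul_zero, add_zero, norm_zero] at hnorm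
  have hadj := (Finset.sum_eq_zero_iff_of_nonneg fun i _ => sq_nonneg _).1
    (hnorm.symm.trans (by norm_num))
  ext i
  by_contra hne
  refine (hpos i (w i) hne).ne' ?_
  rw [inner_sgsBlock, z1 i (Finset.mem_univ i), hadj i (Finset.mem_univ i)]
  simp

end Positivity

lemma isSubgradient_block_iff (p : V i₀ → EReal) (y v : ∀ i, V i) :
    IsSubgradient (fun w : PiLp 2 V => p (w i₀)) (WithLp.toLp 2 y) (WithLp.toLp 2 v) ↔
      ∀ w : ∀ i, V i, p (y i₀) + ((∑ i, ⟪v i, w i - y i⟫ : ℝ) : EReal) ≤ p (w i₀) := by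
  refine ⟨fun h w => ?_, fun h w => ?_⟩
  · simpa [PiLp.inner_apply] using h (WithLp.toLp 2 w)
  · simpa [PiLp.inner_apply] using h w.ofLp

lemma block_proper {p : V i₀ → EReal} (hp : ERProper p) :
    ERProper fun w : PiLp 2 V => p (w i₀) := by
  classical
  obtain ⟨⟨a, ha⟩, hb⟩ := hp
  exact ⟨⟨WithLp.toLp 2 (Pi.single i₀ a), by simpa using ha⟩, fun w => hb _⟩

lemma block_convex {p : V i₀ → EReal} (hp : ERConvex p) :
    ERConvex fun w : PiLp 2 V => p (w i₀) :=
  fun x y a b ha hb hab => by simpa using hp (x i₀) (y i₀) a b ha hb hab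

lemma block_lsc {p : V i₀ → EReal} (hp : LowerSemicontinuous p) :
    LowerSemicontinuous fun w : PiLp 2 V => p (w i₀) :=
  hp.comp (by fun_prop)

lemma block_cocoercive {f : ∀ i, V i → ℝ} {g : ∀ i, V i → V i} {S : ∀ i, V i →ₗ[ℝ] V i}
    (hf : ∀ i, ConvexOn ℝ Set.univ (f i)) (hg : ∀ i w, HasGradientAt (f i) (g i w) w)
    (hmaj : ∀ i (w w' : V i),
      f i w ≤ f i w' + ⟪g i w', w - w'⟫ + 1 / 2 * ⟪w - w', S i (w - w')⟫) (a b w : PiLp 2 V) :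
    ⟪(WithLp.toLp 2 fun i => g i (a i) : PiLp 2 V) - WithLp.toLp 2 fun i => g i (b i), w⟫
      ≤ 1 / 4 * ⟪a - b + w, blockDiag S (a - b + w)⟫ := by
  rw [inner_blockDiag, Finset.mul_sum, PiLp.inner_apply]
  exact Finset.sum_le_sum fun i _ =>
    (hf i).inner_gradient_sub_le (hg i) (S i) (hmaj i) (a i) (b i) (w i)

lemma isSubgradient_of_block_prox {p : V i₀ → EReal} (hp : ERProper p) (hc : ERConvex p)
    {J : (∀ i, V i) → ∀ i, V i}
    (hJ : ∀ v w : ∀ i, V i, p (J v i₀) + ((1 / 2 * ∑ i, ‖J v i - v i‖ ^ 2 : ℝ) : EReal)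
      ≤ p (w i₀) + ((1 / 2 * ∑ i, ‖w i - v i‖ ^ 2 : ℝ) : EReal)) (v : PiLp 2 V) :
    IsSubgradient (fun w : PiLp 2 V => p (w i₀)) (WithLp.toLp 2 (J v.ofLp))
      (v - WithLp.toLp 2 (J v.ofLp)) := by
  rw [← neg_sub]
  refine IsSubgradient.of_isMin (block_proper hp) (block_convex hc)
    (φ := fun w => 1 / 2 * ‖w - v‖ ^ 2) (fun w => ?_) fun d => ⟨1 / 2 * ‖d‖ ^ 2, fun s => ?_⟩
  · simp only [PiLp.norm_sq_eq_of_L2]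
    exact hJ v.ofLp w.ofLp
  · rw [add_sub_right_comm, norm_add_sq_real, inner_smul_right, norm_smul, mul_pow,
      Real.norm_eq_abs, sq_abs]
    ring

end Block

lemma isSubgradient_of_prox_step {E : Type*} [NormedAddCommGroup E] [InnerProductSpace ℝ E]
    {P : E → EReal} (hP : ERProper P) (hc : ERConvex P)
    {T : E →ₗ[ℝ] X} {Ta : X →ₗ[ℝ] E} (hT : ∀ x w, ⟪Ta x, w⟫ = ⟪x, T w⟫)
    {Q : E →ₗ[ℝ] E} (hQ : Q.IsSymmetric) {σ : ℝ} {a y y₀ : E} {d : X}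
    (hmin : ∀ w, P y
        + ((⟪y, a⟫ + σ / 2 * ‖T y + d‖ ^ 2 + 1 / 2 * ⟪y - y₀, Q (y - y₀)⟫ : ℝ) : EReal)
      ≤ P w + ((⟪w, a⟫ + σ / 2 * ‖T w + d‖ ^ 2 + 1 / 2 * ⟪w - y₀, Q (w - y₀)⟫ : ℝ) : EReal)) :
    IsSubgradient P y (-(a + σ • Ta (T y + d) + Q (y - y₀))) := by
  refine IsSubgradient.of_isMin hP hc
    (φ := fun w => ⟪w, a⟫ + σ / 2 * ‖T w + d‖ ^ 2 + 1 / 2 * ⟪w - y₀, Q (w - y₀)⟫) hmin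
    fun e => ⟨σ / 2 * ‖T e‖ ^ 2 + 1 / 2 * ⟪e, Q e⟫, fun s => ?_⟩
  have e1 : T (y + s • e) + d = (T y + d) + s • T e := by rw [map_add, map_smul]; abel
  have e2 : y + s • e - y₀ = (y - y₀) + s • e := by abel
  rw [e1, e2, norm_add_sq_real, inner_smul_right, norm_smul, mul_pow, Real.norm_eq_abs, sq_abs]
  generalize T y + d = ρ
  generalize y - y₀ = δ
  have h1 : ⟪e, Q δ⟫ = ⟪Q δ, e⟫ := real_inner_comm _ _
  have h2 : ⟪δ, Q e⟫ = ⟪Q δ, e⟫ := (hQ _ _).symm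
  have h3 : ⟪e, a⟫ = ⟪a, e⟫ := real_inner_comm _ _
  simp only [map_add, map_smul, inner_add_left, inner_add_right, inner_smul_left,
    inner_smul_right, RCLike.conj_to_real, hT, h1, h2, h3]
  ring

lemma isSubgradient_of_block_prox_step {ι : Type*} [Fintype ι] [LinearOrder ι] {i₀ : ι}
    {V : ι → Type*} [∀ i, NormedAddCommGroup (V i)] [∀ i, InnerProductSpace ℝ (V i)]
    [∀ i, FiniteDimensional ℝ (V i)] {p : V i₀ → EReal} (hp : ERProper p) (hc : ERConvex p)
    {σ : ℝ} {A : ∀ i, X →ₗ[ℝ] V i} {Sf S Minv : ∀ i, V i →ₗ[ℝ] V i}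
    (hQ : (sgsProx σ A Sf S Minv).IsSymmetric) {a y y₀ : ∀ i, V i} {d : X}
    (hmin : ∀ w : ∀ i, V i,
      p (y i₀) + ((innerPi y a + σ / 2 * ‖opStar A y + d‖ ^ 2 + 1 / 2 * (quadDiag Sf (y - y₀)
          + quadDiag S (y - y₀) + sgsQuad σ A Minv (y - y₀)) : ℝ) : EReal)
        ≤ p (w i₀) + ((innerPi w a + σ / 2 * ‖opStar A w + d‖ ^ 2 + 1 / 2 * (quadDiag Sf (w - y₀)
          + quadDiag S (w - y₀) + sgsQuad σ A Minv (w - y₀)) : ℝ) : EReal)) :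
    IsSubgradient (fun w : PiLp 2 V => p (w i₀)) (WithLp.toLp 2 y)
      (-(WithLp.toLp 2 a + σ • blockOp A (opStar A y + d)
        + sgsProx σ A Sf S Minv (WithLp.toLp 2 y - WithLp.toLp 2 y₀))) := by
  refine isSubgradient_of_prox_step (block_proper hp) (block_convex hc)
    (T := blockOpStar A) (inner_blockOp A) hQ (fun w => ?_)
  simp only [inner_sgsProx]
  simp only [PiLp.inner_apply]
  exact hmin w.ofLp

lemma one_add_sub_sq_pos {τ : ℝ} (h0 : 0 < τ) (h : τ < (1 + Real.sqrt 5) / 2) :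
    0 < 1 + τ - τ ^ 2 := by
  have h5 := Real.sq_sqrt (show (0 : ℝ) ≤ 5 by norm_num)
  have h1 : 1 ≤ Real.sqrt 5 := Real.one_le_sqrt.2 (by norm_num)
  nlinarith [mul_pos (sub_pos.2 h) (show 0 < τ + (Real.sqrt 5 - 1) / 2 by linarith)]

lemma sq_add_sq_add_sq_le {a b c : ℝ} (ha : 0 ≤ a) (hb : 0 ≤ b) (hc : 0 ≤ c) :
    a ^ 2 + b ^ 2 + c ^ 2 ≤ (a + b + c) ^ 2 := by
  nlinarith [mul_nonneg ha hb, mul_nonneg ha hc, mul_nonneg hb hc]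

/-- **Proposition 4.1.**  For the multi-block problem, the majorized sGS-iPADMM — i.e. the
2-block majorized iPADMM with the sGS proximal terms `𝒮 = Diag(𝒮_i) + sGS(M̃)` and
`𝒯 = Diag(𝒯_j) + sGS(Ñ)` — produces a sequence `u^k` such that (a) `u^k` converges to a KKT
point, and (b) if the KKT mapping `ℛ` is metrically subregular at `(ū, 0)` where `ū` is the
limit, then `u^k` converges linearly to `ū`. -/
theorem stmt10
    (A : ∀ i, X →ₗ[ℝ] Yc i) (Bo : ∀ j, X →ₗ[ℝ] Zc j) (c : X)
    (fi : ∀ i, Yc i → ℝ) (gradfi : ∀ i, Yc i → Yc i)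
    (hficonv : ∀ i, ConvexOn ℝ Set.univ (fi i))
    (hfidiff : ∀ i w, HasGradientAt (fi i) (gradfi i w) w)
    (hfiLip : ∀ i, ∃ L : NNReal, LipschitzWith L (gradfi i))
    (gj : ∀ j, Zc j → ℝ) (gradgj : ∀ j, Zc j → Zc j)
    (hgjconv : ∀ j, ConvexOn ℝ Set.univ (gj j))
    (hgjdiff : ∀ j w, HasGradientAt (gj j) (gradgj j w) w)
    (hgjLip : ∀ j, ∃ L : NNReal, LipschitzWith L (gradgj j))
    (p : Yc 0 → EReal) (q : Zc 0 → EReal)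
    (hpconv : ERConvex p) (hplsc : LowerSemicontinuous p) (hpproper : ERProper p)
    (hqconv : ERConvex q) (hqlsc : LowerSemicontinuous q) (hqproper : ERProper q)
    (Sfi : ∀ i, Yc i →ₗ[ℝ] Yc i) (Sgj : ∀ j, Zc j →ₗ[ℝ] Zc j)
    (hSfisym : ∀ i, (Sfi i).IsSymmetric) (hSgjsym : ∀ j, (Sgj j).IsSymmetric)
    (hSfipos : ∀ i (w : Yc i), 0 ≤ ⟪w, Sfi i w⟫)
    (hSgjpos : ∀ j (w : Zc j), 0 ≤ ⟪w, Sgj j w⟫)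
    (hfimaj : ∀ i (w w' : Yc i),
      fi i w ≤ fi i w' + ⟪gradfi i w', w - w'⟫ + 1 / 2 * ⟪w - w', Sfi i (w - w')⟫)
    (hgjmaj : ∀ j (w w' : Zc j),
      gj j w ≤ gj j w' + ⟪gradgj j w', w - w'⟫ + 1 / 2 * ⟪w - w', Sgj j (w - w')⟫)
    (σ τ : ℝ) (hσ : 0 < σ) (hτ : 0 < τ ∧ τ < (1 + Real.sqrt 5) / 2)
    (Si : ∀ i, Yc i →ₗ[ℝ] Yc i) (Tj : ∀ j, Zc j →ₗ[ℝ] Zc j)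
    (hSisym : ∀ i, (Si i).IsSymmetric) (hTjsym : ∀ j, (Tj j).IsSymmetric)
    (hSi : ∀ i (w : Yc i), -(1 / 2) * ⟪w, Sfi i w⟫ ≤ ⟪w, Si i w⟫)
    (hTj : ∀ j (w : Zc j), -(1 / 2) * ⟪w, Sgj j w⟫ ≤ ⟪w, Tj j w⟫)
    (hMpos : ∀ i (w : Yc i), w ≠ 0 →
      0 < ⟪w, ((1 / 2 : ℝ) • Sfi i + Si i + σ • (A i ∘ₗ LinearMap.adjoint (A i))) w⟫)
    (hNpos : ∀ j (w : Zc j), w ≠ 0 →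
      0 < ⟪w, ((1 / 2 : ℝ) • Sgj j + Tj j + σ • (Bo j ∘ₗ LinearMap.adjoint (Bo j))) w⟫)
    (Minv : ∀ i, Yc i →ₗ[ℝ] Yc i) (Ninv : ∀ j, Zc j →ₗ[ℝ] Zc j)
    (hMinv : ∀ i (w : Yc i),
      Minv i (((1 / 2 : ℝ) • Sfi i + Si i + σ • (A i ∘ₗ LinearMap.adjoint (A i))) w) = w ∧
      ((1 / 2 : ℝ) • Sfi i + Si i + σ • (A i ∘ₗ LinearMap.adjoint (A i))) (Minv i w) = w)
    (hNinv : ∀ j (w : Zc j),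
      Ninv j (((1 / 2 : ℝ) • Sgj j + Tj j + σ • (Bo j ∘ₗ LinearMap.adjoint (Bo j))) w) = w ∧
      ((1 / 2 : ℝ) • Sgj j + Tj j + σ • (Bo j ∘ₗ LinearMap.adjoint (Bo j))) (Ninv j w) = w)
    (ys : ℕ → ∀ i, Yc i) (zs : ℕ → ∀ j, Zc j) (xs : ℕ → X)
    (hdomp : ∀ k, p (ys k 0) ≠ ⊤) (hdomq : ∀ k, q (zs k 0) ≠ ⊤)
    (hsubY : ∀ k, ∀ w : ∀ i, Yc i,
      p (ys (k + 1) 0) + ((innerPi (ys (k + 1)) (fun i => gradfi i (ys k i) + A i (xs k))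
          + σ / 2 * ‖opStar A (ys (k + 1)) + opStar Bo (zs k) - c‖ ^ 2
          + 1 / 2 * (quadDiag Sfi (ys (k + 1) - ys k) + quadDiag Si (ys (k + 1) - ys k)
              + sgsQuad σ A Minv (ys (k + 1) - ys k)) : ℝ) : EReal)
      ≤ p (w 0) + ((innerPi w (fun i => gradfi i (ys k i) + A i (xs k))
          + σ / 2 * ‖opStar A w + opStar Bo (zs k) - c‖ ^ 2
          + 1 / 2 * (quadDiag Sfi (w - ys k) + quadDiag Si (w - ys k)
              + sgsQuad σ A Minv (w - ys k)) : ℝ) : EReal))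
    (hsubZ : ∀ k, ∀ w : ∀ j, Zc j,
      q (zs (k + 1) 0) + ((innerPi (zs (k + 1)) (fun j => gradgj j (zs k j) + Bo j (xs k))
          + σ / 2 * ‖opStar A (ys (k + 1)) + opStar Bo (zs (k + 1)) - c‖ ^ 2
          + 1 / 2 * (quadDiag Sgj (zs (k + 1) - zs k) + quadDiag Tj (zs (k + 1) - zs k)
              + sgsQuad σ Bo Ninv (zs (k + 1) - zs k)) : ℝ) : EReal)
      ≤ q (w 0) + ((innerPi w (fun j => gradgj j (zs k j) + Bo j (xs k))
          + σ / 2 * ‖opStar A (ys (k + 1)) + opStar Bo w - c‖ ^ 2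
          + 1 / 2 * (quadDiag Sgj (w - zs k) + quadDiag Tj (w - zs k)
              + sgsQuad σ Bo Ninv (w - zs k)) : ℝ) : EReal))
    (hxup : ∀ k, xs (k + 1)
      = xs k + (τ * σ) • (opStar A (ys (k + 1)) + opStar Bo (zs (k + 1)) - c))
    (hKKTne : (KKTmb A Bo c gradfi gradgj p q).Nonempty)
    (proxP : (∀ i, Yc i) → (∀ i, Yc i)) (proxQ : (∀ j, Zc j) → (∀ j, Zc j))
    (hproxP : ∀ v w : ∀ i, Yc i,
      p (proxP v 0) + ((1 / 2 * ∑ i, ‖proxP v i - v i‖ ^ 2 : ℝ) : EReal)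
        ≤ p (w 0) + ((1 / 2 * ∑ i, ‖w i - v i‖ ^ 2 : ℝ) : EReal))
    (hproxQ : ∀ v w : ∀ j, Zc j,
      q (proxQ v 0) + ((1 / 2 * ∑ j, ‖proxQ v j - v j‖ ^ 2 : ℝ) : EReal)
        ≤ q (w 0) + ((1 / 2 * ∑ j, ‖w j - v j‖ ^ 2 : ℝ) : EReal)) :
    let eunorm : (∀ i, Yc i) × (∀ j, Zc j) × X → ℝ := fun u =>
      Real.sqrt ((∑ i, ‖u.1 i‖ ^ 2) + (∑ j, ‖u.2.1 j‖ ^ 2) + ‖u.2.2‖ ^ 2)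
    let Rmap : (∀ i, Yc i) × (∀ j, Zc j) × X → (∀ i, Yc i) × (∀ j, Zc j) × X := fun u =>
      (u.1 - proxP (fun i => u.1 i - (gradfi i (u.1 i) + A i u.2.2)),
       u.2.1 - proxQ (fun j => u.2.1 j - (gradgj j (u.2.1 j) + Bo j u.2.2)),
       c - opStar A u.1 - opStar Bo u.2.1)
    (∃ ub ∈ KKTmb A Bo c gradfi gradgj p q,
      Filter.Tendsto (fun k => (ys k, zs k, xs k)) Filter.atTop (nhds ub)) ∧
    (∀ ub ∈ KKTmb A Bo c gradfi gradgj p q,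
      Filter.Tendsto (fun k => (ys k, zs k, xs k)) Filter.atTop (nhds ub) →
      (∃ η : ℝ, 0 < η ∧ ∃ ε : ℝ, 0 < ε ∧ ∀ v : (∀ i, Yc i) × (∀ j, Zc j) × X,
        eunorm (v - ub) ≤ ε →
        sInf ((fun w => eunorm (v - w)) '' KKTmb A Bo c gradfi gradgj p q)
          ≤ η * eunorm (Rmap v)) →
      ∃ C : ℝ, 0 < C ∧ ∃ ρ : ℝ, 0 < ρ ∧ ρ < 1 ∧
        ∀ k : ℕ, eunorm ((ys k, zs k, xs k) - ub) ≤ C * ρ ^ k) := by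
  intro eunorm Rmap
  have hMinv' : ∀ i (w : Yc i), sgsBlock σ A Sfi Si i (Minv i w) = w := fun i w => (hMinv i w).2
  have hNinv' : ∀ j (w : Zc j), sgsBlock σ Bo Sgj Tj j (Ninv j w) = w := fun j w => (hNinv j w).2
  have hPsym : (sgsProx σ A Sfi Si Minv).IsSymmetric :=
    sgsProx_isSymmetric σ A hSfisym hSisym fun i =>
      IsSymmetric.of_inverse (sgsBlock_isSymmetric σ A hSfisym hSisym i) (hMinv' i)
  have hQsym : (sgsProx σ Bo Sgj Tj Ninv).IsSymmetric :=
    sgsProx_isSymmetric σ Bo hSgjsym hTjsym fun j =>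
      IsSymmetric.of_inverse (sgsBlock_isSymmetric σ Bo hSgjsym hTjsym j) (hNinv' j)
  let D : ProxADMM X (PiLp 2 Yc) (PiLp 2 Zc) :=
    { A := (blockOp A).toContinuousLinearMap
      At := (blockOpStar A).toContinuousLinearMap
      B := (blockOp Bo).toContinuousLinearMap
      Bt := (blockOpStar Bo).toContinuousLinearMap
      c := c
      σ := σ
      τ := τ
      F := fun w => WithLp.toLp 2 fun i => gradfi i (w i)
      G := fun w => WithLp.toLp 2 fun j => gradgj j (w j)
      Sf := (blockDiag Sfi).toContinuousLinearMap
      Sg := (blockDiag Sgj).toContinuousLinearMap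
      P := (sgsProx σ A Sfi Si Minv).toContinuousLinearMap
      Q := (sgsProx σ Bo Sgj Tj Ninv).toContinuousLinearMap
      MP := IsSubgradient fun w => p (w 0)
      MQ := IsSubgradient fun w => q (w 0)
      y := fun k => WithLp.toLp 2 (ys k)
      z := fun k => WithLp.toLp 2 (zs k)
      x := xs }
  have hD : D.Valid :=
    { adjA := inner_blockOp A
      adjB := inner_blockOp Bo
      hσ := hσ
      hτ := hτ.1
      hτ' := one_add_sub_sq_pos hτ.1 hτ.2
      cocoF := block_cocoercive hficonv hfidiff hfimaj
      cocoG := block_cocoercive hgjconv hgjdiff hgjmaj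
      posSf := fun w => (Finset.sum_nonneg fun i _ => hSfipos i (w i)).trans_eq
        (inner_blockDiag Sfi w w).symm
      posSg := fun w => (Finset.sum_nonneg fun j _ => hSgjpos j (w j)).trans_eq
        (inner_blockDiag Sgj w w).symm
      symP := hPsym
      symQ := hQsym
      posP := sgsProx_sub_nonneg hSi hMpos hMinv'
      posQ := sgsProx_sub_nonneg hTj hNpos hNinv'
      defP := eq_zero_of_sgsProx_sub_eq_zero hσ hSi hMpos hMinv'
      defQ := eq_zero_of_sgsProx_sub_eq_zero hσ hTj hNpos hNinv'
      monoP := fun _ _ _ _ => IsSubgradient.monotone (block_proper hpproper)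
      monoQ := fun _ _ _ _ => IsSubgradient.monotone (block_proper hqproper)
      closedP := fun _ _ _ _ => IsSubgradient.of_tendsto (block_proper hpproper) (block_lsc hplsc)
      closedQ := fun _ _ _ _ => IsSubgradient.of_tendsto (block_proper hqproper) (block_lsc hqlsc)
      stepY := fun k => by
        have := isSubgradient_of_block_prox_step hpproper hpconv hPsym
          (a := fun i => gradfi i (ys k i) + A i (xs k)) (y := ys (k + 1)) (y₀ := ys k)
          (d := opStar Bo (zs k) - c) fun w => by
            simpa only [add_sub_assoc] using hsubY k w
        rw [← add_sub_assoc] at this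
        exact this
      stepZ := fun k => by
        have hcomm : ∀ w, opStar Bo w + (opStar A (ys (k + 1)) - c)
            = opStar A (ys (k + 1)) + opStar Bo w - c := fun w => by abel
        have := isSubgradient_of_block_prox_step hqproper hqconv hQsym
          (a := fun j => gradgj j (zs k j) + Bo j (xs k)) (y := zs (k + 1)) (y₀ := zs k)
          (d := opStar A (ys (k + 1)) - c) fun w => by
            simpa only [hcomm] using hsubZ k w
        rw [hcomm] at this
        exact this
      stepX := hxup }
  have hKKT : ∀ u : PiLp 2 Yc × PiLp 2 Zc × X,
      D.IsKKT u ↔ (u.1.ofLp, u.2.1.ofLp, u.2.2) ∈ KKTmb A Bo c gradfi gradgj p q := fun u =>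
    and_congr (isSubgradient_block_iff p u.1.ofLp fun i => -(gradfi i (u.1 i) + A i u.2.2))
      (and_congr_left' (isSubgradient_block_iff q u.2.1.ofLp fun j =>
        -(gradgj j (u.2.1 j) + Bo j u.2.2)))
  have heu : ∀ a b : (∀ i, Yc i) × (∀ j, Zc j) × X, eunorm (a - b)
      = Real.sqrt (‖(WithLp.toLp 2 a.1 : PiLp 2 Yc) - WithLp.toLp 2 b.1‖ ^ 2
        + ‖(WithLp.toLp 2 a.2.1 : PiLp 2 Zc) - WithLp.toLp 2 b.2.1‖ ^ 2
        + ‖a.2.2 - b.2.2‖ ^ 2) := fun a b => by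
    simp only [PiLp.norm_sq_eq_of_L2]
    rfl
  refine ⟨?_, fun ub hub hlim ⟨η, hη, ε, hε, hreg⟩ => ?_⟩
  · obtain ⟨u₀, hu₀⟩ := hKKTne
    obtain ⟨u, hu, hlim⟩ := ProxADMM.exists_tendsto_isKKT hD
      ⟨(WithLp.toLp 2 u₀.1, WithLp.toLp 2 u₀.2.1, u₀.2.2), (hKKT _).2 hu₀⟩
    refine ⟨_, (hKKT u).1 hu, ?_⟩
    have hcont : Continuous fun v : PiLp 2 Yc × PiLp 2 Zc × X =>
        (v.1.ofLp, v.2.1.ofLp, v.2.2) := by fun_prop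
    exact (hcont.tendsto u).comp hlim
  · have hcont : Continuous fun v : (∀ i, Yc i) × (∀ j, Zc j) × X =>
        ((WithLp.toLp 2 v.1, WithLp.toLp 2 v.2.1, v.2.2) : PiLp 2 Yc × PiLp 2 Zc × X) := by
      fun_prop
    have hlin := ProxADMM.linear_convergence hD
      (fun v => WithLp.toLp 2 (proxP v.ofLp)) (fun v => WithLp.toLp 2 (proxQ v.ofLp))
      (isSubgradient_of_block_prox hpproper hpconv hproxP)
      (isSubgradient_of_block_prox hqproper hqconv hproxQ)
      (u := (WithLp.toLp 2 ub.1, WithLp.toLp 2 ub.2.1, ub.2.2)) ((hKKT _).2 hub)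
      ((hcont.tendsto ub).comp hlim) (η := 2 * η ^ 2) (ε := ε ^ 2) (by positivity)
      (by positivity) fun v hv δ hδ => by
      have hR : eunorm (Rmap (v.1.ofLp, v.2.1.ofLp, v.2.2)) ^ 2
          = ‖v.1 - WithLp.toLp 2 (proxP (v.1 - (D.F v.1 + D.A v.2.2)).ofLp)‖ ^ 2
            + ‖v.2.1 - WithLp.toLp 2 (proxQ (v.2.1 - (D.G v.2.1 + D.B v.2.2)).ofLp)‖ ^ 2
            + ‖D.At v.1 + D.Bt v.2.1 - D.c‖ ^ 2 := by
        have hneg : D.At v.1 + D.Bt v.2.1 - D.c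
            = -(c - opStar A v.1.ofLp - opStar Bo v.2.1.ofLp) := by
          change opStar A v.1.ofLp + opStar Bo v.2.1.ofLp - c = _
          abel
        rw [Real.sq_sqrt (by positivity), hneg, norm_neg]
        simp only [PiLp.norm_sq_eq_of_L2]
        rfl
      have hinf := hreg (v.1.ofLp, v.2.1.ofLp, v.2.2) (by
        rw [heu]
        exact Real.sqrt_le_iff.2 ⟨hε.le, hv⟩)
      have hδ' : 0 < Real.sqrt (δ / 2) := Real.sqrt_pos.2 (by positivity)
      obtain ⟨_, ⟨w, hw, rfl⟩, hlt⟩ := exists_lt_of_csInf_lt (hKKTne.image _)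
        (lt_of_le_of_lt hinf (lt_add_of_pos_right _ hδ'))
      refine ⟨(WithLp.toLp 2 w.1, WithLp.toLp 2 w.2.1, w.2.2), (hKKT _).2 hw, ?_⟩
      rw [← hR]
      simp only [heu] at hlt
      have hsq := (Real.sqrt_le_left (by positivity)).1 hlt.le
      refine hsq.trans ?_
      have := Real.sq_sqrt (show 0 ≤ δ / 2 by positivity)
      nlinarith [sq_nonneg (η * eunorm (Rmap (v.1.ofLp, v.2.1.ofLp, v.2.2)) - Real.sqrt (δ / 2))]
    obtain ⟨C, hC, ρ, hρ, hρ1, hbound⟩ := hlin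
    refine ⟨C, hC, ρ, hρ, hρ1, fun k => le_trans ?_ (hbound k)⟩
    rw [heu]
    refine Real.sqrt_le_iff.2 ⟨by positivity, ?_⟩
    exact sq_add_sq_add_sq_le (norm_nonneg _) (norm_nonneg _) (norm_nonneg _)

end
end

section
/- Let n ≥ 1, λ₁ ≥ 0, λ₂ ≥ 0 and v ∈ ℝⁿ. Let z₀ be the unique minimizer over ℝⁿ of z ↦ λ₂ Σ_{i=2}^n |z_i − z_{i−1}| + ½‖z − v‖², and let z* be the unique minimizer over ℝⁿ of z ↦ λ₁‖z‖₁ + λ₂ Σ_{i=2}^n |z_i − z_{i−1}| + ½‖z − v‖². Then z* is the soft-thresholding of z₀ at level λ₁: for every i, z*_i = sgn((z₀)_i) · max(|(z₀)_i| − λ₁, 0). -/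
noncomputable section

/-- the total-variation (fused) term `Σ_{i=2}^n |z_i − z_{i−1}|` of a vector `z ∈ ℝⁿ`. -/
def tvTerm (n : ℕ) (z : Fin n → ℝ) : ℝ :=
  ∑ i ∈ (Finset.range (n - 1)).attach,
    |z ⟨i.1 + 1, by have := Finset.mem_range.mp i.2; omega⟩
      - z ⟨i.1, by have := Finset.mem_range.mp i.2; omega⟩|

/-- Soft-thresholding of `x` at level `lam`. -/
def softThreshold (lam x : ℝ) : ℝ := Real.sign x * max (|x| - lam) 0

lemma softThreshold_eq {lam : ℝ} (hlam : 0 ≤ lam) (x : ℝ) :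
    softThreshold lam x = max (x - lam) 0 + min (x + lam) 0 := by
  unfold softThreshold
  rcases lt_trichotomy x 0 with hx | rfl | hx
  · rw [Real.sign_of_neg hx, abs_of_neg hx, max_eq_right (by linarith : x - lam ≤ 0)]
    grind
  · simp [hlam]
  · rw [Real.sign_of_pos hx, abs_of_pos hx, min_eq_right (by linarith : 0 ≤ x + lam)]
    ring

lemma softThreshold_mono {lam : ℝ} (hlam : 0 ≤ lam) : Monotone (softThreshold lam) := by
  intro x y hxy
  rw [softThreshold_eq hlam, softThreshold_eq hlam]
  gcongr

lemma sub_softThreshold_mono {lam : ℝ} (hlam : 0 ≤ lam) :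
    Monotone fun x => x - softThreshold lam x := by
  intro x y hxy
  simp only [softThreshold_eq hlam]
  grind

/-- The residual `x - softThreshold lam x` is a subgradient of `lam * |·|` at the
soft-thresholded point. -/
lemma softThreshold_subgradient {lam : ℝ} (hlam : 0 ≤ lam) (x w : ℝ) :
    lam * |softThreshold lam x| + (x - softThreshold lam x) * (w - softThreshold lam x)
      ≤ lam * |w| := by
  rw [softThreshold_eq hlam]
  rcases le_total lam x with h | h
  · rw [max_eq_left (by linarith : 0 ≤ x - lam), min_eq_right (by linarith : 0 ≤ x + lam),
      add_zero, abs_of_nonneg (by linarith : 0 ≤ x - lam)]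
    nlinarith [mul_le_mul_of_nonneg_left (le_abs_self w) hlam]
  · rw [max_eq_right (by linarith : x - lam ≤ 0)]
    rcases le_total x (-lam) with h' | h'
    · rw [min_eq_left (by linarith : x + lam ≤ 0), zero_add,
        abs_of_nonpos (by linarith : x + lam ≤ 0)]
      nlinarith [mul_le_mul_of_nonneg_left (neg_le_abs w) hlam]
    · rw [min_eq_right (by linarith : 0 ≤ x + lam)]
      simp only [add_zero, abs_zero, mul_zero, zero_add, sub_zero]
      calc x * w ≤ |x * w| := le_abs_self _
        _ = |x| * |w| := abs_mul _ _
        _ ≤ lam * |w| := by gcongr; exact abs_le.2 ⟨h', h⟩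

lemma tvTerm_add_le {n : ℕ} (z w : Fin n → ℝ) :
    tvTerm n (z + w) ≤ tvTerm n z + tvTerm n w := by
  unfold tvTerm
  rw [← Finset.sum_add_distrib]
  refine Finset.sum_le_sum fun i _ => ?_
  simp only [Pi.add_apply, add_sub_add_comm]
  exact abs_add_le _ _

lemma tvTerm_smul {n : ℕ} {t : ℝ} (ht : 0 ≤ t) (z : Fin n → ℝ) :
    tvTerm n (t • z) = t * tvTerm n z := by
  unfold tvTerm
  rw [Finset.mul_sum]
  refine Finset.sum_congr rfl fun i _ => ?_
  simp only [Pi.smul_apply, smul_eq_mul, ← mul_sub, abs_mul, abs_of_nonneg ht]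

/-- The total variation is additive along a splitting of the identity into monotone maps. -/
lemma tvTerm_eq_add_of_monotone {n : ℕ} {f : ℝ → ℝ} (hf : Monotone f)
    (hg : Monotone fun x => x - f x) (z : Fin n → ℝ) :
    tvTerm n z = tvTerm n (fun i => f (z i)) + tvTerm n (fun i => z i - f (z i)) := by
  unfold tvTerm
  rw [← Finset.sum_add_distrib]
  refine Finset.sum_congr rfl fun i _ => ?_
  beta_reduce
  generalize z ⟨i.1 + 1, _⟩ = a
  generalize z ⟨i.1, _⟩ = b
  rcases le_total a b with h | h
  · have h₁ := hf h
    have h₂ := hg h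
    simp only at h₂
    rw [abs_of_nonpos (by linarith), abs_of_nonpos (by linarith), abs_of_nonpos (by linarith)]
    ring
  · have h₁ := hf h
    have h₂ := hg h
    simp only at h₂
    rw [abs_of_nonneg (by linarith), abs_of_nonneg (by linarith), abs_of_nonneg (by linarith)]
    ring

lemma nonneg_of_forall_add_mul_nonneg {a b : ℝ}
    (h : ∀ t : ℝ, 0 < t → t ≤ 1 → 0 ≤ a + t * b) : 0 ≤ a := by
  by_contra! ha
  have hb : 0 < |b| + 1 := by positivity
  have ht : 0 < min 1 (-a / (2 * (|b| + 1))) :=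
    lt_min one_pos (div_pos (by linarith) (by positivity))
  have h₁ := h _ ht (min_le_left _ _)
  have h₂ : min 1 (-a / (2 * (|b| + 1))) * (2 * (|b| + 1)) ≤ -a :=
    (le_div_iff₀ (by positivity)).1 (min_le_right _ _)
  nlinarith [mul_le_mul_of_nonneg_left (le_abs_self b) ht.le]

lemma sum_add_smul_sub_sq {n : ℕ} (v z w : Fin n → ℝ) (t : ℝ) :
    ∑ i, ((z + t • w) i - v i) ^ 2
      = ∑ i, (z i - v i) ^ 2 - 2 * t * ∑ i, (v i - z i) * w i + t ^ 2 * ∑ i, w i ^ 2 := by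
  simp only [Finset.mul_sum, ← Finset.sum_sub_distrib, ← Finset.sum_add_distrib, Pi.add_apply,
    Pi.smul_apply, smul_eq_mul]
  exact Finset.sum_congr rfl fun i _ => by ring

/-- The residual at a minimizer lies in the polar set of the total-variation seminorm. -/
lemma sum_residual_mul_le_tvTerm {n : ℕ} {lam : ℝ} (hlam : 0 ≤ lam) {v z : Fin n → ℝ}
    (hz : ∀ w : Fin n → ℝ,
      lam * tvTerm n z + 1 / 2 * ∑ i, (z i - v i) ^ 2
        ≤ lam * tvTerm n w + 1 / 2 * ∑ i, (w i - v i) ^ 2) (w : Fin n → ℝ) :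
    ∑ i, (v i - z i) * w i ≤ lam * tvTerm n w := by
  rw [← sub_nonneg]
  refine nonneg_of_forall_add_mul_nonneg (b := 1 / 2 * ∑ i, w i ^ 2) fun t ht _ => ?_
  have h := hz (z + t • w)
  have h' := mul_le_mul_of_nonneg_left (tvTerm_add_le z (t • w)) hlam
  rw [tvTerm_smul ht.le] at h'
  rw [sum_add_smul_sub_sq] at h
  refine nonneg_of_mul_nonneg_right (a := t) ?_ ht
  linarith

lemma tvTerm_le_sum_residual_mul_self {n : ℕ} {lam : ℝ} {v z : Fin n → ℝ}
    (hz : ∀ w : Fin n → ℝ,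
      lam * tvTerm n z + 1 / 2 * ∑ i, (z i - v i) ^ 2
        ≤ lam * tvTerm n w + 1 / 2 * ∑ i, (w i - v i) ^ 2) :
    lam * tvTerm n z ≤ ∑ i, (v i - z i) * z i := by
  rw [← sub_nonneg]
  refine nonneg_of_forall_add_mul_nonneg (b := 1 / 2 * ∑ i, z i ^ 2) fun t ht ht₁ => ?_
  have h := hz (z + (-t) • z)
  rw [sum_add_smul_sub_sq, show z + (-t) • z = (1 - t) • z by module,
    tvTerm_smul (by linarith)] at h
  refine nonneg_of_mul_nonneg_right (a := t) ?_ ht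
  linarith

/-- **Lemma 5.1.**  For `λ₁, λ₂ ≥ 0` and `v ∈ ℝⁿ`, if `z₀` minimizes
`z ↦ λ₂ Σ_{i=2}^n |z_i − z_{i−1}| + ½‖z − v‖²` and `z*` minimizes
`z ↦ λ₁‖z‖₁ + λ₂ Σ_{i=2}^n |z_i − z_{i−1}| + ½‖z − v‖²`, then `z*` is the soft-thresholding
of `z₀` at level `λ₁`: `z*_i = sgn((z₀)_i)·max(|(z₀)_i| − λ₁, 0)` for every `i`. -/
theorem stmt11 {n : ℕ} (hn : 1 ≤ n) (lam1 lam2 : ℝ)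
    (hlam1 : 0 ≤ lam1) (hlam2 : 0 ≤ lam2)
    (v z0 zstar : Fin n → ℝ)
    (hz0 : ∀ w : Fin n → ℝ,
      lam2 * tvTerm n z0 + 1 / 2 * ∑ i, (z0 i - v i) ^ 2
        ≤ lam2 * tvTerm n w + 1 / 2 * ∑ i, (w i - v i) ^ 2)
    (hzstar : ∀ w : Fin n → ℝ,
      lam1 * (∑ i, |zstar i|) + lam2 * tvTerm n zstar + 1 / 2 * ∑ i, (zstar i - v i) ^ 2
        ≤ lam1 * (∑ i, |w i|) + lam2 * tvTerm n w + 1 / 2 * ∑ i, (w i - v i) ^ 2) :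
    ∀ i : Fin n, zstar i = Real.sign (z0 i) * max (|z0 i| - lam1) 0 := by
  set s : Fin n → ℝ := fun i => softThreshold lam1 (z0 i)
  have hsplit := tvTerm_eq_add_of_monotone (softThreshold_mono hlam1)
    (sub_softThreshold_mono hlam1) z0
  have hself := tvTerm_le_sum_residual_mul_self hz0
  have hres := sum_residual_mul_le_tvTerm hlam2 hz0 (fun i => z0 i - s i)
  have hstar := sum_residual_mul_le_tvTerm hlam2 hz0 zstar
  have hmin := hzstar s
  have hsub : ∑ i, (lam1 * |s i| + (z0 i - s i) * (zstar i - s i)) ≤ ∑ i, lam1 * |zstar i| :=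
    Finset.sum_le_sum fun i _ => softThreshold_subgradient hlam1 (z0 i) (zstar i)
  rw [Finset.sum_add_distrib, ← Finset.mul_sum, ← Finset.mul_sum] at hsub
  have hexpand : 1 / 2 * ∑ i, (zstar i - s i) ^ 2
      = 1 / 2 * ∑ i, (zstar i - v i) ^ 2 - 1 / 2 * ∑ i, (s i - v i) ^ 2
        + ∑ i, (z0 i - s i) * (zstar i - s i) + ∑ i, (v i - z0 i) * zstar i
        - ∑ i, (v i - z0 i) * z0 i + ∑ i, (v i - z0 i) * (z0 i - s i) := by
    simp only [Finset.mul_sum, ← Finset.sum_sub_distrib, ← Finset.sum_add_distrib]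
    exact Finset.sum_congr rfl fun i _ => by ring
  have hsplit' : lam2 * tvTerm n z0
      = lam2 * tvTerm n s + lam2 * tvTerm n (fun i => z0 i - s i) := by
    rw [hsplit, mul_add]
  have hle : ∑ i, (zstar i - s i) ^ 2 ≤ 0 := by linarith
  have hzero := (Finset.sum_eq_zero_iff_of_nonneg fun i _ => sq_nonneg (zstar i - s i)).1
    (le_antisymm hle (Finset.sum_nonneg fun i _ => sq_nonneg _))
  intro i
  exact sub_eq_zero.1 (pow_eq_zero_iff two_ne_zero |>.1 (hzero i (Finset.mem_univ i)))

end
end
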